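/- For every integer c ≥ 7 and all integers a, b with 0 ≤ a < b ≤ ⌊c/2⌋, there exists a constant n_{a,b,c} (depending only on a, b, c) such that for every integer n > n_{a,b,c} one has N̄(a,c,n) > N̄(b,c,n). -/

import Mathlib

/-- An overpartition of `n`: a partition of `n` together with a chosen subset of its
distinct part sizes (the overlined parts). -/
def Overpartition (n : ℕ) : Type :=
  {P : n.Partition × Finset ℕ // P.2 ⊆ P.1.parts.toFinset}

/-- The Dyson rank of an overpartition: largest part minus number of parts. -/
def Overpartition.rank {n : ℕ} (P : Overpartition n) : ℤ :=
  (P.1.1.parts.sup : ℤ) - (P.1.1.parts.card : ℤ)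

/-- `nbarRank m n` is the number of overpartitions of `n` with rank `m`. -/
noncomputable def nbarRank (m : ℤ) (n : ℕ) : ℕ :=
  Nat.card {P : Overpartition n // P.rank = m}

/-- `nbar a c n` is the number of overpartitions of `n` with rank congruent to `a` mod `c`. -/
noncomputable def nbar (a : ℤ) (c : ℕ) (n : ℕ) : ℕ :=
  Nat.card {P : Overpartition n // P.rank ≡ a [ZMOD (c : ℤ)]}

/-- `pbar n` is the number of overpartitions of `n`. -/
noncomputable def pbar (n : ℕ) : ℕ := Nat.card (Overpartition n)

namespace OPR

section

open PowerSeries Finset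

/-- multisets of `k` positive parts, all `≤ m` -/
def MS : ℕ → ℕ → Finset (Multiset ℕ)
  | _, 0 => {0}
  | 0, _ + 1 => ∅
  | m + 1, k + 1 => MS m (k + 1) ∪ (MS (m + 1) k).image (fun s => (m + 1) ::ₘ s)
termination_by m k => (m, k)

lemma mem_MS (m k : ℕ) (s : Multiset ℕ) :
    s ∈ MS m k ↔ s.card = k ∧ ∀ x ∈ s, 1 ≤ x ∧ x ≤ m := by
  induction m, k using MS.induct generalizing s with
  | case1 m =>
    rw [MS]
    simp only [Finset.mem_singleton, Multiset.card_eq_zero]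
    constructor
    · rintro rfl; simp
    · exact fun h => h.1
  | case2 k =>
    rw [MS]
    simp only [Finset.notMem_empty, false_iff, not_and]
    intro h1 h2
    have : s ≠ 0 := by rintro rfl; simp at h1
    obtain ⟨x, hx⟩ := Multiset.exists_mem_of_ne_zero this
    have := h2 x hx
    omega
  | case3 m k ih1 ih2 =>
    rw [MS, Finset.mem_union, ih1, Finset.mem_image]
    constructor
    · rintro (⟨h1, h2⟩ | ⟨t, ht, rfl⟩)
      · exact ⟨h1, fun x hx => ⟨(h2 x hx).1, by have := (h2 x hx).2; omega⟩⟩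
      · rw [ih2] at ht
        refine ⟨by simp [ht.1], ?_⟩
        intro x hx
        rw [Multiset.mem_cons] at hx
        rcases hx with rfl | hx
        · omega
        · exact ht.2 x hx
    · rintro ⟨h1, h2⟩
      by_cases hm : m + 1 ∈ s
      · right
        refine ⟨s.erase (m + 1), ?_, Multiset.cons_erase hm⟩
        rw [ih2]
        refine ⟨by rw [Multiset.card_erase_of_mem hm, h1]; rfl, ?_⟩
        intro x hx
        exact h2 x (Multiset.mem_of_mem_erase hx)
      · left
        refine ⟨h1, fun x hx => ⟨(h2 x hx).1, ?_⟩⟩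
        have h3 := (h2 x hx).2
        have : x ≠ m + 1 := by rintro rfl; exact hm hx
        omega

/-- the weight of a multiset -/
noncomputable def W (q : ℂ) (s : Multiset ℕ) : ℂ := 2 ^ s.toFinset.card * q ^ s.sum

lemma W_cons (q : ℂ) (s : Multiset ℕ) (a : ℕ) :
    W q (a ::ₘ s) = q ^ a * (W q s + if a ∈ s then 0 else W q s) := by
  unfold W
  split_ifs with h
  · simp [h, pow_add]; ring
  · simp [h, pow_add, Finset.card_insert_of_notMem]; ring

/-- coefficients of the q-binomial series -/
noncomputable def cc (q : ℂ) (n : ℕ) : ℂ := ∏ i ∈ range n, (1 + q ^ i) / (1 - q ^ (i + 1))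

noncomputable def CC (q : ℂ) : PowerSeries ℂ := PowerSeries.mk (cc q)

lemma one_sub_ne {q : ℂ} (hq : ‖q‖ < 1) (n : ℕ) : 1 - q ^ (n + 1) ≠ 0 := by
  intro h
  have : ‖q ^ (n + 1)‖ = 1 := by rw [← sub_eq_zero.1 h]; simp
  rw [norm_pow] at this
  have h2 := pow_lt_one₀ (norm_nonneg q) hq (Nat.succ_ne_zero n)
  rw [Nat.succ_eq_add_one] at h2
  linarith

lemma one_add_ne {q : ℂ} (hq : ‖q‖ < 1) (n : ℕ) : 1 + q ^ (n + 1) ≠ 0 := by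
  intro h
  have : ‖q ^ (n + 1)‖ = 1 := by rw [eq_neg_of_add_eq_zero_right h]; simp
  rw [norm_pow] at this
  have h2 := pow_lt_one₀ (norm_nonneg q) hq (Nat.succ_ne_zero n)
  rw [Nat.succ_eq_add_one] at h2
  linarith

lemma cc_succ {q : ℂ} (hq : ‖q‖ < 1) (n : ℕ) :
    cc q (n + 1) * (1 - q ^ (n + 1)) = cc q n * (1 + q ^ n) := by
  unfold cc
  rw [prod_range_succ]
  field_simp [one_sub_ne hq n]

lemma CC_eq {q : ℂ} (hq : ‖q‖ < 1) :
    (1 - X) * CC q = (1 + X) * rescale q (CC q) := by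
  ext n
  rw [sub_mul, add_mul, one_mul, one_mul, map_sub, map_add]
  cases n with
  | zero => simp [CC]
  | succ n =>
    rw [coeff_succ_X_mul, coeff_succ_X_mul]
    simp only [coeff_rescale, CC, coeff_mk]
    linear_combination cc_succ hq n

lemma CC_eq' {q : ℂ} (hq : ‖q‖ < 1) (a : ℂ) :
    (1 - C a * X) * rescale a (CC q) = (1 + C a * X) * rescale (a * q) (CC q) := by
  have := congrArg (rescale a) (CC_eq hq)
  simp only [map_mul, map_sub, map_add, map_one, rescale_X, rescale_rescale] at this
  rw [mul_comm a q]
  exact this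

lemma coeff_zero_mul_split (A B : PowerSeries ℂ) :
    PowerSeries.coeff 0 (A * B) = PowerSeries.coeff 0 A * PowerSeries.coeff 0 B := by
  simp

lemma const_rescale_CC (q a : ℂ) : PowerSeries.coeff 0 (rescale a (CC q)) = 1 := by
  rw [coeff_rescale]; simp [CC, cc]

noncomputable def Ff (q : ℂ) (m : ℕ) : PowerSeries ℂ :=
  rescale q (CC q) * rescale (-q ^ (m + 1)) (CC q)

lemma one_sub_CX_ne (a : ℂ) : (1 - C a * X : PowerSeries ℂ) ≠ 0 := by
  intro h
  have := congrArg (PowerSeries.coeff 0) h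
  simp at this

lemma Ff_zero {q : ℂ} (hq : ‖q‖ < 1) : Ff q 0 = 1 := by
  have h1 := CC_eq' hq 1
  have h2 := CC_eq' hq (-1)
  set P := rescale (1:ℂ) (CC q) * rescale (-1:ℂ) (CC q) with hP
  have h3 : P = rescale q P := by
    have e : rescale q P = rescale (1 * q) (CC q) * rescale (-1 * q) (CC q) := by
      rw [hP, map_mul, rescale_rescale, rescale_rescale]
    rw [e]
    apply mul_left_cancel₀ (one_sub_CX_ne 1)
    apply mul_left_cancel₀ (one_sub_CX_ne (-1))
    have h4 := congrArg₂ (· * ·) h1 h2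
    simp only [map_neg, map_one] at h4 ⊢
    linear_combination h4
  have h5 : P = 1 := by
    ext n
    have h6 := congrArg (PowerSeries.coeff n) h3
    rw [coeff_rescale] at h6
    cases n with
    | zero => rw [hP, coeff_zero_mul_split, const_rescale_CC, const_rescale_CC]; simp
    | succ n =>
      have : (1 - q ^ (n + 1)) * (PowerSeries.coeff (n+1)) P = 0 := by linear_combination h6
      have := (mul_eq_zero.1 this).resolve_left (one_sub_ne hq n)
      rw [this, PowerSeries.coeff_one]; simp
  unfold Ff
  have : rescale q P = 1 := by rw [← h3, h5]
  rw [hP, map_mul, rescale_rescale, rescale_rescale] at this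
  simpa using this

lemma Ff_succ {q : ℂ} (hq : ‖q‖ < 1) (m : ℕ) :
    (1 - C (q ^ (m + 1)) * X) * Ff q (m + 1) = (1 + C (q ^ (m + 1)) * X) * Ff q m := by
  unfold Ff
  have := CC_eq' hq (-q ^ (m + 1))
  rw [show -q ^ (m + 1) * q = - q ^ (m + 1 + 1) by ring] at this
  simp only [map_neg] at this
  linear_combination (-rescale q (CC q)) * this

/-- second functional equation -/
lemma Ff_succ' {q : ℂ} (hq : ‖q‖ < 1) (m : ℕ) :
    (1 - C q * X) * Ff q (m + 1) = (1 + C q * X) * rescale q (Ff q m) := by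
  unfold Ff
  have := CC_eq' hq q
  rw [map_mul, rescale_rescale, rescale_rescale, show -q ^ (m + 1) * q = - q ^ (m + 1 + 1) by ring]
  linear_combination (rescale (-q ^ (m+1+1)) (CC q)) * this

lemma coeff_Ff_zero' (q : ℂ) (m : ℕ) : PowerSeries.coeff 0 (Ff q m) = 1 := by
  unfold Ff
  rw [coeff_zero_mul_split, const_rescale_CC, const_rescale_CC]; simp

lemma coeff_Ff_succ {q : ℂ} (hq : ‖q‖ < 1) (m k : ℕ) :
    PowerSeries.coeff (k+1) (Ff q (m+1)) = PowerSeries.coeff (k+1) (Ff q m)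
      + q ^ (m+1) * (PowerSeries.coeff k (Ff q (m+1)) + PowerSeries.coeff k (Ff q m)) := by
  have := congrArg (PowerSeries.coeff (k+1)) (Ff_succ hq m)
  simp only [sub_mul, add_mul, one_mul, map_sub, map_add, mul_assoc, coeff_C_mul,
    coeff_succ_X_mul] at this
  linear_combination this

lemma coeff_Ff_succ' {q : ℂ} (hq : ‖q‖ < 1) (m k : ℕ) :
    PowerSeries.coeff (k+1) (Ff q (m+1)) = q * PowerSeries.coeff k (Ff q (m+1))
      + q ^ (k+1) * (PowerSeries.coeff (k+1) (Ff q m) + PowerSeries.coeff k (Ff q m)) := by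
  have := congrArg (PowerSeries.coeff (k+1)) (Ff_succ' hq m)
  simp only [sub_mul, add_mul, one_mul, map_sub, map_add, mul_assoc, coeff_C_mul,
    coeff_succ_X_mul, coeff_rescale] at this
  linear_combination this

lemma sum_MS {q : ℂ} (hq : ‖q‖ < 1) (m k : ℕ) :
    ∑ s ∈ MS m k, W q s = PowerSeries.coeff k (Ff q m) := by
  induction m generalizing k with
  | zero =>
    cases k with
    | zero => rw [MS, coeff_Ff_zero']; simp [W]
    | succ k => rw [MS, Ff_zero hq]; simp [PowerSeries.coeff_one]
  | succ m ihm =>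
  induction k with
  | zero => rw [MS, coeff_Ff_zero']; simp [W]
  | succ k ih2 =>
    rw [coeff_Ff_succ hq, ← ihm, ← ih2]
    have hk : ∑ s ∈ MS m k, W q s = ∑ s ∈ MS (m+1) k, if m + 1 ∈ s then 0 else W q s := by
      rw [← Finset.sum_filter_add_sum_filter_not (MS (m+1) k) (fun s => m + 1 ∈ s)
        (fun s => if m + 1 ∈ s then 0 else W q s)]
      rw [Finset.sum_eq_zero (s := (MS (m+1) k).filter _), zero_add]
      swap
      · intro s hs; rw [if_pos (Finset.mem_filter.1 hs).2]
      rw [Finset.sum_congr rfl (fun s (hs : s ∈ Finset.filter (fun s => ¬ m + 1 ∈ s) (MS (m+1) k)) => if_neg (Finset.mem_filter.1 hs).2)]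
      apply Finset.sum_congr _ (fun _ _ => rfl)
      ext s
      rw [Finset.mem_filter, mem_MS, mem_MS]
      constructor
      · rintro ⟨h1, h2⟩
        refine ⟨⟨h1, fun x hx => ⟨(h2 x hx).1, by have := (h2 x hx).2; omega⟩⟩, ?_⟩
        intro h
        have := (h2 _ h).2
        omega
      · rintro ⟨⟨h1, h2⟩, h3⟩
        refine ⟨h1, fun x hx => ⟨(h2 x hx).1, ?_⟩⟩
        have h4 := (h2 x hx).2
        have : x ≠ m + 1 := by rintro rfl; exact h3 hx
        omega
    rw [← ihm, hk, MS, Finset.sum_union, Finset.sum_image, ← Finset.sum_add_distrib, Finset.mul_sum]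
    · simp only [W_cons]
    · intro a _ b _ h
      simpa using h
    · rw [Finset.disjoint_left]
      intro s hs hs'
      rw [mem_MS] at hs
      rw [Finset.mem_image] at hs'
      obtain ⟨t, _, rfl⟩ := hs'
      have := (hs.2 (m+1) (by simp)).2
      omega

end

end OPR

namespace OPR

section

open PowerSeries Finset

noncomputable def gg (q : ℂ) : ℕ → ℕ → ℂ
  | 0, k => if k = 0 then 1 else 0
  | m + 1, k => PowerSeries.coeff k (Ff q (m+1)) - PowerSeries.coeff k (Ff q m)

lemma sum_MS_sup {q : ℂ} (hq : ‖q‖ < 1) (m k : ℕ) :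
    ∑ s ∈ (MS m k).filter (fun s => s.sup = m), W q s = gg q m k := by
  cases m with
  | zero =>
    cases k with
    | zero => rw [MS]; simp [Finset.filter_singleton, gg, W]
    | succ k => rw [MS]; simp [gg]
  | succ m =>
    rw [gg, ← sum_MS hq, ← sum_MS hq, ← Finset.sum_filter_add_sum_filter_not (MS (m+1) k) (fun s => s.sup = m + 1)]
    have : (MS (m+1) k).filter (fun s => ¬ s.sup = m + 1) = MS m k := by
      ext s
      rw [Finset.mem_filter, mem_MS, mem_MS]
      constructor
      · rintro ⟨⟨h1, h2⟩, h3⟩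
        refine ⟨h1, fun x hx => ⟨(h2 x hx).1, ?_⟩⟩
        have h4 : s.sup ≤ m + 1 := Multiset.sup_le.2 fun x hx => (h2 x hx).2
        have h5 : x ≤ s.sup := Multiset.le_sup hx
        omega
      · rintro ⟨h1, h2⟩
        refine ⟨⟨h1, fun x hx => ⟨(h2 x hx).1, by have := (h2 x hx).2; omega⟩⟩, ?_⟩
        have h4 : s.sup ≤ m := Multiset.sup_le.2 fun x hx => (h2 x hx).2
        omega
    rw [this]; ring

lemma gg_recA {q : ℂ} (hq : ‖q‖ < 1) (m k : ℕ) :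
    gg q (m+2) (k+1) = q * gg q (m+2) k + q^(k+1) * (gg q (m+1) (k+1) + gg q (m+1) k) := by
  simp only [gg]
  linear_combination coeff_Ff_succ' hq (m+1) k - coeff_Ff_succ' hq m k

lemma gg_recB {q : ℂ} (hq : ‖q‖ < 1) (m k : ℕ) :
    gg q (m+2) (k+1) = q^(m+2) * gg q (m+2) k + q * gg q (m+1) (k+1) + q^(m+2) * gg q (m+1) k := by
  have h1 := Ff_succ hq m
  have h2 := Ff_succ hq (m+1)
  have h3 : (1 - C (q^(m+2)) * X) * (Ff q (m+2) - Ff q (m+1))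
      = C q * ((1 + C (q^(m+1)) * X) * (Ff q (m+1) - Ff q m)) := by
    apply mul_left_cancel₀ (one_sub_CX_ne (q^(m+1)))
    simp only [map_pow, pow_succ, map_mul] at h1 h2 ⊢
    linear_combination (1 - C q ^ m * C q * X) * h2 +
      (-C q * (1 + C q ^ m * C q * X) + 2 * C q ^ m * C q * C q * X) * h1
  have := congrArg (PowerSeries.coeff (k+1)) h3
  simp only [sub_mul, add_mul, one_mul, map_sub, map_add, mul_assoc, coeff_C_mul,
    coeff_succ_X_mul] at this
  simp only [gg]
  rw [show q^(m+2) = q * q^(m+1) by ring] at this ⊢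
  linear_combination this

lemma gg_one {q : ℂ} (hq : ‖q‖ < 1) (k : ℕ) : gg q 1 (k+1) = 2 * q^(k+1) := by
  have h0 : ∀ k, PowerSeries.coeff (k+1) (Ff q 0) = 0 := by
    intro k; rw [Ff_zero hq]; simp [PowerSeries.coeff_one]
  have : PowerSeries.coeff (k+1) (Ff q 1) = 2 * q^(k+1) := by
    induction k with
    | zero =>
      have := coeff_Ff_succ hq 0 0
      rw [h0, coeff_Ff_zero', coeff_Ff_zero'] at this
      simp only [zero_add] at this ⊢
      rw [this]; ring
    | succ k ih =>
      have := coeff_Ff_succ hq 0 (k+1)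
      rw [h0, h0] at this
      simp only [zero_add] at this ih ⊢
      rw [this, ih]; ring
  simp only [gg]
  rw [h0, zero_add, this, sub_zero]

lemma gg_one' {q : ℂ} (hq : ‖q‖ < 1) (m : ℕ) : gg q (m+1) 1 = 2 * q^(m+1) := by
  simp only [gg]
  have := coeff_Ff_succ hq m 0
  rw [coeff_Ff_zero', coeff_Ff_zero'] at this
  simp only [zero_add] at this
  rw [this]; ring

lemma gg_symm {q : ℂ} (hq : ‖q‖ < 1) (m k : ℕ) : gg q m k = gg q k m := by
  induction hN : m + k using Nat.strong_induction_on generalizing m k with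
  | _ N ih =>
  match m, k with
  | 0, 0 => rfl
  | 0, k + 1 => simp only [gg]; rw [coeff_Ff_zero', coeff_Ff_zero']; simp
  | m + 1, 0 => simp only [gg]; rw [coeff_Ff_zero', coeff_Ff_zero']; simp
  | 1, k + 1 => rw [gg_one hq, gg_one' hq]
  | m + 2, 1 => rw [gg_one hq, gg_one' hq]
  | m + 2, k + 2 =>
    rw [gg_recA hq m (k+1), gg_recB hq k (m+1), ih _ _ (m+2) (k+1) rfl, ih _ _ (m+1) (k+2) rfl,
      ih _ _ (m+1) (k+1) rfl]
    · ring
    all_goals omega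

lemma gg_formula (q : ℂ) (m k : ℕ) :
    gg q (m+1) k = ∑ p ∈ antidiagonal k,
      (-1)^p.2 * cc q p.2 * q^((m+1)*p.2) * (q^p.2 - 1) * (cc q p.1 * q^p.1) := by
  simp only [gg, Ff]
  rw [PowerSeries.coeff_mul, PowerSeries.coeff_mul, ← Finset.sum_sub_distrib]
  apply Finset.sum_congr rfl
  intro p _
  simp only [coeff_rescale, CC, coeff_mk]
  rw [neg_pow, neg_pow (q^(m+1))]
  ring

lemma tendsto_pow_shift {q : ℂ} (hq : ‖q‖ < 1) :
    Filter.Tendsto (fun n : ℕ => q^n) Filter.atTop (nhds 0) :=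
  tendsto_pow_atTop_nhds_zero_of_norm_lt_one hq

lemma summable_cc {q w : ℂ} (hq : ‖q‖ < 1) (hw : ‖w‖ < 1) :
    Summable (fun n => ‖cc q n * w^n‖) := by
  by_cases hw0 : w = 0
  · subst hw0
    apply summable_of_ne_finset_zero (s := {0})
    intro b hb
    have : b ≠ 0 := by simpa using hb
    simp [this]
  by_cases hv : ∃ N, cc q N = 0
  · obtain ⟨N, hN⟩ := hv
    apply summable_of_ne_finset_zero (s := range N)
    intro b hb
    have hb' : N ≤ b := by simpa using hb
    have : cc q b = 0 := by
      obtain ⟨d, rfl⟩ := Nat.exists_eq_add_of_le hb'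
      clear hb hb'
      induction d with
      | zero => simpa using hN
      | succ d ih =>
        have := cc_succ hq (N + d)
        rw [ih, zero_mul] at this
        exact (mul_eq_zero.1 this).resolve_right (one_sub_ne hq _)
    simp [this]
  push Not at hv
  apply summable_of_ratio_test_tendsto_lt_one hw
  · filter_upwards with n
    simp [hv n, hw0]
  · have h : Filter.Tendsto (fun n : ℕ => ‖(1 + q^n) / (1 - q^(n+1)) * w‖) Filter.atTop
        (nhds ‖(1 + (0:ℂ)) / (1 - 0) * w‖) := by
      apply Filter.Tendsto.norm
      apply Filter.Tendsto.mul_const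
      apply Filter.Tendsto.div
      · exact (tendsto_pow_shift hq).const_add _
      · exact (((tendsto_pow_shift hq).comp (Filter.tendsto_add_atTop_nat 1))).const_sub _
      · simp
    simp only [add_zero, sub_zero, div_one, one_mul] at h
    refine h.congr fun n => ?_
    rw [norm_norm, norm_norm, ← norm_div]
    congr 1
    have h1 := hv n
    have h2 : cc q (n+1) = cc q n * ((1 + q^n) / (1 - q^(n+1))) := by
      unfold cc; rw [prod_range_succ]
    rw [h2]
    field_simp
    ring

noncomputable def V (q w : ℂ) : ℂ := ∑' n, cc q n * w^n

lemma hasSum_V {q w : ℂ} (hq : ‖q‖ < 1) (hw : ‖w‖ < 1) :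
    HasSum (fun n => cc q n * w^n) (V q w) := (summable_cc hq hw).of_norm.hasSum

lemma V_eq {q w : ℂ} (hq : ‖q‖ < 1) (hw : ‖w‖ < 1) :
    V q w * (1 - w) = V q (q * w) * (1 + w) := by
  have hqw : ‖q * w‖ < 1 := by
    rw [norm_mul]; nlinarith [norm_nonneg q, norm_nonneg w]
  have h1 := hasSum_V hq hw
  have h2 := hasSum_V hq hqw
  have h3 := (hasSum_nat_add_iff' 1).2 h1
  have h4 := (hasSum_nat_add_iff' 1).2 h2
  have h5 := (h3.sub h4)
  have h6 := ((h1.add h2).mul_right w)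
  have : (fun n => cc q (n+1) * w^(n+1) - cc q (n+1) * (q*w)^(n+1)) =
      fun n => (cc q n * w^n + cc q n * (q*w)^n) * w := by
    funext n
    rw [mul_pow, mul_pow]
    linear_combination (w^(n+1)) * cc_succ hq n
  rw [this] at h5
  have h7 := h5.unique h6
  simp at h7
  linear_combination h7

lemma pow_norm_lt {q : ℂ} (hq : ‖q‖ < 1) (n : ℕ) : ‖q^(n+1)‖ < 1 := by
  rw [norm_pow]; exact pow_lt_one₀ (norm_nonneg q) hq (Nat.succ_ne_zero n)

lemma V_pow {q : ℂ} (hq : ‖q‖ < 1) (n : ℕ) :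
    V q (q^(n+1)) * ∏ j ∈ range n, (1 + q^(j+1)) = V q q * ∏ j ∈ range n, (1 - q^(j+1)) := by
  induction n with
  | zero => simp
  | succ n ih =>
    rw [prod_range_succ, prod_range_succ]
    have := V_eq hq (pow_norm_lt hq n)
    rw [show q * q^(n+1) = q^(n+1+1) by ring] at this
    linear_combination (1 - q^(n+1)) * ih - (∏ j ∈ range n, (1 + q^(j+1))) * this

lemma prod_add_ne {q : ℂ} (hq : ‖q‖ < 1) (n : ℕ) : ∏ j ∈ range n, (1 + q^(j+1)) ≠ 0 :=
  Finset.prod_ne_zero_iff.2 fun j _ => one_add_ne hq j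

lemma prod_sub_ne {q : ℂ} (hq : ‖q‖ < 1) (n : ℕ) : ∏ j ∈ range n, (1 - q^(j+1)) ≠ 0 :=
  Finset.prod_ne_zero_iff.2 fun j _ => one_sub_ne hq j

lemma cc_V {q : ℂ} (hq : ‖q‖ < 1) (n : ℕ) :
    cc q (n+1) * V q (q^(n+1+1)) = V q q * (2 / (1 + q^(n+1))) := by
  have h1 := V_pow hq (n+1)
  have h2 : cc q (n+1) * ∏ j ∈ range (n+1), (1 - q^(j+1)) = 2 * ∏ j ∈ range n, (1 + q^(j+1)) := by
    unfold cc
    rw [← Finset.prod_mul_distrib, Finset.prod_congr rfl (fun i _ => div_mul_cancel₀ (1 + q^i) (one_sub_ne hq i)),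
      Finset.prod_range_succ']
    ring
  rw [mul_div_assoc', eq_div_iff (one_add_ne hq n)]
  apply mul_right_cancel₀ (prod_add_ne hq n)
  rw [Finset.prod_range_succ] at h1
  linear_combination (cc q (n+1)) * h1 + V q q * h2

/-- V as limit of products -/
lemma V_tendsto {q : ℂ} (hq : ‖q‖ < 1) :
    Filter.Tendsto (fun n => ∏ j ∈ range n, ((1 + q^(j+1)) / (1 - q^(j+1)))) Filter.atTop (nhds (V q q)) := by
  have h1 : ∀ n, (∏ j ∈ range n, ((1 + q^(j+1)) / (1 - q^(j+1)))) * V q (q^(n+1)) = V q q := by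
    intro n
    rw [Finset.prod_div_distrib, div_mul_eq_mul_div, div_eq_iff (prod_sub_ne hq n)]
    linear_combination V_pow hq n
  have h2 : Filter.Tendsto (fun n => V q (q^(n+1))) Filter.atTop (nhds 1) := by
    have h3 : Filter.Tendsto (fun m => ∑' n, cc q n * (q^(m+1))^n) Filter.atTop
        (nhds (∑' n, if n = 0 then 1 else 0)) := by
      apply tendsto_tsum_of_dominated_convergence (bound := fun n => ‖cc q n * q^n‖) (summable_cc hq hq)
      · intro k
        cases k with
        | zero => simp [cc]
        | succ k =>
          have h4 := (((tendsto_pow_shift hq).comp (Filter.tendsto_add_atTop_nat 1)).pow (k+1)).const_mul (cc q (k+1))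
          simpa using h4
      · filter_upwards with m k
        rw [norm_mul, norm_mul, norm_pow, norm_pow, norm_pow]
        gcongr
        rw [pow_succ]
        exact mul_le_of_le_one_left (norm_nonneg q) (pow_le_one₀ (norm_nonneg q) hq.le)
    simpa [V] using h3
  have h5 := (tendsto_const_nhds (x := V q q)).div h2 one_ne_zero
  rw [div_one] at h5
  apply h5.congr'
  filter_upwards [h2.eventually_ne one_ne_zero] with n hn
  simp only [Pi.div_apply]
  rw [← h1 n, mul_div_assoc, div_self hn, mul_one]


end

end OPR

namespace OPR

section

open PowerSeries Finset

lemma norm_W (q : ℂ) (s : Multiset ℕ) : ‖W q s‖ = 2 ^ s.toFinset.card * ‖q‖ ^ s.sum := by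
  simp [W]

lemma norm_coeff_Ff_le {q : ℂ} (hq : ‖q‖ < 1) (m k : ℕ) :
    ‖PowerSeries.coeff k (Ff q m)‖ ≤ ∑ p ∈ antidiagonal k, ‖cc q p.1 * q^p.1‖ * ‖cc q p.2 * q^p.2‖ := by
  unfold Ff
  rw [PowerSeries.coeff_mul]
  refine (norm_sum_le _ _).trans (Finset.sum_le_sum fun p _ => ?_)
  simp only [coeff_rescale, CC, coeff_mk]
  rw [norm_mul, mul_comm (q^p.1)]
  gcongr 1
  rw [mul_comm, norm_mul, norm_mul]
  gcongr 1
  rw [norm_pow, norm_neg, norm_pow, norm_pow]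
  gcongr
  rw [pow_succ]
  exact mul_le_of_le_one_left (norm_nonneg q) (pow_le_one₀ (norm_nonneg q) hq.le)

lemma sum_coeff_Ff_le {q : ℂ} (hq : ‖q‖ < 1) (m K : ℕ) :
    ∑ k ∈ range K, ‖PowerSeries.coeff k (Ff q m)‖ ≤ (∑' n, ‖cc q n * q^n‖)^2 := by
  have hs := summable_cc hq hq
  have hs' : Summable fun n => ‖‖cc q n * q^n‖‖ := by simpa using hs
  rw [sq, tsum_mul_tsum_eq_tsum_sum_antidiagonal_of_summable_norm hs' hs']
  refine (Finset.sum_le_sum fun k _ => norm_coeff_Ff_le hq m k).trans ?_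
  apply Summable.sum_le_tsum
  · intro i _
    positivity
  · have := summable_norm_sum_mul_antidiagonal_of_summable_norm hs' hs'
    exact this.of_norm

/-- weight extended to all multisets -/
noncomputable def W0 (q : ℂ) (s : Multiset ℕ) : ℂ := if 0 ∈ s then 0 else W q s

lemma summable_W0 {q : ℂ} (hq : ‖q‖ < 1) : Summable (fun s => ‖W0 q s‖) := by
  have hq' : ‖((‖q‖ : ℝ) : ℂ)‖ < 1 := by simpa using hq
  apply summable_of_sum_le (c := (∑' n, ‖cc (‖q‖:ℂ) n * (‖q‖:ℂ)^n‖)^2)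
  · intro s; positivity
  intro u
  set M := u.sup (fun s => s.sup) with hM
  set K := u.sup (fun s => s.card) + 1 with hK
  refine le_trans ?_ (sum_coeff_Ff_le hq' M K)
  have h1 : ∀ k, ‖PowerSeries.coeff k (Ff (‖q‖:ℂ) M)‖ = ∑ s ∈ MS M k, ‖W0 q s‖ := by
    intro k
    rw [← sum_MS hq']
    have : ∑ s ∈ MS M k, W (‖q‖:ℂ) s = ((∑ s ∈ MS M k, ‖W0 q s‖ : ℝ) : ℂ) := by
      push_cast
      apply Finset.sum_congr rfl
      intro s hs
      have h0 : 0 ∉ s := fun h => by have := (((mem_MS _ _ _).1 hs).2 0 h).1; omega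
      rw [W0, if_neg h0, norm_W, W]
      push_cast; rfl
    rw [this, Complex.norm_real, Real.norm_of_nonneg (by positivity)]
  simp_rw [h1]
  rw [← Finset.sum_biUnion]
  · rw [← Finset.sum_filter_add_sum_filter_not u (fun s => 0 ∈ s)]
    rw [Finset.sum_eq_zero, zero_add]
    · apply Finset.sum_le_sum_of_subset_of_nonneg
      · intro s hs
        rw [Finset.mem_filter] at hs
        rw [Finset.mem_biUnion]
        refine ⟨s.card, ?_, ?_⟩
        · rw [Finset.mem_range, hK]
          have := Finset.le_sup (f := fun s : Multiset ℕ => s.card) hs.1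
          exact Nat.lt_succ_of_le this
        · rw [mem_MS]
          refine ⟨rfl, fun x hx => ⟨?_, ?_⟩⟩
          · rcases Nat.eq_zero_or_pos x with h | h
            · subst h; exact absurd hx hs.2
            · exact h
          · exact (Multiset.le_sup hx).trans (Finset.le_sup (f := fun s : Multiset ℕ => s.sup) hs.1)
      · intros; positivity
    · intro s hs
      rw [Finset.mem_filter] at hs
      simp [W0, hs.2]
  · intro k _ l _ hkl
    rw [Function.onFun, Finset.disjoint_left]
    intro s hs hs'
    rw [mem_MS] at hs hs'
    exact hkl (hs.1.symm.trans hs'.1)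

lemma hasSum_of_eq {ι : Type*} {f g : ι → ℂ} {a : ℂ} (h : HasSum g a) (e : ∀ i, f i = g i) :
    HasSum f a := by
  have : f = g := funext e
  rw [this]; exact h

/-- the total sum -/
noncomputable def TT (q : ℂ) (w : ℕ → ℕ → ℂ) : ℂ := ∑' s : Multiset ℕ, w s.sup s.card * W0 q s

lemma hasSum_TT {q : ℂ} (hq : ‖q‖ < 1) {w : ℕ → ℕ → ℂ} (hw : ∀ m k, ‖w m k‖ ≤ 1) :
    HasSum (fun s : Multiset ℕ => w s.sup s.card * W0 q s) (TT q w) := by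
  apply Summable.hasSum
  apply Summable.of_norm_bounded (summable_W0 hq)
  intro s
  rw [norm_mul]
  exact mul_le_of_le_one_left (norm_nonneg _) (hw _ _)

lemma hasSum_gg {q : ℂ} (hq : ‖q‖ < 1) {w : ℕ → ℕ → ℂ} (hw : ∀ m k, ‖w m k‖ ≤ 1) :
    HasSum (fun p : ℕ × ℕ => w p.1 p.2 * gg q p.1 p.2) (TT q w) := by
  have h := (hasSum_TT hq hw).tsum_fiberwise (fun s : Multiset ℕ => (s.sup, s.card))
  refine hasSum_of_eq h ?_
  rintro ⟨m, k⟩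
  rw [tsum_subtype ((fun s : Multiset ℕ => (s.sup, s.card)) ⁻¹' {(m, k)})
    (fun s : Multiset ℕ => w s.sup s.card * W0 q s)]
  rw [tsum_eq_sum (s := (MS m k).filter (fun s => s.sup = m))]
  · rw [← sum_MS_sup hq, Finset.mul_sum]
    apply Finset.sum_congr rfl
    intro s hs
    rw [Finset.mem_filter] at hs
    have h1 := (mem_MS _ _ _).1 hs.1
    have h0 : 0 ∉ s := fun h => by have := (h1.2 0 h).1; omega
    rw [Set.indicator_of_mem]
    · rw [hs.2, h1.1, W0, if_neg h0]
    · simp [hs.2, h1.1]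
  · intro s hs
    by_cases h1 : s ∈ (fun s : Multiset ℕ => (s.sup, s.card)) ⁻¹' {(m, k)}
    · rw [Set.indicator_of_mem h1]
      simp only [Set.mem_preimage, Set.mem_singleton_iff, Prod.mk.injEq] at h1
      by_cases h0 : 0 ∈ s
      · simp [W0, h0]
      · exfalso
        apply hs
        rw [Finset.mem_filter, mem_MS]
        refine ⟨⟨h1.2, fun x hx => ⟨?_, ?_⟩⟩, h1.1⟩
        · rcases Nat.eq_zero_or_pos x with h | h
          · subst h; exact absurd hx h0
          · exact h
        · rw [← h1.1]; exact Multiset.le_sup hx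
    · rw [Set.indicator_of_notMem h1]

lemma hasSum_part {q : ℂ} (hq : ‖q‖ < 1) {w : ℕ → ℕ → ℂ} (hw : ∀ m k, ‖w m k‖ ≤ 1) :
    HasSum (fun n : ℕ => (∑ p : n.Partition, 2 ^ p.parts.toFinset.card * w p.parts.sup p.parts.card) * q^n)
      (TT q w) := by
  have h := (hasSum_TT hq hw).tsum_fiberwise (fun s : Multiset ℕ => s.sum)
  refine hasSum_of_eq h ?_
  intro n
  rw [tsum_subtype ((fun s : Multiset ℕ => s.sum) ⁻¹' {n})
    (fun s : Multiset ℕ => w s.sup s.card * W0 q s)]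
  have hinj : Function.Injective (fun p : n.Partition => p.parts) := by
    intro p p' h; exact Nat.Partition.ext h
  rw [← hinj.tsum_eq, tsum_fintype, Finset.sum_mul]
  · apply Finset.sum_congr rfl
    intro p _
    have h0 : 0 ∉ p.parts := fun h => by have := p.parts_pos h; omega
    rw [Set.indicator_of_mem]
    · rw [W0, if_neg h0, W, p.parts_sum]; ring
    · simp [p.parts_sum]
  · intro s hs
    rw [Function.mem_support] at hs
    have h1 : s ∈ (fun s : Multiset ℕ => s.sum) ⁻¹' {n} := by
      by_contra h1; exact hs (Set.indicator_of_notMem h1 _)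
    rw [Set.indicator_of_mem h1] at hs
    have h0 : 0 ∉ s := by
      intro h0; apply hs; simp [W0, h0]
    refine ⟨⟨s, ?_, h1⟩, rfl⟩
    intro i hi
    rcases Nat.eq_zero_or_pos i with h | h
    · subst h; exact absurd hi h0
    · exact h

/-- the value at `w = 1` -/
lemma TT_one {q : ℂ} (hq : ‖q‖ < 1) : TT q (fun _ _ => 1) = V q q := by
  have h := hasSum_gg hq (w := fun _ _ => 1) (by simp)
  simp only [one_mul] at h
  have h' : HasSum (fun p : ℕ × ℕ => gg q p.2 p.1) (TT q fun _ _ => 1) :=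
    (Equiv.prodComm ℕ ℕ).hasSum_iff.2 h
  have hf : ∀ k, HasSum (fun m => gg q m k) (cc q k * q^k) := by
    intro k
    have hs : Summable (fun m => gg q m k) := h'.summable.prod_factor k
    have h1 := (hs.hasSum).tendsto_sum_nat
    have h2 := h1.comp (Filter.tendsto_add_atTop_nat 1)
    have h3 : ∀ M, ∑ m ∈ range (M+1), gg q m k = PowerSeries.coeff k (Ff q M) := by
      intro M
      induction M with
      | zero => simp [gg, Ff_zero hq, PowerSeries.coeff_one]
      | succ M ih => rw [Finset.sum_range_succ, ih]; simp [gg]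
    have h4 : Filter.Tendsto (fun M => PowerSeries.coeff k (Ff q M)) Filter.atTop (nhds (cc q k * q^k)) := by
      unfold Ff
      simp only [PowerSeries.coeff_mul, coeff_rescale, CC, coeff_mk]
      have : cc q k * q^k = ∑ p ∈ antidiagonal k, q^p.1 * cc q p.1 * ((if p.2 = 0 then 1 else 0) * cc q p.2) := by
        rw [Finset.sum_eq_single (k, 0)]
        · simp [cc]; ring
        · rintro ⟨a, b⟩ hab hne
          have hab : a + b = k := by simpa using hab
          have : b ≠ 0 := by
            rintro rfl; apply hne; simp at hab; simp [hab]
          simp [this]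
        · simp
      rw [this]
      apply tendsto_finsetSum
      rintro ⟨a, b⟩ _
      apply Filter.Tendsto.const_mul
      apply Filter.Tendsto.mul_const
      cases b with
      | zero => simp
      | succ b =>
        have := ((((tendsto_pow_shift hq).comp (Filter.tendsto_add_atTop_nat 1)).neg).pow (b+1))
        simpa using this
    have h5 : (fun M => ∑ m ∈ range (M+1), gg q m k) = fun M => PowerSeries.coeff k (Ff q M) := funext h3
    have h6 : Filter.Tendsto (fun M => ∑ m ∈ range (M+1), gg q m k) Filter.atTop (nhds (∑' m, gg q m k)) := h2
    rw [h5] at h6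
    rw [← tendsto_nhds_unique h6 h4]
    exact hs.hasSum
  have h7 := h'.prod_fiberwise hf
  exact h7.unique (hasSum_V hq hq)


end

end OPR

namespace OPR

section

open PowerSeries Finset

noncomputable def uu (q : ℂ) (r : ℕ) (p : ℕ × ℕ) : ℂ :=
  (-1)^p.2 * cc q p.2 * q^((p.1+p.2+r)*p.2) * (q^p.2 - 1) * (cc q p.1 * q^p.1)

lemma summable_uu {q : ℂ} (hq : ‖q‖ < 1) (r : ℕ) : Summable (uu q r) := by
  have hs := summable_cc hq hq
  have h2 := (hs.mul_of_nonneg hs (fun _ => norm_nonneg _) (fun _ => norm_nonneg _)).mul_left 2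
  apply Summable.of_norm_bounded h2
  rintro ⟨j, n⟩
  unfold uu
  simp only [norm_mul, norm_pow, norm_neg, norm_one, one_pow, one_mul]
  cases n with
  | zero => simp; positivity
  | succ n =>
    have h3 : ‖q‖^((j+(n+1)+r)*(n+1)) ≤ ‖q‖^(n+1) := by
      apply pow_le_pow_of_le_one (norm_nonneg q) hq.le
      nlinarith
    have h4 : ‖q^(n+1) - 1‖ ≤ 2 := by
      refine (norm_sub_le _ _).trans ?_
      have := pow_norm_lt hq n
      simp only [norm_one]; linarith
    calc ‖cc q (n+1)‖ * ‖q‖^((j+(n+1)+r)*(n+1)) * ‖q^(n+1) - 1‖ * (‖cc q j‖ * ‖q‖^j)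
        ≤ ‖cc q (n+1)‖ * ‖q‖^(n+1) * 2 * (‖cc q j‖ * ‖q‖^j) := by gcongr
      _ = _ := by ring

noncomputable def tt (q : ℂ) (r n : ℕ) : ℂ :=
  2 * (-1)^(n+1) * q^((n+1)^2 + r*(n+1)) * (q^(n+1) - 1) / (1 + q^(n+1))

lemma one_add_norm_ge {q : ℂ} (hq : ‖q‖ < 1) (n : ℕ) : 1 - ‖q‖ ≤ ‖1 + q^(n+1)‖ := by
  have h1 : ‖q^(n+1)‖ ≤ ‖q‖ := by
    rw [norm_pow, pow_succ]
    exact mul_le_of_le_one_left (norm_nonneg q) (pow_le_one₀ (norm_nonneg q) hq.le)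
  have h2 := norm_sub_norm_le (1:ℂ) (-q^(n+1))
  rw [norm_neg, norm_one, sub_neg_eq_add] at h2
  linarith

lemma norm_tt_le {q : ℂ} (hq : ‖q‖ < 1) (r n : ℕ) :
    ‖tt q r n‖ ≤ 4 / (1 - ‖q‖) * (‖q‖^r * ‖q‖^n) := by
  unfold tt
  rw [norm_div]
  simp only [norm_mul, norm_pow, norm_neg, norm_one, one_pow, mul_one]
  have h0 : 0 < 1 - ‖q‖ := by linarith
  have h4 : ‖q^(n+1) - 1‖ ≤ 2 := by
    refine (norm_sub_le _ _).trans ?_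
    have := pow_norm_lt hq n
    simp only [norm_one]; linarith
  have h3 : ‖q‖^((n+1)^2 + r*(n+1)) ≤ ‖q‖^(r+n) := by
    apply pow_le_pow_of_le_one (norm_nonneg q) hq.le
    nlinarith
  calc ‖(2:ℂ)‖ * ‖q‖^((n+1)^2 + r*(n+1)) * ‖q^(n+1) - 1‖ / ‖1 + q^(n+1)‖
      ≤ 2 * ‖q‖^(r+n) * 2 / (1 - ‖q‖) := by
        gcongr
        · simp
        · exact one_add_norm_ge hq n
    _ = _ := by rw [pow_add]; ring

lemma hasSum_Nr {q : ℂ} (hq : ‖q‖ < 1) (r : ℕ) :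
    HasSum (fun k => gg q (k + r) k) ((if r = 0 then 1 else 0) + V q q * ∑' n, tt q r n) := by
  have hu := (summable_uu hq r).hasSum
  set U := ∑' p, uu q r p with hU
  -- by n
  have h1 : HasSum (fun n => (-1)^n * cc q n * q^(n^2 + r*n) * (q^n - 1) * V q (q^(n+1))) U := by
    have hu' : HasSum (fun p : ℕ × ℕ => uu q r (p.2, p.1)) U := (Equiv.prodComm ℕ ℕ).hasSum_iff.2 hu
    apply hu'.prod_fiberwise
    intro n
    have := (hasSum_V hq (pow_norm_lt hq n)).mul_left ((-1)^n * cc q n * q^(n^2 + r*n) * (q^n - 1))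
    refine hasSum_of_eq this ?_
    intro j
    unfold uu
    ring
  have h2 : HasSum (fun n => V q q * tt q r n) U := by
    have h3 := (hasSum_nat_add_iff' 1).2 h1
    simp only [Finset.range_one, Finset.sum_singleton, pow_zero, sub_self, mul_zero, zero_mul, sub_zero] at h3
    refine hasSum_of_eq h3 ?_
    intro n
    have e : (-1) ^ (n + 1) * cc q (n + 1) * q ^ ((n + 1) ^ 2 + r * (n + 1)) * (q ^ (n + 1) - 1) * V q (q ^ (n + 1 + 1)) = (-1)^(n+1) * q^((n+1)^2+r*(n+1)) * (q^(n+1)-1) * (cc q (n+1) * V q (q^(n+1+1))) := by ring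
    rw [e, cc_V hq]
    unfold tt
    ring
  have h4 : U = V q q * ∑' n, tt q r n := by rw [← h2.tsum_eq, tsum_mul_left]
  rw [← h4]
  have h5 : HasSum (fun k => ∑ p ∈ antidiagonal k, uu q r p) U := by
    have h6 := (Finset.HasAntidiagonal.sigmaAntidiagonalEquivProd (A := ℕ)).hasSum_iff.2 hu
    have h7 := h6.sigma (g := fun k => ∑ p ∈ antidiagonal k, uu q r p) (fun k => by
      have := Finset.hasSum (antidiagonal k) (uu q r)
      exact this)
    exact h7
  have h8 : HasSum (fun k : ℕ => if k = 0 then (if r = 0 then (1:ℂ) else 0) else 0) (if r = 0 then 1 else 0) :=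
    hasSum_ite_eq 0 _
  refine hasSum_of_eq (h8.add h5) ?_
  intro k
  have key : ∀ m, m + 1 = k + r → gg q (m + 1) k = ∑ p ∈ antidiagonal k, uu q r p := by
    intro m hm
    rw [gg_formula]
    apply Finset.sum_congr rfl
    rintro ⟨j, n⟩ hp
    have hp' : j + n = k := by simpa using hp
    simp only [uu]
    rw [hm, ← hp']
  by_cases hk : k = 0
  · subst hk
    by_cases hr : r = 0
    · subst hr; simp [gg, uu]
    · obtain ⟨r', rfl⟩ := Nat.exists_eq_succ_of_ne_zero hr
      rw [if_pos rfl, if_neg hr, zero_add, ← key r' (by omega)]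
      rw [zero_add]
  · obtain ⟨k', rfl⟩ := Nat.exists_eq_succ_of_ne_zero hk
    rw [if_neg hk, zero_add, ← key (k' + r) (by simp; omega)]
    congr 1; simp; omega

/-- regrouping a sum over pairs by difference -/
lemma hasSum_split {f : ℕ × ℕ → ℂ} {T : ℂ} (h : HasSum f T) :
    ∃ A B, HasSum (fun p : ℕ × ℕ => f (p.2 + p.1, p.2)) A ∧
      HasSum (fun p : ℕ × ℕ => f (p.2, p.2 + (p.1 + 1))) B ∧ A + B = T := by
  have i1 : Function.Injective (fun p : ℕ × ℕ => (p.2 + p.1, p.2)) := by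
    rintro ⟨a, b⟩ ⟨c, d⟩ h; simp at h ⊢; omega
  have i2 : Function.Injective (fun p : ℕ × ℕ => (p.2, p.2 + (p.1 + 1))) := by
    rintro ⟨a, b⟩ ⟨c, d⟩ h; simp at h ⊢; omega
  have s1 := (h.summable.comp_injective i1).hasSum
  have s2 := (h.summable.comp_injective i2).hasSum
  refine ⟨_, _, s1, s2, ?_⟩
  have r1 := i1.hasSum_range_iff.2 s1
  have r2 := i2.hasSum_range_iff.2 s2
  have hc : IsCompl (Set.range (fun p : ℕ × ℕ => (p.2 + p.1, p.2)))
      (Set.range (fun p : ℕ × ℕ => (p.2, p.2 + (p.1 + 1)))) := by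
    constructor
    · rw [Set.disjoint_left]
      rintro x ⟨⟨a, b⟩, rfl⟩ ⟨⟨c, d⟩, h⟩
      simp at h; omega
    · rw [codisjoint_iff_le_sup]
      rintro ⟨m, k⟩ _
      rcases le_or_gt k m with hmk | hmk
      · left; exact ⟨(m - k, k), by simp; omega⟩
      · right; exact ⟨(k - m - 1, m), by simp; omega⟩
  exact (r1.add_isCompl hc r2).unique h

lemma geom_cos {x : ℂ} (hx : ‖x‖ < 1) (φ : ℝ) :
    HasSum (fun r : ℕ => (Real.cos (φ * r) : ℂ) * x^r)
      ((1 - x * Real.cos φ) / (1 - 2 * Real.cos φ * x + x^2)) ∧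
      (1 - 2 * Real.cos φ * x + x^2) ≠ 0 ∧
      (1 - ‖x‖)^2 ≤ ‖1 - 2 * Real.cos φ * x + x^2‖ := by
  set ζ := Complex.exp (φ * Complex.I) with hζ
  set ξ := Complex.exp (-(φ * Complex.I)) with hξ
  have hζξ : ζ * ξ = 1 := by rw [hζ, hξ, ← Complex.exp_add]; simp
  have hcos : (Real.cos φ : ℂ) = (ζ + ξ) / 2 := by
    rw [Complex.ofReal_cos, Complex.cos, hζ, hξ]; simp [neg_mul]
  have n1 : ‖ζ‖ = 1 := Complex.norm_exp_ofReal_mul_I φ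
  have n2 : ‖ξ‖ = 1 := by
    have := Complex.norm_exp_ofReal_mul_I (-φ)
    rw [hξ]; simpa using this
  have h1 : ‖ζ * x‖ < 1 := by rw [norm_mul, n1, one_mul]; exact hx
  have h2 : ‖ξ * x‖ < 1 := by rw [norm_mul, n2, one_mul]; exact hx
  have g1 := hasSum_geometric_of_norm_lt_one h1
  have g2 := hasSum_geometric_of_norm_lt_one h2
  have hfac : 1 - 2 * Real.cos φ * x + x^2 = (1 - ζ * x) * (1 - ξ * x) := by
    rw [hcos]; linear_combination (-x^2) * hζξ
  have b1 : 1 - ‖x‖ ≤ ‖1 - ζ * x‖ := by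
    have := norm_sub_norm_le 1 (ζ * x)
    rw [norm_mul, n1, norm_one, one_mul] at this; exact this
  have b2 : 1 - ‖x‖ ≤ ‖1 - ξ * x‖ := by
    have := norm_sub_norm_le 1 (ξ * x)
    rw [norm_mul, n2, norm_one, one_mul] at this; exact this
  have b0 : 0 < 1 - ‖x‖ := by linarith
  have z1 : 1 - ζ * x ≠ 0 := norm_pos_iff.1 (by linarith)
  have z2 : 1 - ξ * x ≠ 0 := norm_pos_iff.1 (by linarith)
  refine ⟨?_, ?_, ?_⟩
  · have := (g1.add g2).mul_left (1/2)
    have e : (1/2 : ℂ) * ((1 - ζ * x)⁻¹ + (1 - ξ * x)⁻¹) =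
        (1 - x * Real.cos φ) / (1 - 2 * Real.cos φ * x + x^2) := by
      rw [hfac, hcos, eq_div_iff (mul_ne_zero z1 z2)]
      have y1 := inv_mul_cancel₀ z1
      have y2 := inv_mul_cancel₀ z2
      linear_combination (1/2) * (1 - ξ * x) * y1 + (1/2) * (1 - ζ * x) * y2
    rw [e] at this
    refine hasSum_of_eq this ?_
    intro r
    have : (Real.cos (φ * r) : ℂ) = (ζ^r + ξ^r)/2 := by
      rw [Complex.ofReal_cos, Complex.cos, hζ, hξ, ← Complex.exp_nat_mul, ← Complex.exp_nat_mul]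
      push_cast
      congr 3 <;> ring
    rw [this, mul_pow, mul_pow]; ring
  · rw [hfac]; exact mul_ne_zero z1 z2
  · rw [hfac, norm_mul, sq]; gcongr

noncomputable def wcos (φ : ℝ) (m k : ℕ) : ℂ := (Real.cos (φ * ((m:ℝ) - k)) : ℂ)

lemma wcos_le (φ : ℝ) (m k : ℕ) : ‖wcos φ m k‖ ≤ 1 := by
  unfold wcos; rw [Complex.norm_real]; exact Real.abs_cos_le_one _

lemma TT_cos {q : ℂ} (hq : ‖q‖ < 1) (φ : ℝ) :
    TT q (wcos φ) = 1 - V q q * ∑' n : ℕ, 2 * (-1)^(n+1) * q^((n+1)^2) * (1 - q^(n+1))^2 /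
      (1 - 2 * Real.cos φ * q^(n+1) + (q^(n+1))^2) := by
  obtain ⟨A, B, hA, hB, hAB⟩ := hasSum_split (hasSum_gg hq (wcos_le φ))
  have hA' := hA.prod_fiberwise (g := fun r : ℕ => (Real.cos (φ * r) : ℂ) * ((if r = 0 then 1 else 0) + V q q * ∑' n, tt q r n)) (by
    intro r
    refine hasSum_of_eq ((hasSum_Nr hq r).mul_left _) ?_
    intro k; simp [wcos])
  have hB' := hB.prod_fiberwise (g := fun r : ℕ => (Real.cos (φ * (r+1 : ℕ)) : ℂ) * (V q q * ∑' n, tt q (r+1) n)) (by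
    intro r
    have := (hasSum_Nr hq (r+1)).mul_left (Real.cos (φ * (r+1 : ℕ)) : ℂ)
    rw [if_neg (Nat.succ_ne_zero r), zero_add] at this
    refine hasSum_of_eq this ?_
    intro k
    rw [gg_symm hq]
    simp only [wcos]
    congr 2
    rw [← Real.cos_neg]
    congr 1; push_cast; ring)
  have hA0 : HasSum (fun r : ℕ => if r = 0 then (1:ℂ) else 0) 1 := hasSum_ite_eq 0 1
  have hA'' := hA'.sub hA0
  have e1 : ∀ r : ℕ, (Real.cos (φ * r) : ℂ) * (V q q * ∑' n, tt q r n) =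
    (Real.cos (φ * r) : ℂ) * ((if r = 0 then 1 else 0) + V q q * ∑' n, tt q r n) - (if r = 0 then (1:ℂ) else 0) := by
    intro r
    split_ifs with h
    · subst h; simp
    · simp
  have hA3 := hasSum_of_eq hA'' e1
  have hsum := hA3
  -- the double sum
  set G : ℕ × ℕ → ℂ := fun p => (Real.cos (φ * p.1) : ℂ) * (V q q * tt q p.1 p.2) with hG
  have hGs : Summable G := by
    have hg := summable_geometric_of_lt_one (norm_nonneg q) hq
    have := (hg.mul_of_nonneg hg (fun _ => by positivity) (fun _ => by positivity)).mul_left (‖V q q‖ * (4 / (1 - ‖q‖)))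
    apply Summable.of_norm_bounded this
    rintro ⟨r, n⟩
    simp only [hG]
    rw [norm_mul, norm_mul, Complex.norm_real]
    calc _ ≤ 1 * (‖V q q‖ * (4 / (1 - ‖q‖) * (‖q‖^r * ‖q‖^n))) := by
          gcongr
          · exact Real.abs_cos_le_one _
          · exact norm_tt_le hq r n
      _ = _ := by ring
  have hGs' : Summable (fun p : ℕ × ℕ => G (p.1 + 1, p.2)) :=
    hGs.comp_injective (i := fun p : ℕ × ℕ => (p.1 + 1, p.2)) (by rintro ⟨a, b⟩ ⟨c, d⟩ h; simpa using h)
  have eA : A - 1 = ∑' p, G p := by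
    have h1 := hGs.hasSum.prod_fiberwise (g := fun r : ℕ => (Real.cos (φ * r) : ℂ) * (V q q * ∑' n, tt q r n)) (by
      intro r
      have := (hGs.prod_factor r).hasSum
      have e : ∑' c, G (r, c) = (Real.cos (φ * r) : ℂ) * (V q q * ∑' n, tt q r n) := by
        simp only [hG]; rw [tsum_mul_left, tsum_mul_left]
      rw [e] at this; exact this)
    exact hA3.unique h1
  have eB : B = ∑' p : ℕ × ℕ, G (p.1 + 1, p.2) := by
    have h1 := hGs'.hasSum.prod_fiberwise (g := fun r : ℕ => (Real.cos (φ * (r+1 : ℕ)) : ℂ) * (V q q * ∑' n, tt q (r+1) n)) (by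
      intro r
      have := (hGs'.prod_factor r).hasSum
      have e : ∑' c, G (r+1, c) = (Real.cos (φ * (r+1 : ℕ)) : ℂ) * (V q q * ∑' n, tt q (r+1) n) := by
        simp only [hG]; rw [tsum_mul_left, tsum_mul_left]
      simp only at this
      rw [e] at this; exact this)
    exact hB'.unique h1
  -- other order
  set co : ℕ → ℂ := fun n => V q q * (2 * (-1)^(n+1) * q^((n+1)^2) * (q^(n+1) - 1) / (1 + q^(n+1))) with hco
  have hGco : ∀ r n, G (r, n) = co n * ((Real.cos (φ * r) : ℂ) * (q^(n+1))^r) := by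
    intro r n
    simp only [hG, hco, tt]
    rw [pow_add q ((n+1)^2), mul_comm r, pow_mul q (n+1) r]
    ring
  have o1 : HasSum (fun n => co n * ((1 - q^(n+1) * Real.cos φ) / (1 - 2 * Real.cos φ * q^(n+1) + (q^(n+1))^2))) (∑' p, G p) := by
    have h1 : HasSum (fun p : ℕ × ℕ => G (p.2, p.1)) (∑' p, G p) := (Equiv.prodComm ℕ ℕ).hasSum_iff.2 hGs.hasSum
    apply h1.prod_fiberwise
    intro n
    refine hasSum_of_eq ((geom_cos (pow_norm_lt hq n) φ).1.mul_left (co n)) ?_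
    intro r; exact hGco r n
  have o2 : HasSum (fun n => co n * ((1 - q^(n+1) * Real.cos φ) / (1 - 2 * Real.cos φ * q^(n+1) + (q^(n+1))^2) - 1)) (∑' p : ℕ × ℕ, G (p.1 + 1, p.2)) := by
    have h1 : HasSum (fun p : ℕ × ℕ => G (p.2 + 1, p.1)) (∑' p : ℕ × ℕ, G (p.1 + 1, p.2)) :=
      (Equiv.prodComm ℕ ℕ).hasSum_iff.2 hGs'.hasSum
    apply h1.prod_fiberwise
    intro n
    have h2 := (hasSum_nat_add_iff' 1).2 (geom_cos (pow_norm_lt hq n) φ).1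
    simp only [Finset.range_one, Finset.sum_singleton, Nat.cast_zero, mul_zero, Real.cos_zero, pow_zero, mul_one, Complex.ofReal_one] at h2
    refine hasSum_of_eq (h2.mul_left (co n)) ?_
    intro r; exact hGco (r+1) n
  have o3 := (o1.add o2)
  rw [← eA, ← eB] at o3
  have : TT q (wcos φ) - 1 = A - 1 + B := by rw [← hAB]; ring
  have o4 : HasSum (fun n : ℕ => -V q q * (2 * (-1)^(n+1) * q^((n+1)^2) * (1 - q^(n+1))^2 /
      (1 - 2 * Real.cos φ * q^(n+1) + (q^(n+1))^2))) (TT q (wcos φ) - 1) := by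
    rw [this]
    refine hasSum_of_eq o3 ?_
    intro n
    simp only [hco]
    have z1 := (geom_cos (pow_norm_lt hq n) φ).2.1
    have z2 := one_add_ne hq n
    have z2' : 1 + q^(n+1) ≠ 0 := z2
    generalize q^(n+1) = x at z1 z2' ⊢
    generalize (Real.cos φ : ℂ) = κ at z1 ⊢
    generalize hD : 1 - 2 * κ * x + x^2 = D at z1 ⊢
    field_simp
    rw [← hD]
    ring
  have o5 := o4.tsum_eq
  rw [tsum_mul_left] at o5
  linear_combination -o5


end

end OPR

namespace OPR

section

open PowerSeries Finset

lemma nbar_eq (a : ℤ) (c n : ℕ) : (nbar a c n : ℂ) = ∑ p : n.Partition, 2 ^ p.parts.toFinset.card *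
    (if ((p.parts.sup : ℤ) - (p.parts.card : ℤ)) ≡ a [ZMOD (c : ℤ)] then (1:ℂ) else 0) := by
  classical
  have e : {P : Overpartition n // P.rank ≡ a [ZMOD (c : ℤ)]} ≃
      (Σ p : {p : n.Partition // ((p.parts.sup : ℤ) - (p.parts.card : ℤ)) ≡ a [ZMOD (c : ℤ)]},
        {s : Finset ℕ // s ∈ p.1.parts.toFinset.powerset}) :=
    { toFun := fun P => ⟨⟨P.1.1.1, P.2⟩, ⟨P.1.1.2, Finset.mem_powerset.2 P.1.2⟩⟩
      invFun := fun x => ⟨⟨(x.1.1, x.2.1), Finset.mem_powerset.1 x.2.2⟩, x.1.2⟩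
      left_inv := fun P => rfl
      right_inv := fun x => rfl }
  unfold nbar
  rw [Nat.card_congr e, Nat.card_eq_fintype_card, Fintype.card_sigma]
  simp only [Fintype.card_coe, Finset.card_powerset]
  push_cast
  simp only [mul_ite, mul_one, mul_zero]
  rw [← Finset.sum_filter]
  exact (Finset.sum_subtype _ (by simp) (fun p : n.Partition => (2:ℂ)^p.parts.toFinset.card)).symm

lemma TT_transpose {q : ℂ} (hq : ‖q‖ < 1) {w : ℕ → ℕ → ℂ} (hw : ∀ m k, ‖w m k‖ ≤ 1) :
    TT q (fun m k => w k m) = TT q w := by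
  have h1 := hasSum_gg hq hw
  have h2 := hasSum_gg hq (w := fun m k => w k m) (fun m k => hw k m)
  have h3 := (Equiv.prodComm ℕ ℕ).hasSum_iff.2 h1
  refine h2.unique (hasSum_of_eq h3 ?_)
  rintro ⟨m, k⟩
  simp only [Function.comp, Equiv.prodComm_apply, Prod.swap]
  rw [gg_symm hq]

lemma TT_sum {q : ℂ} (hq : ‖q‖ < 1) {ι : Type*} (s : Finset ι) (l : ι → ℂ) (w : ι → ℕ → ℕ → ℂ)
    (hw : ∀ i m k, ‖w i m k‖ ≤ 1) (w' : ℕ → ℕ → ℂ) (hw' : ∀ m k, ‖w' m k‖ ≤ 1)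
    (h : ∀ m k, w' m k = ∑ i ∈ s, l i * w i m k) :
    TT q w' = ∑ i ∈ s, l i * TT q (w i) := by
  have h1 := hasSum_TT hq hw'
  have h2 : HasSum (fun s' : Multiset ℕ => ∑ i ∈ s, l i * (w i s'.sup s'.card * W0 q s')) (∑ i ∈ s, l i * TT q (w i)) :=
    hasSum_sum (fun i _ => (hasSum_TT hq (hw i)).mul_left (l i))
  refine h1.unique (hasSum_of_eq h2 ?_)
  intro i
  rw [h, Finset.sum_mul]
  exact Finset.sum_congr rfl fun j _ => by ring

lemma orth (c : ℕ) (hc : 0 < c) (k : ℤ) :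
    ∑ j ∈ range c, Real.cos (2 * Real.pi * j / c * k) = if (c : ℤ) ∣ k then (c:ℝ) else 0 := by
  set x := Complex.exp (2 * Real.pi * Complex.I * k / c) with hx
  have hc' : (c : ℂ) ≠ 0 := by exact_mod_cast hc.ne'
  have e : ∀ j : ℕ, Real.cos (2 * Real.pi * j / c * k) = (x^j).re := by
    intro j
    rw [hx, ← Complex.exp_nat_mul, ← Complex.exp_ofReal_mul_I_re]
    congr 2; push_cast; ring
  have e2 : ∑ j ∈ range c, Real.cos (2 * Real.pi * j / c * k) = (∑ j ∈ range c, x^j).re := by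
    rw [Complex.re_sum]; exact Finset.sum_congr rfl fun j _ => e j
  rw [e2]
  have xc : x^c = 1 := by
    rw [hx, ← Complex.exp_nat_mul, Complex.exp_eq_one_iff]
    exact ⟨k, by field_simp⟩
  have x1 : x = 1 ↔ (c:ℤ) ∣ k := by
    rw [hx, Complex.exp_eq_one_iff]
    constructor
    · rintro ⟨n, hn⟩
      refine ⟨n, ?_⟩
      have : (2 * Real.pi * Complex.I) ≠ 0 := Complex.two_pi_I_ne_zero
      have h2 : (k:ℂ) = c * n := by
        rw [div_eq_iff hc'] at hn
        apply mul_left_cancel₀ this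
        linear_combination hn
      exact_mod_cast h2
    · rintro ⟨n, hn⟩
      refine ⟨n, ?_⟩
      rw [hn]; push_cast; field_simp
  split_ifs with h
  · rw [x1.2 h]; simp
  · have hne : x ≠ 1 := fun h' => h (x1.1 h')
    rw [geom_sum_eq hne, xc]; simp

lemma TT_ind {q : ℂ} (hq : ‖q‖ < 1) (a : ℤ) (c : ℕ) (hc : 0 < c) :
    TT q (fun m k => if ((m:ℤ) - k) ≡ a [ZMOD (c:ℤ)] then 1 else 0) =
    ∑ j ∈ range c, ((Real.cos (2 * Real.pi * j / c * a) / c : ℝ) : ℂ) * TT q (wcos (2 * Real.pi * j / c)) := by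
  set w : ℕ → ℕ → ℂ := fun m k => if ((m:ℤ) - k) ≡ a [ZMOD (c:ℤ)] then 1 else 0 with hw
  have hw1 : ∀ m k, ‖w m k‖ ≤ 1 := by intro m k; simp only [hw]; split_ifs <;> simp
  have hw2 : ∀ m k, ‖(fun m k => (w m k + w k m)/2) m k‖ ≤ 1 := by
    intro m k
    simp only [norm_div]
    have := norm_add_le (w m k) (w k m)
    have := hw1 m k
    have := hw1 k m
    simp only [Complex.norm_ofNat]
    linarith
  have h1 : TT q (fun m k => (w m k + w k m)/2) = TT q w := by
    have := TT_sum hq (Finset.univ : Finset Bool) (fun _ => 1/2) (fun i => if i then w else fun m k => w k m)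
      (by intro i m k; cases i <;> simp [hw1]) _ hw2 (by intro m k; simp; ring)
    rw [this]
    simp only [Fintype.sum_bool, if_true, Bool.false_eq_true, if_false]
    rw [TT_transpose hq hw1]; ring
  rw [← h1]
  apply TT_sum hq (range c) _ (fun j => wcos (2 * Real.pi * j / c)) (fun j => wcos_le _) _ hw2
  intro m k
  have c0 : (c:ℝ) ≠ 0 := by positivity
  have ww : ∀ m k, w m k = ((∑ j ∈ range c, Real.cos (2 * Real.pi * j / c * (((m:ℤ) - k - a : ℤ))) / c : ℝ) : ℂ) := by
    intro m k
    rw [← Finset.sum_div, orth c hc]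
    simp only [hw]
    have : ((m:ℤ) - k) ≡ a [ZMOD (c:ℤ)] ↔ (c:ℤ) ∣ ((m:ℤ) - k - a) := by
      rw [Int.modEq_comm, Int.modEq_iff_dvd]
    by_cases h : (c:ℤ) ∣ ((m:ℤ) - k - a)
    · rw [if_pos h, if_pos (this.2 h), div_self c0]; simp
    · rw [if_neg h, if_neg (fun h' => h (this.1 h'))]; simp
  simp only [ww, wcos]
  rw [← Complex.ofReal_add, ← Finset.sum_add_distrib]
  have : (2:ℂ) = ((2:ℝ):ℂ) := by simp
  rw [this, ← Complex.ofReal_div, Finset.sum_div, Complex.ofReal_sum]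
  apply Finset.sum_congr rfl
  intro j _
  rw [← Complex.ofReal_mul]
  congr 1
  have e1 : 2 * Real.pi * j / c * (((m:ℤ) - k - a : ℤ):ℝ) = 2 * Real.pi * j / c * ((m:ℝ) - k) - 2 * Real.pi * j / c * a := by push_cast; ring
  have e2 : 2 * Real.pi * j / c * (((k:ℤ) - m - a : ℤ):ℝ) = -(2 * Real.pi * j / c * ((m:ℝ) - k) + 2 * Real.pi * j / c * a) := by push_cast; ring
  rw [e1, e2, Real.cos_neg, Real.cos_sub, Real.cos_add]
  ring

lemma hasSum_nbar {q : ℂ} (hq : ‖q‖ < 1) (a : ℤ) (c : ℕ) (hc : 0 < c) :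
    HasSum (fun n : ℕ => (nbar a c n : ℂ) * q^n)
     (∑ j ∈ range c, ((Real.cos (2 * Real.pi * j / c * a) / c : ℝ) : ℂ) * TT q (wcos (2 * Real.pi * j / c))) := by
  rw [← TT_ind hq a c hc]
  refine hasSum_of_eq (hasSum_part hq (by intro m k; split_ifs <;> simp)) ?_
  intro n
  rw [nbar_eq]

/-- Gauss -/
lemma V_theta {q : ℂ} (hq : ‖q‖ < 1) :
    V q q * (1 + ∑' n : ℕ, 2 * (-1)^(n+1) * q^((n+1)^2)) = 1 := by
  have h := TT_cos hq 0
  have h2 : TT q (wcos 0) = V q q := by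
    rw [← TT_one hq]; congr 1; funext m k; simp [wcos]
  rw [h2] at h
  have h3 : ∀ n : ℕ, 2 * (-1)^(n+1) * q^((n+1)^2) * (1 - q^(n+1))^2 /
      (1 - 2 * Real.cos 0 * q^(n+1) + (q^(n+1))^2) = 2 * (-1)^(n+1) * q^((n+1)^2) := by
    intro n
    have z := (geom_cos (pow_norm_lt hq n) 0).2.1
    rw [div_eq_iff z, Real.cos_zero, Complex.ofReal_one]; ring
  simp only [h3] at h
  linear_combination h

lemma summable_th {q : ℂ} (hq : ‖q‖ < 1) : Summable (fun n : ℕ => ‖q‖^((n+1)^2)) := by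
  apply Summable.of_nonneg_of_le (fun n => by positivity) _ (summable_geometric_of_lt_one (norm_nonneg q) hq)
  intro n
  apply pow_le_pow_of_le_one (norm_nonneg q) hq.le
  nlinarith

lemma TT_cos' {q : ℂ} (hq : ‖q‖ < 1) (φ : ℝ) :
    TT q (wcos φ) = V q q * (1 + (2 - 2 * Real.cos φ) * ∑' n : ℕ, 2 * (-1)^(n+1) * q^((n+1)^2+(n+1)) /
      (1 - 2 * Real.cos φ * q^(n+1) + (q^(n+1))^2)) := by
  rw [TT_cos hq φ]
  have s1 : Summable (fun n : ℕ => 2 * (-1)^(n+1) * q^((n+1)^2)) := by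
    apply Summable.of_norm_bounded ((summable_th hq).mul_left 2)
    intro n; simp
  have hb : ∀ n : ℕ, (1 - ‖q‖)^2 ≤ ‖1 - 2 * Real.cos φ * q^(n+1) + (q^(n+1))^2‖ := by
    intro n
    refine le_trans ?_ (geom_cos (pow_norm_lt hq n) φ).2.2
    have : ‖q^(n+1)‖ ≤ ‖q‖ := by
      rw [norm_pow, pow_succ]
      exact mul_le_of_le_one_left (norm_nonneg q) (pow_le_one₀ (norm_nonneg q) hq.le)
    have h0 : 0 < 1 - ‖q‖ := by linarith
    gcongr
  have s2 : Summable (fun n : ℕ => 2 * (-1)^(n+1) * q^((n+1)^2+(n+1)) /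
      (1 - 2 * Real.cos φ * q^(n+1) + (q^(n+1))^2)) := by
    apply Summable.of_norm_bounded ((summable_th hq).mul_left (2 / (1-‖q‖)^2))
    intro n
    have h0 : 0 < 1 - ‖q‖ := by linarith
    simp only [norm_div, norm_mul, norm_pow, norm_neg, norm_one, one_pow, mul_one]
    calc _ ≤ ‖(2:ℂ)‖ * ‖q‖^((n+1)^2) / (1-‖q‖)^2 := by
          have hp : ‖q‖^((n+1)^2+(n+1)) ≤ ‖q‖^((n+1)^2) := pow_le_pow_of_le_one (norm_nonneg q) hq.le (by omega)
          have hbn := hb n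
          exact div_le_div₀ (by positivity) (mul_le_mul_of_nonneg_left hp (norm_nonneg _)) (by positivity) hbn
      _ = _ := by simp; ring
  have e : ∀ n : ℕ, 2 * (-1)^(n+1) * q^((n+1)^2) * (1 - q^(n+1))^2 /
      (1 - 2 * Real.cos φ * q^(n+1) + (q^(n+1))^2) = 2 * (-1)^(n+1) * q^((n+1)^2) -
      (2 - 2 * Real.cos φ) * (2 * (-1)^(n+1) * q^((n+1)^2+(n+1)) /
      (1 - 2 * Real.cos φ * q^(n+1) + (q^(n+1))^2)) := by
    intro n
    have z := (geom_cos (pow_norm_lt hq n) φ).2.1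
    rw [pow_add q ((n+1)^2)]
    generalize q^(n+1) = x at z ⊢
    generalize (Real.cos φ : ℂ) = κ at z ⊢
    generalize hD : 1 - 2 * κ * x + x^2 = D at z ⊢
    field_simp
    rw [← hD]; ring
  simp only [e]
  rw [Summable.tsum_sub s1 (s2.mul_left _), tsum_mul_left]
  have := V_theta hq
  linear_combination -this

lemma norm_TT_cos {q : ℂ} (hq : ‖q‖ < 1) (φ : ℝ) :
    ‖TT q (wcos φ)‖ ≤ ‖V q q‖ * (1 + 8 / (1 - ‖q‖)^3) := by
  have h0 : 0 < 1 - ‖q‖ := by linarith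
  rw [TT_cos' hq, norm_mul]
  gcongr
  refine (norm_add_le _ _).trans ?_
  rw [norm_one, norm_mul]
  gcongr
  have hb : ∀ n : ℕ, (1 - ‖q‖)^2 ≤ ‖1 - 2 * Real.cos φ * q^(n+1) + (q^(n+1))^2‖ := by
    intro n
    refine le_trans ?_ (geom_cos (pow_norm_lt hq n) φ).2.2
    have : ‖q^(n+1)‖ ≤ ‖q‖ := by
      rw [norm_pow, pow_succ]
      exact mul_le_of_le_one_left (norm_nonneg q) (pow_le_one₀ (norm_nonneg q) hq.le)
    gcongr
  have n1 : ‖(2 - 2 * Real.cos φ : ℂ)‖ ≤ 4 := by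
    have : (2 - 2 * Real.cos φ : ℂ) = ((2 - 2 * Real.cos φ : ℝ) : ℂ) := by push_cast; rfl
    rw [this, Complex.norm_real, Real.norm_eq_abs, abs_le]
    constructor <;> linarith [Real.cos_le_one φ, Real.neg_one_le_cos φ]
  have n2 : ‖∑' n : ℕ, 2 * (-1)^(n+1) * q^((n+1)^2+(n+1)) /
      (1 - 2 * Real.cos φ * q^(n+1) + (q^(n+1))^2)‖ ≤ 2 / (1-‖q‖)^2 * (1 - ‖q‖)⁻¹ := by
    apply tsum_of_norm_bounded ((hasSum_geometric_of_lt_one (norm_nonneg q) hq).mul_left (2 / (1-‖q‖)^2))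
    intro n
    simp only [norm_div, norm_mul, norm_pow, norm_neg, norm_one, one_pow, mul_one]
    calc _ ≤ ‖(2:ℂ)‖ * ‖q‖^n / (1-‖q‖)^2 := by
          have hp : ‖q‖^((n+1)^2+(n+1)) ≤ ‖q‖^n := pow_le_pow_of_le_one (norm_nonneg q) hq.le (by nlinarith)
          have hbn := hb n
          exact div_le_div₀ (by positivity) (mul_le_mul_of_nonneg_left hp (norm_nonneg _)) (by positivity) hbn
      _ = _ := by simp; ring
  calc _ ≤ 4 * (2 / (1-‖q‖)^2 * (1 - ‖q‖)⁻¹) := by gcongr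
    _ = _ := by field_simp; norm_num


end

end OPR

namespace OPR

section

open Finset

lemma intComp {w : ℂ} (h0 : 0 < w.re) (h1 : w.re < 1) : w ∈ Complex.integerComplement := by
  rw [Complex.mem_integerComplement_iff]
  rintro ⟨n, rfl⟩
  simp at h0 h1
  have a : (0:ℤ) < n := by exact_mod_cast h0
  have b : n < (1:ℤ) := by exact_mod_cast h1
  omega

lemma tan_series {w : ℂ} (h0 : 0 < w.re) (h1 : w.re < 1) :
    HasSum (fun k : ℕ => 1 / ((2*k+1 : ℂ) - w) - 1 / ((2*k+1 : ℂ) + w))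
      ((Real.pi / 2) * Complex.tan (Real.pi * w / 2)) := by
  have c1 := intComp h0 h1
  have c2 : w / 2 ∈ Complex.integerComplement := intComp (by simp; linarith) (by simp; linarith)
  have s1 := summable_cotTerm c1
  have s2 := summable_cotTerm c2
  have e1 := cot_series_rep' c1
  have e2 := cot_series_rep' c2
  have i1 : Function.Injective (fun k : ℕ => 2 * k) := fun a b h => by simpa using h
  have i2 : Function.Injective (fun k : ℕ => 2 * k + 1) := fun a b h => by simpa using h
  have t1 := s1.comp_injective i1
  have t2 := s1.comp_injective i2
  have e3 := tsum_even_add_odd t1 t2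
  have odd_eq : ∀ k : ℕ, cotTerm w (2*k+1) = 1/2 * cotTerm (w/2) k := by
    intro k
    have n1 : w / 2 - (k+1) ≠ 0 := by
      intro h
      have := congrArg Complex.re h
      simp at this
      have hk : (0:ℝ) ≤ k := by positivity
      linarith
    have n2 : w / 2 + (k+1) ≠ 0 := by
      intro h
      have := congrArg Complex.re h
      simp at this
      have hk : (0:ℝ) ≤ k := by positivity
      linarith
    unfold cotTerm
    have a1 : w - ((2*k+1 : ℕ) + 1) = 2 * (w/2 - (k+1)) := by push_cast; ring
    have a2 : w + ((2*k+1 : ℕ) + 1) = 2 * (w/2 + (k+1)) := by push_cast; ring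
    rw [a1, a2]
    field_simp
  have e4 : ∑' k, cotTerm w (2*k+1) = 1/2 * ∑' k, cotTerm (w/2) k := by
    rw [← tsum_mul_left]; exact tsum_congr odd_eq
  have e5 : ∑' k, cotTerm w (2*k) = (Real.pi * Complex.cot (Real.pi * w) - 1 / w) - 1/2 * (Real.pi * Complex.cot (Real.pi * (w/2)) - 1/(w/2)) := by
    rw [e1, e2, ← e4, ← e3]; simp only [cotTerm]; ring
  have h2 := t1.hasSum
  simp only [Function.comp_def] at h2
  rw [e5] at h2
  have w0 : w ≠ 0 := by intro h; simp [h] at h0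
  have e6 : (Real.pi * Complex.cot (Real.pi * w) - 1 / w) - 1/2 * (Real.pi * Complex.cot (Real.pi * (w/2)) - 1/(w/2))
     = - ((Real.pi / 2) * Complex.tan (Real.pi * w / 2)) := by
    set y : ℂ := Real.pi * w / 2 with hy
    have hyr : y.re = Real.pi * w.re / 2 := by
      rw [hy]; simp
    have sy : Complex.sin y ≠ 0 := by
      rw [Complex.sin_ne_zero_iff]
      intro k hk
      have := congrArg Complex.re hk
      rw [hyr] at this
      simp at this
      have hp := Real.pi_pos
      have hk' : (k:ℝ) = w.re / 2 := by
        apply mul_right_cancel₀ hp.ne'; linarith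
      have a : (0:ℝ) < k := by linarith
      have b : (k:ℝ) < 1 := by linarith
      have a' : (0:ℤ) < k := by exact_mod_cast a
      have b' : k < (1:ℤ) := by exact_mod_cast b
      omega
    have cy : Complex.cos y ≠ 0 := by
      rw [Complex.cos_ne_zero_iff]
      intro k hk
      have := congrArg Complex.re hk
      rw [hyr] at this
      simp at this
      have hp := Real.pi_pos
      have hk' : (2 * k + 1:ℝ) = w.re := by
        apply mul_right_cancel₀ hp.ne'; linarith
      have a : (0:ℝ) < 2*k+1 := by linarith
      have b : (2*k+1:ℝ) < 1 := by linarith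
      have a' : (0:ℤ) < 2*k+1 := by exact_mod_cast a
      have b' : 2*k+1 < (1:ℤ) := by exact_mod_cast b
      omega
    have y1 : Real.pi * w = 2 * y := by rw [hy]; ring
    have y2 : Real.pi * (w/2) = y := by rw [hy]; ring
    rw [y1, y2, Complex.cot, Complex.cot, Complex.tan, Complex.sin_two_mul, Complex.cos_two_mul]
    have := Complex.sin_sq_add_cos_sq y
    field_simp
    linear_combination (Real.pi * w) * this
  rw [e6] at h2
  have h3 := h2.neg
  rw [neg_neg] at h3
  refine hasSum_of_eq h3 ?_
  intro k
  have a1 : w - ((2*k : ℕ) + 1) = -((2*k+1) - w) := by push_cast; ring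
  have a2 : w + ((2*k : ℕ) + 1) = ((2*k+1) + w) := by push_cast; ring
  simp only [cotTerm]
  rw [a1, a2, one_div_neg_eq_neg_one_div]; ring

lemma re_tan (α x : ℝ) (h0 : 0 < α) (h1 : α < Real.pi) :
    (Complex.tan ((α - x * Complex.I)/2)).re = Real.sin α / (Real.cosh x + Real.cos α) := by
  set z : ℂ := (α - x * Complex.I)/2 with hz
  have hcz : (starRingEnd ℂ) z = (α + x * Complex.I)/2 := by
    rw [hz]; simp [map_ofNat]
  have hzr : z.re = α/2 := by rw [hz]; simp
  have cz : Complex.cos z ≠ 0 := by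
    rw [Complex.cos_ne_zero_iff]
    intro k hk
    have := congrArg Complex.re hk
    rw [hzr] at this
    simp at this
    have hp := Real.pi_pos
    have a : (0:ℝ) < 2*k+1 := by
      by_contra h; push Not at h; nlinarith
    have b : (2*k+1:ℝ) < 1 := by
      by_contra h; push Not at h; nlinarith
    have a' : (0:ℤ) < 2*k+1 := by exact_mod_cast a
    have b' : 2*k+1 < (1:ℤ) := by exact_mod_cast b
    omega
  have cz' : Complex.cos ((starRingEnd ℂ) z) ≠ 0 := by
    rw [Complex.cos_conj]; simpa using cz
  have h : ((Complex.tan z).re : ℂ) = (Complex.tan z + Complex.tan ((starRingEnd ℂ) z))/2 := by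
    rw [Complex.tan_conj, Complex.add_conj]; push_cast; ring
  have prod : 2 * (Complex.cos z * Complex.cos ((starRingEnd ℂ) z)) = Complex.cosh x + Complex.cos α := by
    have a : Complex.cos α = Complex.cos (z + (starRingEnd ℂ) z) := by rw [hcz, hz]; congr 1; ring
    have b : Complex.cosh x = Complex.cos (z - (starRingEnd ℂ) z) := by
      rw [hcz, hz, ← Complex.cos_mul_I, ← Complex.cos_neg]; congr 1; ring
    rw [a, b, Complex.cos_add, Complex.cos_sub]; ring
  have sn : Complex.sin z * Complex.cos ((starRingEnd ℂ) z) + Complex.cos z * Complex.sin ((starRingEnd ℂ) z) = Complex.sin α := by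
    rw [← Complex.sin_add]; congr 1; rw [hcz, hz]; ring
  have : ((Complex.tan z).re : ℂ) = ((Real.sin α / (Real.cosh x + Real.cos α) : ℝ) : ℂ) := by
    rw [h]; push_cast
    rw [← prod, ← sn, Complex.tan, Complex.tan]
    field_simp
  exact_mod_cast this


end

end OPR

namespace OPR

section

open Finset MeasureTheory

noncomputable def KK (α u : ℝ) : ℝ := Real.sinh (α * u) / Real.sinh (Real.pi * u)

lemma KK_nonneg {α u : ℝ} (h0 : 0 < α) (hu : 0 < u) : 0 ≤ KK α u := by
  unfold KK
  have := Real.pi_pos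
  have h1 : 0 < Real.sinh (α * u) := Real.sinh_pos_iff.2 (by positivity)
  have h2 : 0 < Real.sinh (Real.pi * u) := Real.sinh_pos_iff.2 (by positivity)
  positivity

lemma KK_le {α u : ℝ} (_h0 : 0 < α) (h1 : α < Real.pi) (hu : 0 < u) :
    KK α u ≤ Real.exp (-(Real.pi - α) * u) := by
  unfold KK
  have := Real.pi_pos
  have h2 : 0 < Real.sinh (Real.pi * u) := Real.sinh_pos_iff.2 (by positivity)
  rw [div_le_iff₀ h2, Real.sinh_eq, Real.sinh_eq]
  have a1 : Real.exp (-(Real.pi - α) * u) * Real.exp (Real.pi * u) = Real.exp (α * u) := by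
    rw [← Real.exp_add]; ring_nf
  have a2 : Real.exp (-(Real.pi - α) * u) * Real.exp (-(Real.pi * u)) ≤ Real.exp (-(α * u)) := by
    rw [← Real.exp_add, Real.exp_le_exp]; nlinarith
  nlinarith

lemma KK_meas (α : ℝ) : Measurable (KK α) := by
  unfold KK
  exact (Real.continuous_sinh.measurable.comp (by fun_prop)).div (Real.continuous_sinh.measurable.comp (by fun_prop))

lemma KK_int {α : ℝ} (h0 : 0 < α) (h1 : α < Real.pi) : IntegrableOn (KK α) (Set.Ioi 0) := by
  have := integrableOn_exp_mul_Ioi (a := -(Real.pi - α)) (by linarith) 0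
  refine Integrable.mono' this (KK_meas α).aestronglyMeasurable ?_
  filter_upwards [ae_restrict_mem measurableSet_Ioi] with u hu
  rw [Real.norm_of_nonneg (KK_nonneg h0 hu)]
  exact KK_le h0 h1 hu

lemma KK_series {α u : ℝ} (hu : 0 < u) :
    HasSum (fun k : ℕ => Real.exp (-((2*k+1) * Real.pi - α) * u) - Real.exp (-((2*k+1) * Real.pi + α) * u))
      (KK α u) := by
  have hp := Real.pi_pos
  have hr : Real.exp (-2 * Real.pi * u) < 1 := by
    rw [Real.exp_lt_one_iff]; nlinarith [mul_pos hp hu]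
  have g := hasSum_geometric_of_lt_one (Real.exp_pos (-2 * Real.pi * u)).le hr
  have g2 := g.mul_left ((Real.exp (α * u) - Real.exp (-α*u)) * Real.exp (-Real.pi * u))
  have h2 : 0 < Real.sinh (Real.pi * u) := Real.sinh_pos_iff.2 (by positivity)
  have e : (Real.exp (α * u) - Real.exp (-α*u)) * Real.exp (-Real.pi * u) * (1 - Real.exp (-2 * Real.pi * u))⁻¹ = KK α u := by
    unfold KK
    rw [eq_div_iff h2.ne']
    have h3 : 1 - Real.exp (-2 * Real.pi * u) ≠ 0 := by linarith
    rw [Real.sinh_eq, Real.sinh_eq]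
    have h4 : Real.exp (-Real.pi * u) * Real.exp (Real.pi * u) = 1 := by rw [← Real.exp_add]; simp
    have h5 : Real.exp (-Real.pi * u) * Real.exp (-(Real.pi * u)) = Real.exp (-2 * Real.pi * u) := by rw [← Real.exp_add]; ring_nf
    rw [← neg_mul] at h5
    rw [← neg_mul, ← neg_mul]
    generalize Real.exp (-Real.pi * u) = a at *
    generalize Real.exp (Real.pi * u) = b at *
    generalize Real.exp (-2 * Real.pi * u) = c at *
    have h6 := inv_mul_cancel₀ h3
    have h7 : a * (b - a) = 1 - c := by linear_combination h4 - h5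
    calc _ = (Real.exp (α * u) - Real.exp (-α * u)) / 2 * ((1-c)⁻¹ * (a * (b - a))) := by ring
      _ = _ := by rw [h7, h6]; ring
  rw [e] at g2
  have : (fun k : ℕ => Real.exp (-((2*k+1) * Real.pi - α) * u) - Real.exp (-((2*k+1) * Real.pi + α) * u)) =
    fun k : ℕ => (Real.exp (α * u) - Real.exp (-α*u)) * Real.exp (-Real.pi * u) * Real.exp (-2 * Real.pi * u)^k := by
    funext k
    rw [← Real.exp_nat_mul, sub_mul, sub_mul, ← Real.exp_add, ← Real.exp_add, ← Real.exp_add, ← Real.exp_add]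
    congr 2 <;> ring
  rw [this]; exact g2

lemma KK_fourier {α : ℝ} (h0 : 0 < α) (h1 : α < Real.pi) (x : ℝ) :
    ∫ u in Set.Ioi (0:ℝ), KK α u * Real.cos (x * u) = 1/2 * (Real.sin α / (Real.cosh x + Real.cos α)) := by
  have hp := Real.pi_pos
  set lm : ℕ → ℝ := fun k => (2*k+1) * Real.pi - α with hlm
  set lp : ℕ → ℝ := fun k => (2*k+1) * Real.pi + α with hlp
  have lm0 : ∀ k, 0 < lm k := by
    intro k; simp only [hlm]
    have : (0:ℝ) ≤ k * Real.pi := by positivity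
    nlinarith
  have lp0 : ∀ k, 0 < lp k := by intro k; simp only [hlp]; positivity
  set F : ℕ → ℝ → ℂ := fun k u => Complex.exp ((-(lm k) + x * Complex.I : ℂ) * u) - Complex.exp ((-(lp k) + x * Complex.I : ℂ) * u) with hF
  have i1 : ∀ k, IntegrableOn (fun u : ℝ => Complex.exp ((-(lm k) + x * Complex.I : ℂ) * u)) (Set.Ioi 0) := fun k =>
    integrableOn_exp_mul_complex_Ioi (by simp [lm0 k]) 0
  have i2 : ∀ k, IntegrableOn (fun u : ℝ => Complex.exp ((-(lp k) + x * Complex.I : ℂ) * u)) (Set.Ioi 0) := fun k =>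
    integrableOn_exp_mul_complex_Ioi (by simp [lp0 k]) 0
  have hFi : ∀ k, IntegrableOn (F k) (Set.Ioi 0) := fun k => (i1 k).sub (i2 k)
  have hFe : ∀ k u, F k u = ((Real.exp (-lm k * u) - Real.exp (-lp k * u) : ℝ) : ℂ) * Complex.exp (((x * u : ℝ) : ℂ) * Complex.I) := by
    intro k u
    simp only [hF]
    push_cast
    rw [sub_mul, ← Complex.exp_add, ← Complex.exp_add]
    congr 2 <;> ring
  have hFn : ∀ k, ∫ u in Set.Ioi (0:ℝ), ‖F k u‖ = 1 / lm k - 1 / lp k := by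
    intro k
    have : ∀ u ∈ Set.Ioi (0:ℝ), ‖F k u‖ = Real.exp (-lm k * u) - Real.exp (-lp k * u) := by
      intro u hu
      rw [hFe, norm_mul, Complex.norm_exp_ofReal_mul_I, mul_one, Complex.norm_real, Real.norm_of_nonneg]
      rw [sub_nonneg, Real.exp_le_exp]
      simp only [hlm, hlp]
      have : 0 < u := hu
      nlinarith
    rw [setIntegral_congr_fun measurableSet_Ioi this,
      integral_sub (integrableOn_exp_mul_Ioi (by linarith [lm0 k]) 0) (integrableOn_exp_mul_Ioi (by linarith [lp0 k]) 0),
      integral_exp_mul_Ioi (by linarith [lm0 k]), integral_exp_mul_Ioi (by linarith [lp0 k])]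
    have := (lm0 k).ne'
    have := (lp0 k).ne'
    simp
  -- tan series scaled
  have tan' : ∀ y : ℝ, HasSum (fun k : ℕ => 1 / ((lm k : ℂ) - y * Complex.I) - 1 / ((lp k : ℂ) + y * Complex.I))
      (1/2 * Complex.tan ((α + y * Complex.I)/2)) := by
    intro y
    have hre : ((α + y * Complex.I : ℂ) / Real.pi).re = α / Real.pi := by
      rw [Complex.div_ofReal_re]; simp
    have t := (tan_series (w := (α + y * Complex.I) / Real.pi) (by rw [hre]; positivity)
      (by rw [hre, div_lt_one hp]; exact h1)).mul_left (1 / (Real.pi : ℂ))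
    have hpc : (Real.pi : ℂ) ≠ 0 := by exact_mod_cast hp.ne'
    have e : (1 / (Real.pi : ℂ)) * ((Real.pi / 2) * Complex.tan (Real.pi * ((α + y * Complex.I) / Real.pi) / 2)) = 1/2 * Complex.tan ((α + y * Complex.I)/2) := by
      rw [mul_div_cancel₀ _ hpc]; field_simp
    rw [e] at t
    refine hasSum_of_eq t ?_
    intro k
    have a1 : ((lm k : ℂ) - y * Complex.I) = Real.pi * ((2*k+1) - (α + y * Complex.I) / Real.pi) := by
      simp only [hlm]; push_cast; field_simp; ring
    have a2 : ((lp k : ℂ) + y * Complex.I) = Real.pi * ((2*k+1) + (α + y * Complex.I) / Real.pi) := by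
      simp only [hlp]; push_cast; field_simp; ring
    rw [a1, a2, one_div_mul_eq_div, ← div_div, ← div_div, sub_div, div_right_comm, div_right_comm (1:ℂ) (_ + _)]
  have hFs : Summable fun k => ∫ u in Set.Ioi (0:ℝ), ‖F k u‖ := by
    simp only [hFn]
    have := (Complex.hasSum_re (tan' 0)).summable
    refine this.congr ?_
    intro k
    simp [← Complex.ofReal_inv]
  have key := hasSum_integral_of_summable_integral_norm hFi hFs
  have hFI : ∀ k, ∫ u in Set.Ioi (0:ℝ), F k u = 1 / ((lm k : ℂ) - x * Complex.I) - 1 / ((lp k : ℂ) - x * Complex.I) := by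
    intro k
    simp only [hF]
    rw [integral_sub (i1 k) (i2 k), integral_exp_mul_complex_Ioi (by simp [lm0 k]), integral_exp_mul_complex_Ioi (by simp [lp0 k])]
    simp only [Complex.ofReal_zero, mul_zero, Complex.exp_zero]
    rw [neg_div, neg_div, ← div_neg, ← div_neg]
    congr 2 <;> ring
  simp only [hFI] at key
  have k1 := Complex.hasSum_re key
  have k2 := Complex.hasSum_re (tan' x)
  have k3 : ∀ k, (1 / ((lm k : ℂ) - x * Complex.I) - 1 / ((lp k : ℂ) - x * Complex.I)).re = (1 / ((lm k : ℂ) - x * Complex.I) - 1 / ((lp k : ℂ) + x * Complex.I)).re := by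
    intro k
    simp [Complex.inv_re, Complex.normSq]
  simp only [k3] at k1
  have k4 := k1.unique k2
  have k5 : ∫ u in Set.Ioi (0:ℝ), ∑' k, F k u = ∫ u in Set.Ioi (0:ℝ), (KK α u : ℂ) * Complex.exp (((x * u : ℝ) : ℂ) * Complex.I) := by
    apply setIntegral_congr_fun measurableSet_Ioi
    intro u hu
    have := ((Complex.hasSum_ofReal.2 (KK_series (α := α) (u := u) hu)).mul_right (Complex.exp (((x * u : ℝ) : ℂ) * Complex.I))).tsum_eq
    simp only
    rw [← this]
    apply tsum_congr
    intro k
    rw [hFe]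
  rw [k5] at k4
  have ik : IntegrableOn (fun u : ℝ => (KK α u : ℂ) * Complex.exp (((x * u : ℝ) : ℂ) * Complex.I)) (Set.Ioi 0) := by
    refine Integrable.mono' (KK_int h0 h1) ?_ ?_
    · exact ((Complex.measurable_ofReal.comp (KK_meas α)).mul (by fun_prop)).aestronglyMeasurable
    · filter_upwards [ae_restrict_mem measurableSet_Ioi] with u hu
      rw [norm_mul, Complex.norm_exp_ofReal_mul_I, mul_one, Complex.norm_real, Real.norm_of_nonneg (KK_nonneg h0 hu)]
  have k6 : (∫ u in Set.Ioi (0:ℝ), (KK α u : ℂ) * Complex.exp (((x * u : ℝ) : ℂ) * Complex.I)).re = ∫ u in Set.Ioi (0:ℝ), KK α u * Real.cos (x * u) := by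
    have := (integral_re ik).symm
    simp only [RCLike.re_eq_complex_re] at this
    rw [this]
    congr 1; funext u
    rw [Complex.re_ofReal_mul, Complex.exp_ofReal_mul_I_re]
  rw [← k6, k4]
  have := re_tan α (-x) h0 h1
  rw [Real.cosh_neg] at this
  rw [← this]
  push_cast
  rw [neg_mul, sub_neg_eq_add]
  have : ((1:ℂ)/2) = ((1/2:ℝ):ℂ) := by push_cast; rfl
  rw [this, Complex.re_ofReal_mul]


end

end OPR

namespace OPR

section

open Finset MeasureTheory

lemma theta_inv {τ : ℂ} (hτ : 0 < τ.re) (u : ℂ) :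
    ∃ T, HasSum (fun n : ℕ => 2 * (-1)^(n+1) * Complex.exp (-(n+1)^2 * τ) * Complex.cos ((n+1) * τ * u)) (T - 1) ∧
    HasSum (fun m : ℕ => 2 * (1 / (τ / Real.pi)^(1/2:ℂ)) * Complex.exp (-τ * u^2 / 4) * Complex.exp (-Real.pi^2 * (m+1/2)^2/τ) *
      Complex.cosh ((m+1/2) * Real.pi * u)) T := by
  have hp := Real.pi_pos
  have hpc : (Real.pi : ℂ) ≠ 0 := by exact_mod_cast hp.ne'
  have hτ0 : τ ≠ 0 := by intro h; simp [h] at hτ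
  set σ : ℂ := Complex.I * τ / Real.pi with hσ
  set z : ℂ := -1/2 + τ * u / (2 * Real.pi) with hz
  have him : 0 < σ.im := by
    rw [hσ, Complex.div_ofReal_im]; simp; positivity
  have him' : 0 < (-1/σ).im := by
    rw [neg_div, one_div, Complex.neg_im, Complex.inv_im, neg_div, neg_neg]
    have h1 : 0 < Complex.normSq σ := Complex.normSq_pos.2 (by intro h; simp [h] at him)
    positivity
  have h1 := hasSum_jacobiTheta₂_term z him
  have h2 := hasSum_jacobiTheta₂_term (z/σ) him'
  have fe := jacobiTheta₂_functional_equation z σ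
  refine ⟨jacobiTheta₂ z σ, ?_, ?_⟩
  · have h3 := h1.nat_add_neg
    have h4 := (hasSum_nat_add_iff' 1).2 h3
    have h0 : jacobiTheta₂_term 0 z σ = 1 := by simp [jacobiTheta₂_term]
    simp only [Finset.range_one, Finset.sum_singleton, Nat.cast_zero, neg_zero, h0] at h4
    have e : jacobiTheta₂ z σ + 1 - (1 + 1) = jacobiTheta₂ z σ - 1 := by ring
    rw [e] at h4
    refine hasSum_of_eq h4 ?_
    intro n
    simp only [jacobiTheta₂_term]
    have hsig : ((-1:ℂ))^(n+1) = Complex.exp (-((n+1:ℕ):ℂ) * (Real.pi * Complex.I)) := by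
      rw [neg_mul, ← mul_neg, Complex.exp_nat_mul, Complex.exp_neg, Complex.exp_pi_mul_I]; norm_num
    have hsig' : ((-1:ℂ))^(n+1) = Complex.exp (((n+1:ℕ):ℂ) * (Real.pi * Complex.I)) := by
      rw [Complex.exp_nat_mul, Complex.exp_pi_mul_I]
    have x1 : Complex.exp (2 * Real.pi * Complex.I * ((n+1:ℕ):ℤ) * z + Real.pi * Complex.I * ((n+1:ℕ):ℤ)^2 * σ) =
      (-1)^(n+1) * Complex.exp (-(n+1)^2 * τ) * Complex.exp ((n+1) * τ * u * Complex.I) := by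
      rw [hsig, ← Complex.exp_add, ← Complex.exp_add]
      congr 1
      rw [hz, hσ]; push_cast; field_simp
      linear_combination (((n:ℂ)+1) * τ) * Complex.I_sq
    have x2 : Complex.exp (2 * Real.pi * Complex.I * ((-((n+1:ℕ):ℤ) : ℤ) : ℂ) * z + Real.pi * Complex.I * ((-((n+1:ℕ):ℤ) : ℤ) : ℂ)^2 * σ) =
      (-1)^(n+1) * Complex.exp (-(n+1)^2 * τ) * Complex.exp (-((n+1) * τ * u) * Complex.I) := by
      rw [hsig', ← Complex.exp_add, ← Complex.exp_add]
      congr 1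
      rw [hz, hσ]; push_cast; field_simp
      linear_combination (((n:ℂ)+1) * τ) * Complex.I_sq
    rw [x1, x2, Complex.cos]
    ring
  · have h3 := (h2.nat_add_neg_add_one).mul_left (1 / (-Complex.I * σ) ^ (1 / 2 : ℂ) * Complex.exp (-Real.pi * Complex.I * z ^ 2 / σ))
    rw [← fe] at h3
    refine hasSum_of_eq h3 ?_
    intro m
    have s1 : -Complex.I * σ = τ / Real.pi := by
      rw [hσ]; linear_combination (-τ / Real.pi) * Complex.I_sq
    rw [s1]
    simp only [jacobiTheta₂_term]
    have hI : Complex.I ≠ 0 := Complex.I_ne_zero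
    have q1 : ∀ x : ℂ, -Real.pi * Complex.I * z^2/σ + (2 * Real.pi * Complex.I * x * (z/σ) + Real.pi * Complex.I * x^2 * (-1/σ)) =
       -Real.pi^2 * (x+1/2)^2/τ + (x + 1/2) * Real.pi * u - τ * u^2/4 := by
      intro x
      rw [hz, hσ]; field_simp; ring
    have q2 : ∀ x : ℂ, Complex.exp (-Real.pi * Complex.I * z^2/σ) * Complex.exp (2 * Real.pi * Complex.I * x * (z/σ) + Real.pi * Complex.I * x^2 * (-1/σ)) =
       Complex.exp (-Real.pi^2 * (x+1/2)^2/τ) * Complex.exp ((x + 1/2) * Real.pi * u) * (Complex.exp (τ * u^2/4))⁻¹ := by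
      intro x
      rw [← Complex.exp_add, q1, Complex.exp_sub, Complex.exp_add]; rfl
    rw [mul_add, mul_assoc _ (Complex.exp (-Real.pi * Complex.I * z^2/σ)), mul_assoc _ (Complex.exp (-Real.pi * Complex.I * z^2/σ)), q2, q2, Complex.cosh]
    have r1 : (((-((m:ℤ)+1) : ℤ) : ℂ) + 1/2) = -(m+1/2) := by push_cast; ring
    have r2 : (((m:ℤ):ℂ) + 1/2) = (m + 1/2) := by push_cast; ring
    rw [r1, r2, neg_sq]
    have r3 : Complex.exp (-τ * u^2/4) = (Complex.exp (τ * u^2/4))⁻¹ := by rw [← Complex.exp_neg]; congr 1; ring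
    rw [r3, neg_mul, neg_mul]
    ring


end

end OPR

namespace OPR

section

open Finset MeasureTheory

noncomputable def sg (τ : ℂ) : ℂ := 1/2 * (Real.pi / (τ/4))^(1/2:ℂ)

lemma gauss_int {τ : ℂ} (hτ : 0 < τ.re) (c : ℂ) :
    Integrable (fun u : ℝ => Complex.exp (c * u) * Complex.exp (-τ * u^2/4)) ∧
    ∫ u : ℝ, Complex.exp (c * u) * Complex.exp (-τ * u^2/4) = 2 * sg τ * Complex.exp (c^2/τ) := by
  have hτ0 : τ ≠ 0 := by intro h; simp [h] at hτ
  have hb : (-τ/4).re < 0 := by simp; linarith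
  have h1 := integral_cexp_quadratic hb c 0
  have e : ∀ u : ℝ, Complex.exp (c * u) * Complex.exp (-τ * u^2/4) = Complex.exp (-τ/4 * u^2 + c * u + 0) := by
    intro u; rw [← Complex.exp_add]; congr 1; ring
  constructor
  · simp only [e]
    have := integrable_cexp_quadratic' hb c 0
    exact this
  · simp only [e]
    rw [h1, sg]
    have e1 : (0:ℂ) - c^2/(4 * (-τ/4)) = c^2/τ := by field_simp; ring
    have e2 : -(-τ/4) = τ/4 := by ring
    rw [e1, e2]; ring

lemma gauss_cosh {τ : ℂ} (hτ : 0 < τ.re) (c : ℂ) :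
    IntegrableOn (fun u : ℝ => Complex.cosh (c * u) * Complex.exp (-τ * u^2/4)) (Set.Ioi 0) ∧
    ∫ u in Set.Ioi (0:ℝ), Complex.cosh (c * u) * Complex.exp (-τ * u^2/4) = sg τ * Complex.exp (c^2/τ) := by
  obtain ⟨i1, h1⟩ := gauss_int hτ c
  obtain ⟨i2, h2⟩ := gauss_int hτ (-c)
  have e : ∀ u : ℝ, Complex.cosh (c * u) * Complex.exp (-τ * u^2/4) =
    1/2 * (Complex.exp (c * u) * Complex.exp (-τ * u^2/4)) + 1/2 * (Complex.exp (-c * u) * Complex.exp (-τ * u^2/4)) := by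
    intro u; rw [Complex.cosh, neg_mul]; ring
  constructor
  · simp only [e]
    exact ((i1.const_mul _).add (i2.const_mul _)).integrableOn
  · simp only [e]
    rw [integral_add (i1.integrableOn.const_mul _) (i2.integrableOn.const_mul _), integral_const_mul, integral_const_mul]
    have h3 : ∫ u in Set.Ioi (0:ℝ), Complex.exp (-c * u) * Complex.exp (-τ * u^2/4) = ∫ u in Set.Iic (0:ℝ), Complex.exp (c * u) * Complex.exp (-τ * u^2/4) := by
      have := integral_comp_neg_Ioi (0:ℝ) (fun u : ℝ => Complex.exp (c * u) * Complex.exp (-τ * u^2/4))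
      rw [neg_zero] at this
      rw [← this]
      congr 1; funext u; push_cast; rw [neg_sq]; ring_nf
    rw [h3]
    have h4 := intervalIntegral.integral_Iic_add_Ioi (b := (0:ℝ)) i1.integrableOn i1.integrableOn
    rw [h1] at h4
    linear_combination (1/2) * h4

noncomputable def E0 (α u : ℝ) : ℝ := Real.sinh (α * u) / (2 * Real.sinh (Real.pi * u / 2))

lemma E0_eq (α : ℝ) {u : ℝ} (hu : 0 < u) : E0 α u = KK α u * Real.cosh (1/2 * Real.pi * u) := by
  have hp := Real.pi_pos
  have h2 : 0 < Real.sinh (Real.pi * u / 2) := Real.sinh_pos_iff.2 (by positivity)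
  have h3 : 0 < Real.cosh (Real.pi * u / 2) := Real.cosh_pos _
  unfold E0 KK
  have : Real.pi * u = 2 * (Real.pi * u / 2) := by ring
  rw [this, Real.sinh_two_mul, show 1/2 * Real.pi * u = Real.pi * u / 2 by ring, ← this]
  field_simp

noncomputable def Hi (α : ℝ) (τ : ℂ) : ℂ := ∫ u in Set.Ioi (0:ℝ), (E0 α u : ℂ) * Complex.exp (-τ * u^2/4)

lemma KKcosh_le {α u : ℝ} (h0 : 0 < α) (h1 : α < Real.pi) (hu : 0 < u) (x : ℝ) :
    ‖KK α u * Real.cosh (x * u)‖ ≤ Real.cosh (x * u) := by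
  have := KK_nonneg h0 hu
  have h2 := KK_le h0 h1 hu
  have h3 : Real.exp (-(Real.pi - α) * u) ≤ 1 := by rw [Real.exp_le_one_iff]; nlinarith
  rw [Real.norm_of_nonneg (by positivity)]
  have := Real.cosh_pos (x * u)
  nlinarith

lemma KKcosh_int {α : ℝ} (h0 : 0 < α) (h1 : α < Real.pi) (x : ℝ) {τ : ℂ} (hτ : 0 < τ.re) :
    IntegrableOn (fun u : ℝ => ((KK α u * Real.cosh (x * u) : ℝ) : ℂ) * Complex.exp (-τ * u^2/4)) (Set.Ioi 0) := by
  have := (gauss_cosh (τ := τ.re) (by simpa using hτ) x).1.norm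
  refine Integrable.mono' this ?_ ?_
  · refine ((Complex.measurable_ofReal.comp ((KK_meas α).mul (Real.continuous_cosh.measurable.comp (by fun_prop)))).mul (by fun_prop)).aestronglyMeasurable
  · filter_upwards [ae_restrict_mem measurableSet_Ioi] with u hu
    rw [norm_mul, norm_mul, Complex.norm_real]
    have e1 : ‖Complex.exp (-τ * u^2/4)‖ = ‖Complex.exp (-(τ.re:ℂ) * u^2/4)‖ := by
      rw [Complex.norm_exp, Complex.norm_exp]
      congr 1
      rw [show -τ * (u:ℂ)^2/4 = -τ * ((u^2/4 : ℝ):ℂ) by push_cast; ring, show -(τ.re:ℂ) * (u:ℂ)^2/4 = -(τ.re:ℂ) * ((u^2/4 : ℝ):ℂ) by push_cast; ring]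
      rw [Complex.re_mul_ofReal, Complex.re_mul_ofReal]; simp
    have e2 : ‖Complex.cosh ((x:ℂ) * u)‖ = Real.cosh (x * u) := by
      rw [← Complex.ofReal_mul, ← Complex.ofReal_cosh, Complex.norm_real, Real.norm_of_nonneg (Real.cosh_pos _).le]
    rw [e1, e2]
    exact mul_le_mul_of_nonneg_right (KKcosh_le h0 h1 hu x) (norm_nonneg _)

noncomputable def gP (α : ℝ) (τ : ℂ) (x : ℝ) : ℂ :=
  Complex.exp (((α + x * Real.pi : ℝ) : ℂ)^2/τ) - Complex.exp (((α - x * Real.pi : ℝ) : ℂ)^2/τ)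

noncomputable def PP (α : ℝ) (τ : ℂ) : ℕ → ℂ
  | 0 => 0
  | 1 => gP α τ (1/2)
  | (m+2) => PP α τ m + gP α τ (m + 3/2)

lemma gP_int (α : ℝ) {τ : ℂ} (hτ : 0 < τ.re) (x : ℝ) :
    ∫ u in Set.Ioi (0:ℝ), ((2 * (Real.sinh (α * u) * Real.sinh (x * Real.pi * u)) : ℝ) : ℂ) * Complex.exp (-τ * u^2/4) = sg τ * gP α τ x := by
  obtain ⟨i1, e1⟩ := gauss_cosh hτ ((α + x * Real.pi : ℝ) : ℂ)
  obtain ⟨i2, e2⟩ := gauss_cosh hτ ((α - x * Real.pi : ℝ) : ℂ)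
  rw [gP, mul_sub, ← e1, ← e2, ← integral_sub i1 i2]
  congr 1; funext u
  rw [← sub_mul]
  congr 1
  rw [← Complex.ofReal_mul, ← Complex.ofReal_mul, ← Complex.ofReal_cosh, ← Complex.ofReal_cosh, ← Complex.ofReal_sub]
  congr 1
  rw [show (α + x * Real.pi) * u = α * u + x * Real.pi * u by ring, show (α - x * Real.pi) * u = α * u - x * Real.pi * u by ring, Real.cosh_add, Real.cosh_sub]
  ring

lemma KKcosh_integral {α : ℝ} (h0 : 0 < α) (h1 : α < Real.pi) {τ : ℂ} (hτ : 0 < τ.re) : ∀ m : ℕ,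
    ∫ u in Set.Ioi (0:ℝ), ((KK α u * Real.cosh (((m:ℝ)+1/2) * Real.pi * u) : ℝ) : ℂ) * Complex.exp (-τ * u^2/4) =
      Hi α τ + sg τ * PP α τ m
  | 0 => by
    simp only [PP, mul_zero, add_zero, Hi]
    apply setIntegral_congr_fun measurableSet_Ioi
    intro u hu
    simp only
    rw [E0_eq α hu]
    simp
  | 1 => by
    have hh : Hi α τ = ∫ u in Set.Ioi (0:ℝ), ((KK α u * Real.cosh (1/2 * Real.pi * u) : ℝ) : ℂ) * Complex.exp (-τ * u^2/4) := by
      unfold Hi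
      apply setIntegral_congr_fun measurableSet_Ioi
      intro u hu
      simp only
      rw [E0_eq α hu]
    rw [← sub_eq_iff_eq_add', hh, ← integral_sub (KKcosh_int h0 h1 _ hτ) (KKcosh_int h0 h1 _ hτ)]
    simp only [PP]
    rw [← gP_int α hτ]
    apply setIntegral_congr_fun measurableSet_Ioi
    intro u hu
    simp only
    rw [← sub_mul, ← Complex.ofReal_sub]
    congr 2
    have hp := Real.pi_pos
    have h2 : 0 < Real.sinh (Real.pi * u) := Real.sinh_pos_iff.2 (mul_pos hp hu)
    unfold KK
    rw [show (((1:ℕ):ℝ)+1/2) * Real.pi * u = Real.pi * u + 1/2 * Real.pi * u by push_cast; ring,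
      show 1/2 * Real.pi * u = Real.pi * u - 1/2 * Real.pi * u by ring, ]
    rw [show Real.pi * u + (Real.pi * u - 1/2 * Real.pi * u) = Real.pi * u + 1/2 * Real.pi * u by ring, Real.cosh_add, Real.cosh_sub, show Real.pi * u - 1/2 * Real.pi * u = 1/2 * Real.pi * u by ring]
    have h3 := h2.ne'
    generalize Real.sinh (Real.pi * u) = s at h3 ⊢
    field_simp; ring
  | (m+2) => by
    have ih := KKcosh_integral h0 h1 hτ m
    simp only [PP]
    rw [mul_add, ← add_assoc, ← ih, ← sub_eq_iff_eq_add', ← integral_sub (KKcosh_int h0 h1 _ hτ) (KKcosh_int h0 h1 _ hτ), ← gP_int α hτ]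
    apply setIntegral_congr_fun measurableSet_Ioi
    intro u hu
    simp only
    rw [← sub_mul, ← Complex.ofReal_sub]
    congr 2
    have hp := Real.pi_pos
    have h2 : 0 < Real.sinh (Real.pi * u) := Real.sinh_pos_iff.2 (mul_pos hp hu)
    unfold KK
    rw [show ((((m+2:ℕ)):ℝ)+1/2) * Real.pi * u = (m+3/2) * Real.pi * u + Real.pi * u by push_cast; ring,
      show ((m:ℝ)+1/2) * Real.pi * u = (m+3/2) * Real.pi * u - Real.pi * u by ring, Real.cosh_add, Real.cosh_sub]
    have h3 := h2.ne'
    generalize Real.sinh (Real.pi * u) = s at h3 ⊢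
    field_simp; ring


end

end OPR

namespace OPR

section

open Finset MeasureTheory

lemma sqrt_conv {t : ℝ} (ht : 0 < t) : (1 / ((t:ℂ) / Real.pi)^(1/2:ℂ)) = ((√(Real.pi / t) : ℝ) : ℂ) := by
  have hp := Real.pi_pos
  rw [Real.sqrt_eq_rpow, Complex.ofReal_cpow (by positivity), one_div, ← Complex.inv_cpow]
  · congr 1
    · push_cast; rw [inv_div]
    · push_cast; rfl
  · rw [← Complex.ofReal_div, Complex.arg_ofReal_of_nonneg (by positivity)]; exact hp.ne

lemma sg_conv {t : ℝ} (ht : 0 < t) : sg t = ((√(Real.pi / t) : ℝ) : ℂ) := by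
  have hp := Real.pi_pos
  have : (Real.pi / ((t:ℂ)/4))^(1/2:ℂ) = ((√(Real.pi / (t/4)) : ℝ) : ℂ) := by
    rw [Real.sqrt_eq_rpow, Complex.ofReal_cpow (by positivity)]
    push_cast; rfl
  rw [sg, this, show Real.pi / (t/4) = 2^2 * (Real.pi / t) by field_simp; norm_num, Real.sqrt_mul (by positivity), Real.sqrt_sq (by norm_num)]
  push_cast; ring

lemma theta_real {t : ℝ} (ht : 0 < t) (u : ℝ) :
    ∃ T : ℝ, HasSum (fun n : ℕ => 2 * (-1)^(n+1) * Real.exp (-(n+1)^2 * t) * Real.cos ((n+1) * t * u)) (T - 1) ∧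
    HasSum (fun m : ℕ => 2 * √(Real.pi / t) * Real.exp (-t * u^2 / 4) * Real.exp (-Real.pi^2 * (m+1/2)^2/t) *
      Real.cosh ((m+1/2) * Real.pi * u)) T := by
  obtain ⟨T, h1, h2⟩ := theta_inv (τ := t) (by simpa using ht) u
  refine ⟨T.re, ?_, ?_⟩
  · have h3 := Complex.hasSum_re h1
    rw [Complex.sub_re, Complex.one_re] at h3
    convert h3 using 1
    funext n
    rw [← Complex.ofReal_re (2 * (-1)^(n+1) * Real.exp (-(n+1)^2 * t) * Real.cos ((n+1) * t * u))]
    congr 1; push_cast; rfl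
  · have h3 := Complex.hasSum_re h2
    convert h3 using 1
    funext n
    rw [sqrt_conv ht]
    rw [← Complex.ofReal_re (2 * √(Real.pi / t) * Real.exp (-t * u^2 / 4) * Real.exp (-Real.pi^2 * (n+1/2)^2/t) *
      Real.cosh ((n+1/2) * Real.pi * u))]
    congr 1; push_cast; rfl

noncomputable def thr (t u : ℝ) : ℝ := 1 + ∑' n : ℕ, 2 * (-1)^(n+1) * Real.exp (-(n+1)^2 * t) * Real.cos ((n+1) * t * u)

lemma summ_exp {t : ℝ} (ht : 0 < t) : Summable (fun n : ℕ => 2 * Real.exp (-((n:ℝ)+1)^2 * t)) := by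
  have hq : ‖(Real.exp (-t) : ℂ)‖ < 1 := by
    rw [Complex.norm_real, Real.norm_of_nonneg (Real.exp_pos _).le]; simpa using ht
  have := (summable_th hq).mul_left 2
  refine this.congr fun n => ?_
  rw [Complex.norm_real, Real.norm_of_nonneg (Real.exp_pos _).le, ← Real.exp_nat_mul]
  congr 2; push_cast; ring

lemma th_term_le (t u : ℝ) (n : ℕ) : ‖2 * (-1)^(n+1) * Real.exp (-((n:ℝ)+1)^2 * t) * Real.cos ((n+1) * t * u)‖ ≤ 2 * Real.exp (-((n:ℝ)+1)^2 * t) := by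
  rw [norm_mul, norm_mul, norm_mul]
  simp only [norm_pow, norm_neg, norm_one, one_pow, mul_one, Real.norm_ofNat]
  rw [Real.norm_of_nonneg (Real.exp_pos _).le]
  exact mul_le_of_le_one_right (by positivity) (Real.abs_cos_le_one _)

lemma thr_cont {t : ℝ} (ht : 0 < t) : Continuous (thr t) := by
  unfold thr
  refine continuous_const.add (continuous_tsum (fun n => by fun_prop) (summ_exp ht) (fun n u => th_term_le t u n))

lemma thr_le {t : ℝ} (ht : 0 < t) (u : ℝ) : ‖thr t u‖ ≤ 1 + ∑' n : ℕ, 2 * Real.exp (-((n:ℝ)+1)^2 * t) := by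
  unfold thr
  refine (norm_add_le _ _).trans ?_
  rw [norm_one]
  gcongr
  exact tsum_of_norm_bounded (summ_exp ht).hasSum (fun n => th_term_le t u n)

lemma thr_int {α : ℝ} (h0 : 0 < α) (h1 : α < Real.pi) {t : ℝ} (ht : 0 < t) :
    IntegrableOn (fun u => KK α u * thr t u) (Set.Ioi 0) := by
  have := (KK_int h0 h1).bdd_mul (c := 1 + ∑' n : ℕ, 2 * Real.exp (-((n:ℝ)+1)^2 * t)) (f := thr t) (thr_cont ht).aestronglyMeasurable (Filter.Eventually.of_forall (thr_le ht))
  unfold IntegrableOn; simpa only [mul_comm] using this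

noncomputable def Sr (α t : ℝ) : ℝ := 1/(1+Real.cos α) + ∑' n : ℕ, 2 * (-1)^(n+1) * Real.exp (-(n+1)^2 * t) / (Real.cosh ((n+1)*t) + Real.cos α)

lemma thr_A {α : ℝ} (h0 : 0 < α) (h1 : α < Real.pi) {t : ℝ} (ht : 0 < t) :
    ∫ u in Set.Ioi (0:ℝ), KK α u * thr t u = 1/2 * Real.sin α * Sr α t := by
  have hi : ∀ n : ℕ, IntegrableOn (fun u => KK α u * (2 * (-1)^(n+1) * Real.exp (-((n:ℝ)+1)^2 * t) * Real.cos ((n+1) * t * u))) (Set.Ioi 0) := by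
    intro n
    have := (KK_int h0 h1).bdd_mul (c := 2 * Real.exp (-((n:ℝ)+1)^2 * t)) (f := fun u => 2 * (-1)^(n+1) * Real.exp (-((n:ℝ)+1)^2 * t) * Real.cos ((n+1) * t * u)) (Continuous.aestronglyMeasurable (by fun_prop)) (Filter.Eventually.of_forall (fun u => th_term_le t u n))
    unfold IntegrableOn; simpa only [mul_comm] using this
  have hs := hasSum_integral_of_summable_integral_norm hi ?_
  · have e1 : ∀ n : ℕ, ∫ u in Set.Ioi (0:ℝ), KK α u * (2 * (-1)^(n+1) * Real.exp (-((n:ℝ)+1)^2 * t) * Real.cos ((n+1) * t * u)) =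
      1/2 * Real.sin α * (2 * (-1)^(n+1) * Real.exp (-(n+1)^2 * t) / (Real.cosh ((n+1)*t) + Real.cos α)) := by
      intro n
      have := KK_fourier h0 h1 ((n+1)*t)
      rw [show (fun u => KK α u * (2 * (-1)^(n+1) * Real.exp (-((n:ℝ)+1)^2 * t) * Real.cos ((n+1) * t * u))) =
        fun u => (2 * (-1)^(n+1) * Real.exp (-((n:ℝ)+1)^2 * t)) * (KK α u * Real.cos ((n+1) * t * u)) by funext u; ring, integral_const_mul, this]
      ring
    have e2 : ∀ u, KK α u * thr t u = KK α u + ∑' n : ℕ, KK α u * (2 * (-1)^(n+1) * Real.exp (-((n:ℝ)+1)^2 * t) * Real.cos ((n+1) * t * u)) := by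
      intro u; rw [thr, mul_add, mul_one, tsum_mul_left]
    have hk : ∫ u in Set.Ioi (0:ℝ), KK α u = 1/2 * (Real.sin α / (1 + Real.cos α)) := by
      have := KK_fourier h0 h1 0
      simpa using this
    have hi2 : IntegrableOn (fun u => ∑' n : ℕ, KK α u * (2 * (-1)^(n+1) * Real.exp (-((n:ℝ)+1)^2 * t) * Real.cos ((n+1) * t * u))) (Set.Ioi 0) := by
      have := (thr_int h0 h1 ht).sub (KK_int h0 h1)
      refine this.congr (Filter.Eventually.of_forall fun u => ?_)
      simp only [Pi.sub_apply]
      rw [e2]; ring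
    simp only [e2]
    rw [integral_add (KK_int h0 h1) hi2, ← hs.tsum_eq, hk]
    simp only [e1]
    rw [tsum_mul_left, Sr]
    ring
  · have hb := (summ_exp ht).mul_right (∫ u in Set.Ioi (0:ℝ), KK α u)
    refine Summable.of_nonneg_of_le (fun n => integral_nonneg (fun u => norm_nonneg _)) (fun n => ?_) hb
    rw [← integral_const_mul]
    apply setIntegral_mono_on (hi n).norm ((KK_int h0 h1).const_mul _) measurableSet_Ioi
    intro u hu
    rw [norm_mul, Real.norm_of_nonneg (KK_nonneg h0 hu), mul_comm]
    exact mul_le_mul_of_nonneg_right (th_term_le t u n) (KK_nonneg h0 hu)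

lemma thr_B {α : ℝ} (h0 : 0 < α) (h1 : α < Real.pi) {t : ℝ} (ht : 0 < t) :
    HasSum (fun m : ℕ => ∫ u in Set.Ioi (0:ℝ), KK α u * (2 * √(Real.pi / t) * Real.exp (-t * u^2 / 4) * Real.exp (-Real.pi^2 * (m+1/2)^2/t) *
      Real.cosh ((m+1/2) * Real.pi * u))) (1/2 * Real.sin α * Sr α t) := by
  rw [← thr_A h0 h1 ht]
  have hT : ∀ u, HasSum (fun m : ℕ => 2 * √(Real.pi / t) * Real.exp (-t * u^2 / 4) * Real.exp (-Real.pi^2 * (m+1/2)^2/t) *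
      Real.cosh ((m+1/2) * Real.pi * u)) (thr t u) := by
    intro u
    obtain ⟨T, a, b⟩ := theta_real ht u
    rw [thr, a.tsum_eq]; convert b using 1; ring
  refine hasSum_integral_of_dominated_convergence (bound := fun m u => KK α u * (2 * √(Real.pi / t) * Real.exp (-t * u^2 / 4) * Real.exp (-Real.pi^2 * (m+1/2)^2/t) *
      Real.cosh ((m+1/2) * Real.pi * u))) ?_ ?_ ?_ ?_ ?_
  · intro n
    exact ((KK_meas α).mul (Continuous.measurable (by fun_prop))).aestronglyMeasurable
  · intro n
    filter_upwards [ae_restrict_mem measurableSet_Ioi] with u hu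
    rw [Real.norm_of_nonneg]
    have := KK_nonneg h0 hu
    have := Real.cosh_pos (((n:ℝ)+1/2) * Real.pi * u)
    positivity
  · exact Filter.Eventually.of_forall fun u => (hT u).summable.mul_left _
  · refine (thr_int h0 h1 ht).congr (Filter.Eventually.of_forall fun u => ?_)
    simp only
    rw [((hT u).mul_left _).tsum_eq]
  · exact Filter.Eventually.of_forall fun u => (hT u).mul_left _

noncomputable def Am (τ : ℂ) (m : ℕ) : ℂ := Complex.exp (-Real.pi^2 * (m+1/2)^2/τ)
noncomputable def Th (τ : ℂ) : ℂ := 1 + ∑' n : ℕ, 2 * (-1)^(n+1) * Complex.exp (-(n+1)^2 * τ)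
noncomputable def Sa (α : ℝ) (τ : ℂ) : ℂ := 1/(1+Real.cos α) + ∑' n : ℕ, 2 * (-1)^(n+1) * Complex.exp (-(n+1)^2 * τ) / (Complex.cosh ((n+1)*τ) + Real.cos α)

lemma hasSum_Th {τ : ℂ} (hτ : 0 < τ.re) : HasSum (fun m => 2 * (1 / (τ / Real.pi)^(1/2:ℂ)) * Am τ m) (Th τ) := by
  obtain ⟨T, a, b⟩ := theta_inv hτ 0
  have : Th τ = T := by
    rw [Th]
    have := a.tsum_eq
    simp only [mul_zero, Complex.cos_zero, mul_one] at this
    rw [this]; ring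
  rw [this]
  simpa [Am] using b

lemma real_identity {α : ℝ} (h0 : 0 < α) (h1 : α < Real.pi) {t : ℝ} (ht : 0 < t) :
    HasSum (fun m => Am t m * PP α t m) ((t / (2 * Real.pi)) * (1/2 * Real.sin α * Sa α t - Th t * Hi α t)) := by
  have hp := Real.pi_pos
  have hr : 0 < √(Real.pi / t) := Real.sqrt_pos.2 (by positivity)
  have h2 := (Complex.hasSum_ofReal.2 (thr_B h0 h1 ht))
  have hT := (hasSum_Th (τ := t) (by simpa using ht)).mul_right (Hi α t)
  have e1 : ((1/2 * Real.sin α * Sr α t : ℝ):ℂ) = 1/2 * Real.sin α * Sa α t := by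
    rw [Sr, Sa]; push_cast; rfl
  rw [e1] at h2
  have e2 : ∀ m : ℕ, ((∫ u in Set.Ioi (0:ℝ), KK α u * (2 * √(Real.pi / t) * Real.exp (-t * u^2 / 4) * Real.exp (-Real.pi^2 * (m+1/2)^2/t) *
      Real.cosh ((m+1/2) * Real.pi * u)) : ℝ) : ℂ) = 2 * √(Real.pi/t) * Am t m * (Hi α t + √(Real.pi/t) * PP α t m) := by
    intro m
    rw [show Hi α t + √(Real.pi/t) * PP α t m = Hi α t + sg t * PP α t m by rw [sg_conv ht], ← KKcosh_integral h0 h1 (by simpa using ht) m, ← integral_const_mul, ← integral_complex_ofReal]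
    congr 1; funext u
    rw [Am]; push_cast; ring
  have h3 := (h2.sub hT).mul_left ((t:ℂ) / (2 * Real.pi))
  refine hasSum_of_eq h3 (fun m => ?_)
  rw [e2, sqrt_conv ht]
  have e3 : ((√(Real.pi/t):ℝ):ℂ)^2 = Real.pi / t := by
    rw [← Complex.ofReal_pow, Real.sq_sqrt (by positivity)]; push_cast; rfl
  have hpc : (Real.pi : ℂ) ≠ 0 := by exact_mod_cast hp.ne'
  have htc : (t : ℂ) ≠ 0 := by exact_mod_cast ht.ne'
  have : (t:ℂ) / (2 * Real.pi) * (2 * (Real.pi / t)) = 1 := by field_simp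
  rw [← e3] at this
  linear_combination -(Am t m * PP α t m) * this


end

end OPR

namespace OPR

section

open Finset MeasureTheory

def HP : Set ℂ := {τ | 0 < τ.re}

lemma HP_open : IsOpen HP := isOpen_lt continuous_const Complex.continuous_re

lemma HP_conv : Convex ℝ HP := convex_halfSpace_re_gt 0

lemma exp_norm_lt {τ : ℂ} (hτ : 0 < τ.re) : ‖Complex.exp (-τ)‖ < 1 := by
  rw [Complex.norm_exp]; simpa using hτ

lemma VTh {τ : ℂ} (hτ : 0 < τ.re) : V (Complex.exp (-τ)) (Complex.exp (-τ)) * Th τ = 1 := by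
  have := V_theta (exp_norm_lt hτ)
  rw [← this, Th]
  congr 3; funext n
  rw [← Complex.exp_nat_mul]
  congr 2; push_cast; ring

noncomputable def Rf (φ : ℝ) (τ : ℂ) : ℂ := TT (Complex.exp (-τ)) (wcos φ)

lemma Sa_Rf {α : ℝ} (h0 : 0 < α) (h1 : α < Real.pi) {τ : ℂ} (hτ : 0 < τ.re) :
    Th τ * Rf (Real.pi - α) τ = (1 + Real.cos α) * Sa α τ := by
  have hcos : -1 < Real.cos α := by
    rw [← Real.cos_pi]; exact Real.cos_lt_cos_of_nonneg_of_le_pi h0.le le_rfl h1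
  have hc0 : (1 + Real.cos α : ℂ) ≠ 0 := by
    rw [← Complex.ofReal_one, ← Complex.ofReal_add, Complex.ofReal_ne_zero]; linarith
  rw [Rf, TT_cos' (exp_norm_lt hτ), ← mul_assoc, mul_comm (Th τ), VTh hτ, one_mul, Sa, mul_add, mul_one_div_cancel hc0, ← tsum_mul_left, ← tsum_mul_left]
  congr 2; funext n
  rw [Real.cos_pi_sub]
  set C : ℂ := (Real.cos α : ℂ)
  rw [show ((-Real.cos α : ℝ):ℂ) = -C from Complex.ofReal_neg _]
  have e1 : Complex.exp (-τ) ^ ((n+1)^2+(n+1)) = Complex.exp (-(n+1)^2 * τ) * Complex.exp (-τ)^(n+1) := by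
    rw [pow_add]
    congr 1
    rw [← Complex.exp_nat_mul]; congr 1; push_cast; ring
  have e2 : Complex.exp (-τ)^(n+1) = Complex.exp (-((n+1)*τ)) := by
    rw [← Complex.exp_nat_mul]; congr 1; push_cast; ring
  rw [e1, e2, Complex.cosh]
  have hx := Complex.exp_ne_zero (-((n+1)*τ))
  have e3 : Complex.exp ((n+1)*τ) = (Complex.exp (-((n+1)*τ)))⁻¹ := by rw [← Complex.exp_neg, neg_neg]
  rw [e3]
  generalize Complex.exp (-((n+1)*τ)) = x at hx ⊢
  generalize Complex.exp (-(n+1)^2 * τ) = y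
  have e4 : (x⁻¹ + x)/2 + C = (1 - 2 * -C * x + x^2) / (2 * x) := by field_simp; ring
  rw [e4, div_div_eq_mul_div]
  ring

lemma Rf_diff (φ : ℝ) : DifferentiableOn ℂ (Rf φ) HP := by
  intro τ hτ
  set ε := τ.re / 2
  have hε : 0 < ε := by have : 0 < τ.re := hτ; positivity
  have hU : IsOpen {z : ℂ | ε < z.re} := isOpen_lt continuous_const Complex.continuous_re
  have hm : τ ∈ {z : ℂ | ε < z.re} := by
    have : 0 < τ.re := hτ
    show τ.re/2 < τ.re; linarith
  have hr : ‖Complex.exp (-(ε:ℂ))‖ < 1 := exp_norm_lt (by simpa using hε)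
  have : DifferentiableOn ℂ (fun z => ∑' s : Multiset ℕ, wcos φ s.sup s.card * W0 (Complex.exp (-z)) s) {z : ℂ | ε < z.re} := by
    refine Complex.differentiableOn_tsum_of_summable_norm (summable_W0 hr) ?_ hU ?_
    · intro s
      unfold W0 W
      split_ifs
      · fun_prop
      · fun_prop
    · intro s w hw
      rw [norm_mul]
      refine (mul_le_of_le_one_left (norm_nonneg _) (wcos_le _ _ _)).trans ?_
      unfold W0
      split_ifs
      · simp
      · rw [norm_W, norm_W]
        have : ‖Complex.exp (-w)‖ ≤ ‖Complex.exp (-(ε:ℂ))‖ := by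
          rw [Complex.norm_exp, Complex.norm_exp, Real.exp_le_exp]
          have : ε < w.re := hw
          simp; linarith
        have := pow_le_pow_left₀ (norm_nonneg _) this s.sum
        exact mul_le_mul_of_nonneg_left this (by positivity)
  exact ((this τ hm).differentiableAt (hU.mem_nhds hm)).differentiableWithinAt

lemma Th_diff : DifferentiableOn ℂ Th HP := by
  intro τ hτ
  set ε := τ.re / 2
  have hε : 0 < ε := by have : 0 < τ.re := hτ; positivity
  have hU : IsOpen {z : ℂ | ε < z.re} := isOpen_lt continuous_const Complex.continuous_re
  have hm : τ ∈ {z : ℂ | ε < z.re} := by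
    have : 0 < τ.re := hτ
    show τ.re/2 < τ.re; linarith
  have : DifferentiableOn ℂ (fun z => ∑' n : ℕ, 2 * (-1)^(n+1) * Complex.exp (-(n+1)^2 * z)) {z : ℂ | ε < z.re} := by
    refine Complex.differentiableOn_tsum_of_summable_norm (summ_exp hε) ?_ hU ?_
    · intro n; fun_prop
    · intro n w hw
      have hw' : ε < w.re := hw
      rw [norm_mul, norm_mul]
      simp only [norm_pow, norm_neg, norm_one, one_pow, mul_one, Complex.norm_ofNat]
      rw [Complex.norm_exp, show (-((n:ℂ)+1)^2 * w) = ((-((n:ℝ)+1)^2 : ℝ):ℂ) * w by push_cast; ring, Complex.re_ofReal_mul]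
      refine mul_le_mul_of_nonneg_left (Real.exp_le_exp.2 ?_) (by norm_num)
      nlinarith [sq_nonneg ((n:ℝ)+1)]
  exact (((this τ hm).differentiableAt (hU.mem_nhds hm)).const_add 1).differentiableWithinAt

lemma E0_eq' (α : ℝ) {u : ℝ} (hu : 0 < u) : E0 α u = KK α u * Real.cosh ((Real.pi/2) * u) := by
  rw [E0_eq α hu]; congr 2; ring

lemma E0_meas (α : ℝ) : Measurable (E0 α) := by
  unfold E0
  exact (Continuous.measurable (by fun_prop)).div (Continuous.measurable (by fun_prop))

lemma Hi_int {α : ℝ} (h0 : 0 < α) (h1 : α < Real.pi) {τ : ℂ} (hτ : 0 < τ.re) :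
    IntegrableOn (fun u : ℝ => (E0 α u : ℂ) * Complex.exp (-τ * u^2/4)) (Set.Ioi 0) := by
  refine (KKcosh_int h0 h1 (Real.pi/2) hτ).congr ?_
  filter_upwards [ae_restrict_mem measurableSet_Ioi] with u hu
  rw [E0_eq' α hu]

lemma norm_gauss (τ : ℂ) (u : ℝ) : ‖Complex.exp (-τ * u^2/4)‖ = Real.exp (-τ.re * u^2/4) := by
  rw [Complex.norm_exp]
  congr 1
  rw [show -τ * (u:ℂ)^2/4 = -τ * ((u^2/4 : ℝ):ℂ) by push_cast; ring, Complex.re_mul_ofReal]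
  simp; ring

lemma Hi_int_norm {α : ℝ} (h0 : 0 < α) (h1 : α < Real.pi) {t : ℝ} (ht : 0 < t) :
    IntegrableOn (fun u : ℝ => ‖E0 α u‖ * Real.exp (-t * u^2/4)) (Set.Ioi 0) := by
  refine (Hi_int h0 h1 (τ := t) (by simpa using ht)).norm.congr (Filter.Eventually.of_forall fun u => ?_)
  simp only
  rw [norm_mul, norm_gauss, Complex.norm_real, Complex.ofReal_re]

lemma Hi_diff {α : ℝ} (h0 : 0 < α) (h1 : α < Real.pi) : DifferentiableOn ℂ (Hi α) HP := by
  intro τ hτ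
  set ε := τ.re / 2
  have hτ' : 0 < τ.re := hτ
  have hε : 0 < ε := by positivity
  have hU : IsOpen {z : ℂ | ε < z.re} := isOpen_lt continuous_const Complex.continuous_re
  have hm : τ ∈ {z : ℂ | ε < z.re} := by
    show τ.re/2 < τ.re; linarith
  have := hasDerivAt_integral_of_dominated_loc_of_deriv_le (μ := volume.restrict (Set.Ioi (0:ℝ))) (x₀ := τ) (s := {z : ℂ | ε < z.re})
    (F := fun z u => (E0 α u : ℂ) * Complex.exp (-z * u^2/4)) (F' := fun z u => (E0 α u : ℂ) * (Complex.exp (-z * u^2/4) * (-u^2/4)))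
    (bound := fun u => (2/ε) * (‖E0 α u‖ * Real.exp (-(ε/2) * u^2/4))) (hU.mem_nhds hm) ?_ (Hi_int h0 h1 hτ') ?_ ?_ ?_ ?_
  · exact this.2.differentiableAt.differentiableWithinAt
  · exact Filter.Eventually.of_forall fun z => ((Complex.measurable_ofReal.comp (E0_meas α)).mul (by fun_prop)).aestronglyMeasurable
  · exact ((Complex.measurable_ofReal.comp (E0_meas α)).mul (by fun_prop)).aestronglyMeasurable
  · refine Filter.Eventually.of_forall fun u z hz => ?_
    have hz' : ε < z.re := hz
    rw [norm_mul, norm_mul, norm_gauss, Complex.norm_real, mul_left_comm (2/ε)]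
    refine mul_le_mul_of_nonneg_left ?_ (norm_nonneg (E0 α u))
    have e1 : ‖-(u:ℂ)^2/4‖ = u^2/4 := by
      rw [show -(u:ℂ)^2/4 = ((-(u^2/4) : ℝ):ℂ) by push_cast; ring, Complex.norm_real, norm_neg, Real.norm_of_nonneg (by positivity)]
    rw [e1]
    have e2 : u^2/4 ≤ (2/ε) * Real.exp (ε * u^2/8) := by
      have := Real.add_one_le_exp (ε * u^2/8)
      have h3 : ε * u^2/8 ≤ Real.exp (ε * u^2/8) := by linarith
      calc u^2/4 = (2/ε) * (ε * u^2/8) := by field_simp; ring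
        _ ≤ _ := mul_le_mul_of_nonneg_left h3 (by positivity)
    have e3 : Real.exp (-z.re * u^2/4) ≤ Real.exp (-ε * u^2/4) := by
      rw [Real.exp_le_exp]; nlinarith [sq_nonneg u]
    calc Real.exp (-z.re * u^2/4) * (u^2/4) ≤ Real.exp (-ε * u^2/4) * ((2/ε) * Real.exp (ε * u^2/8)) :=
          mul_le_mul e3 e2 (by positivity) (by positivity)
      _ = (2/ε) * (Real.exp (-ε * u^2/4) * Real.exp (ε * u^2/8)) := by ring
      _ = _ := by rw [← Real.exp_add]; congr 2; ring
  · exact (Hi_int_norm h0 h1 (by positivity : 0 < ε/2)).const_mul _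
  · refine Filter.Eventually.of_forall fun u z hz => ?_
    refine HasDerivAt.const_mul _ ?_
    refine HasDerivAt.cexp ?_
    have : HasDerivAt (fun z : ℂ => z * (-(u:ℂ)^2/4)) (1 * (-(u:ℂ)^2/4)) z := (hasDerivAt_id z).mul_const _
    rw [one_mul] at this
    have e5 : (fun z : ℂ => -z * (u:ℂ)^2/4) = fun z : ℂ => z * (-(u:ℂ)^2/4) := by funext z; ring
    rw [e5]; exact this

lemma exp_sub_le {a b : ℂ} {R : ℝ} (ha : a.re ≤ R) (hb : b.re ≤ R) : ‖Complex.exp a - Complex.exp b‖ ≤ Real.exp R * ‖a - b‖ := by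
  refine Convex.norm_image_sub_le_of_norm_deriv_le (𝕜 := ℂ) (s := {z : ℂ | z.re ≤ R}) (fun z _ => Complex.differentiable_exp z) ?_ (convex_halfSpace_re_le R) hb ha
  intro z hz
  rw [Complex.deriv_exp, Complex.norm_exp, Real.exp_le_exp]
  exact hz

lemma re_sq_div (x : ℝ) (τ : ℂ) : ((x:ℂ)^2/τ).re = x^2 * (1/τ).re := by
  rw [show (x:ℂ)^2/τ = ((x^2:ℝ):ℂ) * (1/τ) by push_cast; ring, Complex.re_ofReal_mul]

lemma rho_pos {τ : ℂ} (hτ : 0 < τ.re) : 0 < (1/τ).re := by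
  have hτ0 : τ ≠ 0 := by intro h; simp [h] at hτ
  rw [one_div, Complex.inv_re]
  have := Complex.normSq_pos.2 hτ0
  positivity

lemma gP_le {α : ℝ} (h0 : 0 < α) {τ : ℂ} (hτ : 0 < τ.re) {x : ℝ} (hx : 0 ≤ x) :
    ‖gP α τ x‖ ≤ 4 * Real.pi * α * x * ‖τ‖⁻¹ * Real.exp ((1/τ).re * (α + x * Real.pi)^2) := by
  have hp := Real.pi_pos
  have hr := rho_pos hτ
  have h := exp_sub_le (a := ((α + x * Real.pi : ℝ) : ℂ)^2/τ) (b := ((α - x * Real.pi : ℝ) : ℂ)^2/τ) (R := (1/τ).re * (α + x * Real.pi)^2)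
    (by rw [re_sq_div, mul_comm]) (by
      rw [re_sq_div, mul_comm]
      refine mul_le_mul_of_nonneg_left ?_ hr.le
      have : 0 ≤ α * (x * Real.pi) := by positivity
      nlinarith)
  have e : ((α + x * Real.pi : ℝ) : ℂ)^2/τ - ((α - x * Real.pi : ℝ) : ℂ)^2/τ = ((4 * Real.pi * α * x : ℝ) : ℂ) * τ⁻¹ := by
    push_cast; ring
  rw [e, norm_mul, norm_inv, Complex.norm_real, Real.norm_of_nonneg (by positivity)] at h
  rw [gP]
  linarith

lemma PP_le {α : ℝ} (h0 : 0 < α) {τ : ℂ} (hτ : 0 < τ.re) : ∀ m : ℕ,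
    ‖PP α τ m‖ ≤ 4 * Real.pi * α * m^2 * ‖τ‖⁻¹ * Real.exp ((1/τ).re * (α + (m - 1/2) * Real.pi)^2)
  | 0 => by simp [PP]
  | 1 => by
    have := gP_le h0 hτ (x := 1/2) (by norm_num)
    have hp := Real.pi_pos
    simp only [PP]
    refine this.trans ?_
    have e : ((1:ℕ):ℝ) - 1/2 = 1/2 := by norm_num
    rw [e]
    refine mul_le_mul_of_nonneg_right (mul_le_mul_of_nonneg_right (mul_le_mul_of_nonneg_left ?_ (by positivity)) (by positivity)) (by positivity)
    norm_num
  | (m+2) => by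
    have ih := PP_le h0 hτ m
    have := gP_le h0 hτ (x := m+3/2) (by positivity)
    have hp := Real.pi_pos
    have hr := rho_pos hτ
    have e : ((m+2:ℕ):ℝ) - 1/2 = m + 3/2 := by push_cast; ring
    simp only [PP]
    rw [e]
    refine (norm_add_le _ _).trans ?_
    have h2 : Real.exp ((1/τ).re * (α + (m - 1/2) * Real.pi)^2) ≤ Real.exp ((1/τ).re * (α + (m + 3/2) * Real.pi)^2) := by
      rw [Real.exp_le_exp]
      refine mul_le_mul_of_nonneg_left ?_ hr.le
      have : 0 ≤ (m:ℝ) := by positivity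
      apply sq_le_sq'
      · nlinarith [mul_nonneg this hp.le]
      · nlinarith
    set Ex := Real.exp ((1/τ).re * (α + (m + 3/2) * Real.pi)^2)
    have h3 : ‖PP α τ m‖ ≤ 4 * Real.pi * α * m^2 * ‖τ‖⁻¹ * Ex := ih.trans (mul_le_mul_of_nonneg_left h2 (by positivity))
    have h4 : 0 ≤ 4 * Real.pi * α * ‖τ‖⁻¹ * Ex := by positivity
    push_cast
    have h5 : 0 ≤ (m:ℝ) := by positivity
    nlinarith [mul_nonneg h4 h5]

lemma AP_le {α : ℝ} (h0 : 0 < α) (_h1 : α < Real.pi) {τ : ℂ} (hτ : 0 < τ.re) (m : ℕ) :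
    ‖Am τ (m+1) * PP α τ (m+1)‖ ≤ 4 * Real.pi * α * ‖τ‖⁻¹ * Real.exp (-((1/τ).re * ((Real.pi - α) * (2 * Real.pi + α)))) *
      ((m+1)^2 * Real.exp (-(2 * Real.pi * (Real.pi - α) * (1/τ).re * m))) := by
  have h := PP_le h0 hτ (m+1)
  have ha : ‖Am τ (m+1)‖ = Real.exp (-((1/τ).re * (Real.pi * (m + 3/2))^2)) := by
    rw [Am, Complex.norm_exp]
    congr 1
    rw [show -(Real.pi:ℂ)^2 * (((m+1:ℕ):ℂ)+1/2)^2/τ = ((-(Real.pi * (m + 3/2))^2 : ℝ) : ℂ) * (1/τ) by push_cast; ring, Complex.re_ofReal_mul]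
    ring
  rw [norm_mul, ha]
  refine (mul_le_mul_of_nonneg_left h (Real.exp_pos _).le).trans (le_of_eq ?_)
  set ρ := (1/τ).re
  push_cast
  rw [show -(ρ * (Real.pi * (m + 3/2))^2) = -(ρ * ((Real.pi - α) * (2 * Real.pi + α))) + -(2 * Real.pi * (Real.pi - α) * ρ * m) - ρ * (α + (m + 1 - 1/2) * Real.pi)^2 by ring, Real.exp_sub, Real.exp_add]
  field_simp

lemma summ_sq {κ : ℝ} (hκ : 0 < κ) : Summable (fun m : ℕ => ((m:ℝ)+1)^2 * Real.exp (-(κ * m))) := by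
  have h := summable_pow_mul_geometric_of_norm_lt_one 2 (r := Real.exp (-κ)) (by rw [Real.norm_of_nonneg (Real.exp_pos _).le]; simpa using hκ)
  have h1 := ((summable_nat_add_iff 1).2 h).mul_left (Real.exp κ)
  refine h1.congr fun m => ?_
  push_cast
  rw [← Real.exp_nat_mul, mul_left_comm, ← Real.exp_add]
  congr 2; push_cast; ring

noncomputable def GG (α : ℝ) (τ : ℂ) : ℂ := ∑' m : ℕ, Am τ (m+1) * PP α τ (m+1)

lemma PP_diff {α : ℝ} {τ : ℂ} (hτ : τ ≠ 0) : ∀ m : ℕ, DifferentiableAt ℂ (fun z => PP α z m) τ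
  | 0 => by simp only [PP]; fun_prop
  | 1 => by simp only [PP, gP]; fun_prop (disch := assumption)
  | (m+2) => by
    have := PP_diff (α := α) hτ m
    simp only [PP, gP]; fun_prop (disch := assumption)

lemma GG_diff {α : ℝ} (h0 : 0 < α) (h1 : α < Real.pi) : DifferentiableOn ℂ (GG α) HP := by
  intro τ hτ
  have hτ' : 0 < τ.re := hτ
  have hτ0 : τ ≠ 0 := by intro h; simp [h] at hτ'
  have hp := Real.pi_pos
  set ε := (1/τ).re / 2
  have hρ := rho_pos hτ'
  have hε : 0 < ε := by positivity
  set δ := ‖τ‖ / 2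
  have hδ : 0 < δ := by have := norm_pos_iff.2 hτ0; positivity
  set U : Set ℂ := {z : ℂ | 0 < z.re ∧ ε < z.re / Complex.normSq z ∧ δ < ‖z‖}
  have hnb : U ∈ nhds τ := by
    have hc : ContinuousAt (fun z : ℂ => z.re / Complex.normSq z) τ :=
      Complex.continuous_re.continuousAt.div Complex.continuous_normSq.continuousAt (Complex.normSq_pos.2 hτ0).ne'
    have e1 : ε < τ.re / Complex.normSq τ := by
      have : τ.re / Complex.normSq τ = (1/τ).re := by rw [one_div, Complex.inv_re]
      rw [this]; show (1/τ).re/2 < _; linarith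
    have e2 : δ < ‖τ‖ := by show ‖τ‖/2 < _; linarith [norm_pos_iff.2 hτ0]
    filter_upwards [HP_open.mem_nhds hτ, hc.eventually (lt_mem_nhds e1), continuous_norm.continuousAt.eventually (lt_mem_nhds e2)] with z a b c
    exact ⟨a, b, c⟩
  obtain ⟨W, hWU, hWo, hWτ⟩ := mem_nhds_iff.1 hnb
  have key : DifferentiableOn ℂ (GG α) W := by
    refine Complex.differentiableOn_tsum_of_summable_norm (u := fun m : ℕ => 4 * Real.pi * α * δ⁻¹ * (((m:ℝ)+1)^2 * Real.exp (-(2 * Real.pi * (Real.pi - α) * ε * m)))) 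
      ((summ_sq (κ := 2 * Real.pi * (Real.pi - α) * ε) (by have : 0 < Real.pi - α := by linarith
                                                           positivity)).mul_left _) ?_ hWo ?_
    · intro m z hz
      have hz0 : z ≠ 0 := norm_pos_iff.1 (hδ.trans (hWU hz).2.2)
      refine DifferentiableAt.differentiableWithinAt (DifferentiableAt.mul ?_ (PP_diff hz0 _))
      unfold Am; fun_prop (disch := assumption)
    · intro m z hz
      obtain ⟨a, b, c⟩ := hWU hz
      refine (AP_le h0 h1 a m).trans ?_
      have eρ : (1/z).re = z.re / Complex.normSq z := by rw [one_div, Complex.inv_re]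
      rw [← eρ] at b
      have hz : 0 < ‖z‖ := hδ.trans c
      have hpa : 0 < Real.pi - α := by linarith
      have b1 : Real.exp (-((1/z).re * ((Real.pi - α) * (2 * Real.pi + α)))) ≤ 1 := by
        rw [Real.exp_le_one_iff, neg_nonpos]
        have := hε.trans b
        positivity
      have b2 : Real.exp (-(2 * Real.pi * (Real.pi - α) * (1/z).re * m)) ≤ Real.exp (-(2 * Real.pi * (Real.pi - α) * ε * m)) := by
        rw [Real.exp_le_exp, neg_le_neg_iff]
        refine mul_le_mul_of_nonneg_right (mul_le_mul_of_nonneg_left b.le (by positivity)) (by positivity)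
      have b3 : ‖z‖⁻¹ ≤ δ⁻¹ := inv_anti₀ hδ c.le
      have b4 : 4 * Real.pi * α * ‖z‖⁻¹ * Real.exp (-((1/z).re * ((Real.pi - α) * (2 * Real.pi + α)))) ≤ 4 * Real.pi * α * δ⁻¹ := by
        calc _ ≤ 4 * Real.pi * α * δ⁻¹ * 1 := mul_le_mul (mul_le_mul_of_nonneg_left b3 (by positivity)) b1 (by positivity) (by positivity)
          _ = _ := mul_one _
      exact mul_le_mul b4 (mul_le_mul_of_nonneg_left b2 (by positivity)) (by positivity) (by positivity)
  exact ((key τ hWτ).differentiableAt (hWo.mem_nhds hWτ)).differentiableWithinAt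

lemma real_id2 {α : ℝ} (h0 : 0 < α) (h1 : α < Real.pi) {t : ℝ} (ht : 0 < t) :
    GG α t = (t / (2 * Real.pi)) * (1/2 * (Real.sin α / (1 + Real.cos α)) * (Th t * Rf (Real.pi - α) t) - Th t * Hi α t) := by
  have h := real_identity h0 h1 ht
  have hcos : -1 < Real.cos α := by
    rw [← Real.cos_pi]; exact Real.cos_lt_cos_of_nonneg_of_le_pi h0.le le_rfl h1
  have hc0 : (1 + Real.cos α : ℂ) ≠ 0 := by
    rw [← Complex.ofReal_one, ← Complex.ofReal_add, Complex.ofReal_ne_zero]; linarith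
  have h2 := (hasSum_nat_add_iff' 1).2 h
  rw [GG, h2.tsum_eq, Sa_Rf h0 h1 (by simpa using ht)]
  simp only [Finset.sum_range_one, PP, mul_zero, sub_zero]
  congr 2
  generalize (1 + Real.cos α : ℂ) = x at hc0 ⊢
  field_simp

lemma main_id {α : ℝ} (h0 : 0 < α) (h1 : α < Real.pi) {τ : ℂ} (hτ : 0 < τ.re) :
    GG α τ = (τ / (2 * Real.pi)) * (1/2 * (Real.sin α / (1 + Real.cos α)) * (Th τ * Rf (Real.pi - α) τ) - Th τ * Hi α τ) := by
  have hL : AnalyticOnNhd ℂ (GG α) HP := (GG_diff h0 h1).analyticOnNhd HP_open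
  have hR : AnalyticOnNhd ℂ (fun τ => (τ / (2 * Real.pi)) * (1/2 * (Real.sin α / (1 + Real.cos α)) * (Th τ * Rf (Real.pi - α) τ) - Th τ * Hi α τ)) HP := by
    refine DifferentiableOn.analyticOnNhd ?_ HP_open
    exact ((differentiableOn_id.div_const _).mul (((Th_diff.mul (Rf_diff _)).const_mul _).sub (Th_diff.mul (Hi_diff h0 h1))))
  have hf : ∃ᶠ z in nhdsWithin (1:ℂ) {1}ᶜ, GG α z = (fun τ => (τ / (2 * Real.pi)) * (1/2 * (Real.sin α / (1 + Real.cos α)) * (Th τ * Rf (Real.pi - α) τ) - Th τ * Hi α τ)) z := by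
    have ht : Filter.Tendsto (fun n : ℕ => (((1 + 1/((n:ℝ)+1) : ℝ)) : ℂ)) Filter.atTop (nhdsWithin (1:ℂ) {1}ᶜ) := by
      rw [tendsto_nhdsWithin_iff]
      constructor
      · have := (tendsto_one_div_add_atTop_nhds_zero_nat (𝕜 := ℝ)).const_add 1
        rw [add_zero] at this
        exact (Complex.continuous_ofReal.tendsto 1).comp this
      · refine Filter.Eventually.of_forall fun n => ?_
        have : (0:ℝ) < 1/((n:ℝ)+1) := by positivity
        simp only [Set.mem_compl_iff, Set.mem_singleton_iff]
        rw [← Complex.ofReal_one, Complex.ofReal_inj]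
        linarith
    refine ht.frequently (Filter.Frequently.of_forall fun n => ?_)
    exact real_id2 h0 h1 (by positivity)
  exact hL.eqOn_of_preconnected_of_frequently_eq hR HP_conv.isPreconnected (by simp [HP]) hf hτ

lemma Rf_formula {α : ℝ} (h0 : 0 < α) (h1 : α < Real.pi) {τ : ℂ} (hτ : 0 < τ.re) :
    Rf (Real.pi - α) τ = ((1 + Real.cos α)/Real.sin α : ℝ) * (2 * Hi α τ + V (Complex.exp (-τ)) (Complex.exp (-τ)) * (4 * Real.pi / τ) * GG α τ) := by
  have hcos : -1 < Real.cos α := by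
    rw [← Real.cos_pi]; exact Real.cos_lt_cos_of_nonneg_of_le_pi h0.le le_rfl h1
  have hc0 : (1 + Real.cos α : ℂ) ≠ 0 := by
    rw [← Complex.ofReal_one, ← Complex.ofReal_add, Complex.ofReal_ne_zero]; linarith
  have hs0 : (Real.sin α : ℂ) ≠ 0 := by
    rw [Complex.ofReal_ne_zero]; exact (Real.sin_pos_of_pos_of_lt_pi h0 h1).ne'
  have hτ0 : τ ≠ 0 := by intro h; simp [h] at hτ
  have hpc : (Real.pi : ℂ) ≠ 0 := by exact_mod_cast Real.pi_pos.ne'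
  rw [main_id h0 h1 hτ]
  have hV := VTh hτ
  generalize V (Complex.exp (-τ)) (Complex.exp (-τ)) = v at hV ⊢
  generalize Th τ = θ at hV ⊢
  rw [Complex.ofReal_div, Complex.ofReal_add, Complex.ofReal_one]
  generalize (Real.sin α : ℂ) = s at hs0 ⊢
  generalize (Real.cos α : ℂ) = C at hc0 ⊢
  have e : (4 * Real.pi / τ) * (τ / (2 * Real.pi)) = 2 := by field_simp; norm_num
  have e2 : (1 + C)/s * (s / (1+C)) = 1 := by field_simp
  generalize Rf (Real.pi - α) τ = R
  generalize Hi α τ = H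
  linear_combination (-(1+C)/s * v * (1/2 * (s/(1+C)) * (θ * R) - θ * H)) * e - (R * θ * v) * e2 + (2 * H * (1+C)/s - R) * hV

end

end OPR

namespace OPR

section

open Finset MeasureTheory

lemma hasSum_logratio {z : ℂ} (hz : ‖z‖ < 1) :
    HasSum (fun n : ℕ => (1 - (-1)^n) * (z^n).re / n) (Real.log ‖1 + z‖ - Real.log ‖1 - z‖) := by
  have h1 := Complex.hasSum_re (Complex.hasSum_taylorSeries_neg_log hz)
  have h2 := Complex.hasSum_re (Complex.hasSum_taylorSeries_neg_log (z := -z) (by simpa using hz))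
  have h3 := h1.sub h2
  rw [Complex.neg_re, Complex.neg_re, Complex.log_re, Complex.log_re, sub_neg_eq_add] at h3
  rw [show Real.log ‖1 + z‖ - Real.log ‖1 - z‖ = -Real.log ‖1 - z‖ - -Real.log ‖1 + z‖ by ring]
  rw [show -Real.log ‖1 - z‖ - -Real.log ‖1 + z‖ = -Real.log ‖1 - z‖ + Real.log ‖1 - -z‖ by rw [sub_neg_eq_add, sub_neg_eq_add]]
  have hfun : (fun n : ℕ => (1 - (-1)^n) * (z^n).re / n) = fun b : ℕ => (z ^ b / (b:ℂ)).re - ((-z) ^ b / (b:ℂ)).re := by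
    funext n
    rw [← Complex.sub_re, neg_pow z]
    rw [show z^n/(n:ℂ) - (-1)^n * z^n/n = (((1 - (-1)^n)/n : ℝ) : ℂ) * z^n by push_cast; ring, Complex.re_ofReal_mul]
    ring
  rw [hfun]; exact h3

lemma factor_le {z : ℂ} (hz : ‖z‖ < 1) :
    ‖(1 + z) / (1 - z)‖ ≤ (1 + ‖z‖)/(1 - ‖z‖) * Real.exp (-(2 * ∑ k ∈ ({1,3,5} : Finset ℕ), (‖z‖^k - (z^k).re)/k)) := by
  set r := ‖z‖
  have hr0 : 0 ≤ r := norm_nonneg z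
  have hrn : ‖(r:ℂ)‖ = r := by rw [Complex.norm_real, Real.norm_of_nonneg hr0]
  have h1 := hasSum_logratio hz
  have h2 := hasSum_logratio (z := (r:ℂ)) (by rw [hrn]; exact hz)
  have h3 := h2.sub h1
  have hnn : ∀ n : ℕ, 0 ≤ (1 - (-1:ℝ)^n) * ((r:ℂ)^n).re / n - (1 - (-1)^n) * (z^n).re / n := by
    intro n
    rw [← sub_div, ← mul_sub, ← Complex.ofReal_pow, Complex.ofReal_re]
    have : (z^n).re ≤ r^n := by
      refine (Complex.re_le_norm _).trans ?_
      rw [norm_pow]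
    have h5 : (0:ℝ) ≤ 1 - (-1)^n := by
      rcases neg_one_pow_eq_or ℝ n with h | h <;> rw [h] <;> norm_num
    have := sub_nonneg.2 this
    positivity
  have h4 := sum_le_hasSum ({1,3,5} : Finset ℕ) (fun n _ => hnn n) h3
  have e1 : ‖1 + (r:ℂ)‖ = 1 + r := by
    rw [← Complex.ofReal_one, ← Complex.ofReal_add, Complex.norm_real, Real.norm_of_nonneg (by positivity)]
  have e2 : ‖1 - (r:ℂ)‖ = 1 - r := by
    rw [← Complex.ofReal_one, ← Complex.ofReal_sub, Complex.norm_real, Real.norm_of_nonneg (by linarith)]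
  rw [e1, e2] at h4
  have e3 : ∑ n ∈ ({1,3,5} : Finset ℕ), ((1 - (-1:ℝ)^n) * ((r:ℂ)^n).re / n - (1 - (-1)^n) * (z^n).re / n) = 2 * ∑ k ∈ ({1,3,5} : Finset ℕ), (r^k - (z^k).re)/k := by
    simp only [← Complex.ofReal_pow, Complex.ofReal_re]
    rw [Finset.mul_sum]
    refine Finset.sum_congr rfl fun k hk => ?_
    have : (-1:ℝ)^k = -1 := by
      simp at hk; rcases hk with h | h | h <;> subst h <;> norm_num
    rw [this]; ring
  rw [e3] at h4
  have p1 : 0 < ‖1 + z‖ := by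
    have := norm_sub_norm_le (1:ℂ) (-z)
    rw [norm_one, norm_neg, sub_neg_eq_add] at this
    have : ‖z‖ < 1 := hz
    linarith
  have p2 : 0 < ‖1 - z‖ := by
    have := norm_sub_norm_le (1:ℂ) z
    rw [norm_one] at this
    have : ‖z‖ < 1 := hz
    linarith
  have p3 : 0 < 1 + r := by positivity
  have p4 : 0 < 1 - r := by linarith
  rw [norm_div, ← Real.exp_log (div_pos p1 p2), ← Real.exp_log (div_pos p3 p4), ← Real.exp_add, Real.exp_le_exp, Real.log_div p1.ne' p2.ne', Real.log_div p3.ne' p4.ne']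
  linarith

lemma V_le_ratio {q : ℂ} (hq : ‖q‖ < 1) :
    ‖V q q‖ ≤ ‖V (‖q‖:ℂ) (‖q‖:ℂ)‖ * Real.exp (-(2 * ∑ k ∈ ({1,3,5} : Finset ℕ), (‖q‖^k/(1-‖q‖^k) - (q^k/(1-q^k)).re)/k)) := by
  set r := ‖q‖
  have hr0 : 0 ≤ r := norm_nonneg q
  have hrn : ‖(r:ℂ)‖ = r := by rw [Complex.norm_real, Real.norm_of_nonneg hr0]
  have h1 := (V_tendsto hq).norm
  have h2 := (V_tendsto (q := (r:ℂ)) (by rw [hrn]; exact hq)).norm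
  have h3 : ∀ k ∈ ({1,3,5} : Finset ℕ), Filter.Tendsto (fun n => ∑ j ∈ range n, (r^(k*(j+1)) - (q^(k*(j+1))).re)/k) Filter.atTop (nhds ((r^k/(1-r^k) - (q^k/(1-q^k)).re)/k)) := by
    intro k hk
    have hk0 : k ≠ 0 := by rintro rfl; simp at hk
    have hqk : ‖q^k‖ < 1 := by rw [norm_pow]; exact pow_lt_one₀ hr0 hq hk0
    have a1 := (hasSum_geometric_of_lt_one (r := r^k) (by positivity) (pow_lt_one₀ hr0 hq hk0)).mul_left (r^k)
    have a2 := Complex.hasSum_re ((hasSum_geometric_of_norm_lt_one hqk).mul_left (q^k))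
    have a3 := ((a1.sub a2).div_const (k:ℝ)).tendsto_sum_nat
    rw [← div_eq_mul_inv, ← div_eq_mul_inv] at a3
    refine a3.congr fun n => ?_
    refine Finset.sum_congr rfl fun j _ => ?_
    rw [← pow_mul, ← pow_mul, ← pow_add, ← pow_add, mul_add, mul_one, add_comm (k * j)]
  have h4 := tendsto_finsetSum ({1,3,5} : Finset ℕ) h3
  have h5 := h2.mul ((Real.continuous_exp.tendsto _).comp (h4.const_mul 2).neg)
  refine le_of_tendsto_of_tendsto' h1 h5 fun n => ?_
  simp only [Function.comp]
  rw [norm_prod, norm_prod, Finset.sum_comm, Finset.mul_sum, ← Finset.sum_neg_distrib, Real.exp_sum, ← Finset.prod_mul_distrib]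
  refine Finset.prod_le_prod (fun _ _ => norm_nonneg _) fun j _ => ?_
  have := factor_le (pow_norm_lt hq j)
  refine this.trans (le_of_eq ?_)
  congr 1
  · rw [← Complex.ofReal_pow, ← Complex.ofReal_one, ← Complex.ofReal_add, ← Complex.ofReal_sub, ← Complex.ofReal_div, Complex.norm_real, norm_pow]
    have : r^(j+1) < 1 := pow_lt_one₀ hr0 hq (by simp)
    have h6 : 0 < 1 - r^(j+1) := by linarith
    rw [Real.norm_of_nonneg (by positivity)]
  · congr 3
    refine Finset.sum_congr rfl fun k _ => ?_
    rw [norm_pow, ← pow_mul, ← pow_mul, mul_comm k]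

lemma V_cone {τ : ℂ} (hτ : 0 < τ.re) (hρ : 1 ≤ (1/τ).re) :
    ‖V (Complex.exp (-τ)) (Complex.exp (-τ))‖ ≤ √(‖τ‖/Real.pi) * Real.exp (Real.pi^2/4 * (1/τ).re) := by
  have hp := Real.pi_pos
  have hp3 := Real.pi_gt_three
  have hτ0 : τ ≠ 0 := by intro h; simp [h] at hτ
  have hn : 0 < ‖τ‖ := norm_pos_iff.2 hτ0
  set ρ := (1/τ).re
  have hT := hasSum_Th hτ
  set κ : ℂ := 1 / (τ / Real.pi)^(1/2:ℂ)
  have hκ : ‖κ‖ = (√(‖τ‖/Real.pi))⁻¹ := by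
    rw [norm_div, norm_one, one_div]
    congr 1
    have := Complex.norm_cpow_of_ne_zero (z := τ/Real.pi) (div_ne_zero hτ0 (by exact_mod_cast hp.ne')) (1/2)
    rw [this]
    have e : (1/2:ℂ) = ((1/2:ℝ):ℂ) := by push_cast; rfl
    rw [e, Complex.ofReal_re, Complex.ofReal_im, mul_zero, Real.exp_zero, div_one, norm_div, Complex.norm_real, Real.norm_of_nonneg hp.le, Real.sqrt_eq_rpow]
  have hA0 : ‖Am τ 0‖ = Real.exp (-(Real.pi^2/4 * ρ)) := by
    rw [Am, Complex.norm_exp]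
    congr 1
    rw [show -(Real.pi:ℂ)^2 * (((0:ℕ):ℂ)+1/2)^2/τ = ((-(Real.pi^2/4) : ℝ) : ℂ) * (1/τ) by push_cast; ring, Complex.re_ofReal_mul]
    ring
  have hAm : ∀ m : ℕ, ‖Am τ (m+1)‖ ≤ Real.exp (-(Real.pi^2/4 * ρ)) * (1/3 * (1/3)^m) := by
    intro m
    have e : ‖Am τ (m+1)‖ = Real.exp (-(Real.pi^2/4 * ρ)) * Real.exp (-(Real.pi^2 * ((m+1)^2+(m+1)) * ρ)) := by
      rw [Am, Complex.norm_exp, ← Real.exp_add]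
      congr 1
      rw [show -(Real.pi:ℂ)^2 * (((m+1:ℕ):ℂ)+1/2)^2/τ = ((-(Real.pi^2 * ((m+1)^2+(m+1)) + Real.pi^2/4) : ℝ) : ℂ) * (1/τ) by push_cast; ring, Complex.re_ofReal_mul]
      ring
    rw [e]
    refine mul_le_mul_of_nonneg_left ?_ (Real.exp_pos _).le
    have h1 : Real.exp (-2) ≤ 1/3 := by
      rw [Real.exp_neg, one_div]
      apply inv_anti₀ (by norm_num)
      have := Real.add_one_le_exp (2:ℝ); linarith
    have h2 : (1/3:ℝ) * (1/3)^m = (1/3)^(m+1) := by ring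
    rw [h2]
    calc Real.exp (-(Real.pi^2 * ((m+1)^2+(m+1)) * ρ)) ≤ Real.exp ((m+1:ℕ) * (-2)) := by
          rw [Real.exp_le_exp]; push_cast
          have hm : (0:ℝ) ≤ m := by positivity
          have a1 : 2 * ((m:ℝ)+1) ≤ Real.pi^2 * ((m+1)^2+(m+1)) := by
            have a2 : 9 ≤ Real.pi^2 := by nlinarith
            have a3 := mul_le_mul_of_nonneg_right a2 (by positivity : 0 ≤ ((m:ℝ)+1)^2+(m+1))
            nlinarith
          nlinarith
      _ = (Real.exp (-2))^(m+1) := by rw [Real.exp_nat_mul]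
      _ ≤ _ := pow_le_pow_left₀ (Real.exp_pos _).le h1 _
  have hκ0 : κ ≠ 0 := by
    rw [← norm_ne_zero_iff, hκ]
    have : 0 < √(‖τ‖/Real.pi) := Real.sqrt_pos.2 (by positivity)
    positivity
  have hTT := (hasSum_nat_add_iff' 1).2 hT
  simp only [Finset.sum_range_one] at hTT
  have hg : HasSum (fun m : ℕ => 2 * ‖κ‖ * (Real.exp (-(Real.pi^2/4 * ρ)) * (1/3 * (1/3:ℝ)^m))) (2 * ‖κ‖ * (Real.exp (-(Real.pi^2/4 * ρ)) * (1/3 * (1 - 1/3)⁻¹))) :=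
    (((hasSum_geometric_of_lt_one (by norm_num) (by norm_num)).mul_left _).mul_left _).mul_left _
  have hb := tsum_of_norm_bounded hg (f := fun m => 2 * κ * Am τ (m+1)) (fun m => by
    rw [norm_mul, norm_mul, Complex.norm_ofNat]
    exact mul_le_mul_of_nonneg_left (hAm m) (by positivity))
  rw [hTT.tsum_eq] at hb
  have hlow : ‖κ‖ * Real.exp (-(Real.pi^2/4 * ρ)) ≤ ‖Th τ‖ := by
    have h1 := norm_sub_norm_le (2 * κ * Am τ 0) (2 * κ * Am τ 0 - Th τ)
    rw [sub_sub_cancel, norm_sub_rev, norm_mul, norm_mul, hA0, Complex.norm_ofNat] at h1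
    have e : (1/3 * (1 - 1/3)⁻¹ : ℝ) = 1/2 := by norm_num
    rw [e] at hb
    linarith
  have hV := congrArg norm (VTh hτ)
  rw [norm_mul, norm_one] at hV
  have hV0 : 0 ≤ ‖V (Complex.exp (-τ)) (Complex.exp (-τ))‖ := norm_nonneg _
  have h6 : ‖V (Complex.exp (-τ)) (Complex.exp (-τ))‖ * (‖κ‖ * Real.exp (-(Real.pi^2/4 * ρ))) ≤ 1 :=
    (mul_le_mul_of_nonneg_left hlow hV0).trans hV.le
  rw [hκ, Real.exp_neg, ← mul_inv, ← div_eq_mul_inv] at h6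
  have : 0 < √(‖τ‖/Real.pi) := Real.sqrt_pos.2 (by positivity)
  rwa [div_le_iff₀ (by positivity), one_mul] at h6

lemma V_real {t : ℝ} (h0 : 0 < t) (h1 : t ≤ 1) :
    ‖V ((Real.exp (-t) : ℝ) : ℂ) ((Real.exp (-t) : ℝ) : ℂ)‖ ≤ Real.exp (Real.pi^2/4 / t) := by
  have hp3 := Real.pi_gt_three
  have e : (1/(t:ℂ)).re = 1/t := by rw [← Complex.ofReal_one, ← Complex.ofReal_div, Complex.ofReal_re]
  have h := V_cone (τ := t) (by simpa using h0) (by rw [e]; rw [le_div_iff₀ h0]; linarith)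
  rw [e, Complex.norm_real, Real.norm_of_nonneg h0.le] at h
  push_cast
  refine h.trans ?_
  rw [mul_one_div]
  refine mul_le_of_le_one_left (Real.exp_pos _).le ?_
  rw [Real.sqrt_le_one, div_le_one (by positivity)]; linarith

lemma re_frac_le {q : ℂ} (hq : ‖q‖ < 1) {t Λ : ℝ} (ht : 0 < t) (hΛ : 0 < Λ) (k : ℕ) (h : Λ * t ≤ ‖1 - q^k‖) :
    (q^k/(1-q^k)).re ≤ 1/Λ/t := by
  refine (Complex.re_le_norm _).trans ?_
  rw [norm_div, norm_pow, div_div]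
  exact div_le_div₀ zero_le_one (pow_le_one₀ (norm_nonneg _) hq.le) (by positivity) h

lemma rk_ge {t : ℝ} (ht : 0 < t) {k : ℕ} (hk : 0 < k) : 1/k/t - 1 ≤ Real.exp (-t)^k/(1 - Real.exp (-t)^k) := by
  have hk' : (0:ℝ) < k := by exact_mod_cast hk
  rw [← Real.exp_nat_mul, mul_neg]
  set x := k * t
  have hx : 0 < x := by positivity
  have h1 : Real.exp (-x) < 1 := by simpa using hx
  have h2 := Real.add_one_le_exp (-x)
  rw [div_div]
  show 1/x - 1 ≤ _
  have h3 : 0 < 1 - Real.exp (-x) := by linarith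
  rw [show 1/x - 1 = (1-x)/x by field_simp, div_le_div_iff₀ hx h3]
  nlinarith

lemma re_frac_le' {q : ℂ} (hq : ‖q‖ < 1) {k : ℕ} (hk : k ≠ 0) : (q^k/(1-q^k)).re ≤ ‖q‖^k/(1-‖q‖^k) := by
  refine (Complex.re_le_norm _).trans ?_
  rw [norm_div, norm_pow]
  have h1 : ‖q‖^k < 1 := pow_lt_one₀ (norm_nonneg _) hq hk
  refine div_le_div_of_nonneg_left (by positivity) (by linarith) ?_
  have := norm_sub_norm_le (1:ℂ) (q^k)
  rwa [norm_one, norm_pow] at this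

lemma one_sub_q_le {q : ℂ} (hq : ‖q‖ < 1) : ‖1 - q‖ ≤ 4 * ‖1 - q^3‖ + ‖1 - q^5‖ := by
  have e : 1 - q = (1 - q^3) * (2 - (1 - q^3)) - q * (1 - q^5) := by ring
  have h3 : ‖q^3‖ ≤ 1 := by rw [norm_pow]; exact pow_le_one₀ (norm_nonneg _) hq.le
  have h2 : ‖(2:ℂ) - (1 - q^3)‖ ≤ 4 := by
    rw [show (2:ℂ) - (1 - q^3) = 1 + q^3 by ring]
    refine (norm_add_le _ _).trans ?_
    rw [norm_one]; linarith
  rw [e]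
  refine (norm_sub_le _ _).trans ?_
  rw [norm_mul, norm_mul]
  have a1 := mul_le_mul_of_nonneg_left h2 (norm_nonneg (1 - q^3))
  have a2 := mul_le_mul_of_nonneg_right hq.le (norm_nonneg (1 - q^5))
  linarith

lemma norm_q (τ : ℂ) : ‖Complex.exp (-τ)‖ = Real.exp (-τ.re) := by rw [Complex.norm_exp, Complex.neg_re]

lemma one_sub_ge {τ : ℂ} (hτ : 0 < τ.re) (h1 : τ.re ≤ 1) (hi : |τ.im| ≤ Real.pi) : |τ.im|/4 ≤ ‖1 - Complex.exp (-τ)‖ := by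
  have hp := Real.pi_pos
  have hp4 := Real.pi_le_four
  set r := Real.exp (-τ.re)
  have hr : 1/4 ≤ r := by
    have : Real.exp (-1) ≤ r := Real.exp_le_exp.2 (by linarith)
    have h2 : Real.exp 1 < 2.7182818286 := Real.exp_one_lt_d9
    have h3 : (1/4:ℝ) ≤ Real.exp (-1) := by
      rw [Real.exp_neg, one_div]
      exact inv_anti₀ (Real.exp_pos _) (by linarith)
    linarith
  have hc := Real.cos_le_one_sub_mul_cos_sq hi
  have e : ‖1 - Complex.exp (-τ)‖^2 = (1-r)^2 + 2 * r * (1 - Real.cos τ.im) := by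
    rw [← Complex.normSq_eq_norm_sq, Complex.normSq_apply, Complex.sub_re, Complex.sub_im, Complex.exp_re, Complex.exp_im]
    simp only [Complex.neg_re, Complex.neg_im, Real.cos_neg, Real.sin_neg, Complex.one_re, Complex.one_im]
    show (1 - r * _) * (1 - r * _) + (0 - r * _) * (0 - r * _) = _
    have := Real.sin_sq_add_cos_sq τ.im
    linear_combination r^2 * this
  refine abs_le_of_sq_le_sq' ?_ (norm_nonneg _) |>.2
  rw [e, div_pow, sq_abs]
  have h5 : 1/16 * τ.im^2 ≤ 2/Real.pi^2/2 * τ.im^2 := by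
    refine mul_le_mul_of_nonneg_right ?_ (sq_nonneg _)
    rw [div_div, div_le_div_iff₀ (by norm_num) (by positivity)]
    nlinarith
  have h7 : 0 ≤ 1 - Real.cos τ.im := by linarith [Real.cos_le_one τ.im]
  have h6 : 1/2 * (1 - Real.cos τ.im) ≤ 2 * r * (1 - Real.cos τ.im) := by
    refine mul_le_mul_of_nonneg_right (by linarith) h7
  nlinarith [sq_nonneg (1-r)]

lemma V_minor {τ : ℂ} (hτ : 0 < τ.re) (h1 : τ.re ≤ 1) (hi : |τ.im| ≤ Real.pi) (hM : 4000 * τ.re ≤ |τ.im|) :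
    ‖V (Complex.exp (-τ)) (Complex.exp (-τ))‖ ≤ Real.exp 4 * Real.exp ((Real.pi^2/4 - 2.06)/τ.re) := by
  set t := τ.re
  set q := Complex.exp (-τ) with hqdef
  have hq : ‖q‖ < 1 := exp_norm_lt hτ
  have hqr : ‖q‖ = Real.exp (-t) := norm_q τ
  have hV := V_le_ratio hq
  have hr := V_real hτ h1
  have h2 := one_sub_ge hτ h1 hi
  rw [hqr] at hV
  have h3 := one_sub_q_le hq
  have b1 := re_frac_le hq hτ (Λ := 200) (by norm_num) 1 (by rw [pow_one]; linarith)
  have g1 := rk_ge hτ (k := 1) (by norm_num)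
  have g3 := rk_ge hτ (k := 3) (by norm_num)
  have g5 := rk_ge hτ (k := 5) (by norm_num)
  have n3 := re_frac_le' hq (k := 3) (by norm_num)
  have n5 := re_frac_le' hq (k := 5) (by norm_num)
  rw [hqr] at n3 n5
  have ht1 : 1 ≤ 1/t := by rw [le_div_iff₀ hτ]; linarith
  have key : 2.06/t - 4 ≤ 2 * ∑ k ∈ ({1,3,5} : Finset ℕ), (Real.exp (-t)^k/(1-Real.exp (-t)^k) - (q^k/(1-q^k)).re)/k := by
    rw [Finset.sum_insert (by simp), Finset.sum_insert (by simp), Finset.sum_singleton]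
    generalize Real.exp (-t)^1/(1-Real.exp (-t)^1) = x1 at *
    generalize Real.exp (-t)^3/(1-Real.exp (-t)^3) = x3 at *
    generalize Real.exp (-t)^5/(1-Real.exp (-t)^5) = x5 at *
    push_cast at g1 g3 g5 ⊢
    rw [div_eq_mul_one_div _ t] at g1 g3 g5 b1 ⊢
    rcases le_or_gt (200 * t) ‖1 - q^3‖ with hh | hh
    · have b3 := re_frac_le hq hτ (Λ := 200) (by norm_num) 3 hh
      rw [div_eq_mul_one_div _ t] at b3
      generalize 1/t = s at *
      linarith
    · have b5 := re_frac_le hq hτ (Λ := 200) (by norm_num) 5 (by linarith)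
      rw [div_eq_mul_one_div _ t] at b5
      generalize 1/t = s at *
      linarith
  refine hV.trans ?_
  calc _ ≤ Real.exp (Real.pi^2/4/t) * Real.exp (-(2.06/t - 4)) := 
        mul_le_mul hr (Real.exp_le_exp.2 (by linarith)) (Real.exp_pos _).le (Real.exp_pos _).le
    _ = _ := by rw [← Real.exp_add, ← Real.exp_add]; congr 1; ring

lemma Rf_minor (φ : ℝ) {τ : ℂ} (hτ : 0 < τ.re) (h1 : τ.re ≤ 1) (hi : |τ.im| ≤ Real.pi) (hM : 4000 * τ.re ≤ |τ.im|) :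
    ‖Rf φ τ‖ ≤ 65 * Real.exp 4 * (1/τ.re^3 * Real.exp ((Real.pi^2/4 - 2.06)/τ.re)) := by
  have h := norm_TT_cos (exp_norm_lt hτ) φ
  rw [norm_q] at h
  set t := τ.re
  have e1 : t/2 ≤ 1 - Real.exp (-t) := by
    have := Real.exp_bound_div_one_sub_of_interval' (x := t/2)
    have h2 := Real.add_one_le_exp t
    rw [Real.exp_neg, ← sub_nonneg]
    have : (Real.exp t)⁻¹ ≤ (t+1)⁻¹ := inv_anti₀ (by linarith) h2
    have h3 : (t+1)⁻¹ ≤ 1 - t/2 := by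
      rw [inv_le_iff_one_le_mul₀ (by linarith)]; nlinarith
    linarith
  have e2 : 1 + 8/(1 - Real.exp (-t))^3 ≤ 65 * (1/t^3) := by
    have : 8/(1 - Real.exp (-t))^3 ≤ 8/(t/2)^3 := by
      refine div_le_div_of_nonneg_left (by norm_num) (by positivity) (pow_le_pow_left₀ (by positivity) e1 3)
    have h4 : 8/(t/2)^3 = 64 * (1/t^3) := by field_simp; norm_num
    have h5 : 1 ≤ 1/t^3 := by rw [le_div_iff₀ (by positivity), one_mul]; exact pow_le_one₀ hτ.le h1
    linarith
  have e3 : 0 < 1 - Real.exp (-t) := lt_of_lt_of_le (by positivity) e1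
  have := mul_le_mul (V_minor hτ h1 hi hM) e2 (by positivity) (by positivity)
  refine (h.trans this).trans (le_of_eq ?_)
  ring

end

end OPR

namespace OPR

section

open Finset MeasureTheory

lemma sinh_conv {l v : ℝ} (h0 : 0 ≤ l) (h1 : l ≤ 1) (hv : 0 ≤ v) : Real.sinh (l * v) ≤ l * Real.sinh v := by
  have hc : ConvexOn ℝ (Set.Ici 0) Real.sinh := by
    refine convexOn_of_deriv2_nonneg (convex_Ici 0) Real.continuous_sinh.continuousOn Real.differentiable_sinh.differentiableOn ?_ ?_
    · rw [Real.deriv_sinh]; exact Real.differentiable_cosh.differentiableOn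
    · intro x hx
      rw [interior_Ici] at hx
      simp only [Function.iterate_succ, Function.iterate_zero, Function.comp, id, Real.deriv_sinh, Real.deriv_cosh]
      exact (Real.sinh_pos_iff.2 hx).le
  have := hc.2 (Set.mem_Ici.2 le_rfl : (0:ℝ) ∈ Set.Ici 0) (Set.mem_Ici.2 hv) (sub_nonneg.2 h1) h0 (by ring)
  simpa using this

lemma E0_le {α u β : ℝ} (h0 : 0 < α) (h1 : α < Real.pi) (hu : 0 < u) (hβ : 0 ≤ β) (hab : α ≤ Real.pi/2 + β) :
    E0 α u ≤ α * Real.exp (β * u) := by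
  have hp := Real.pi_pos
  have hp3 := Real.pi_gt_three
  have hs : 0 < Real.sinh (Real.pi * u / 2) := Real.sinh_pos_iff.2 (by positivity)
  have he : 1 ≤ Real.exp (β * u) := Real.one_le_exp (by positivity)
  unfold E0
  rw [div_le_iff₀ (by positivity)]
  rcases le_or_gt α (Real.pi/2) with h | h
  · have := sinh_conv (l := α / (Real.pi/2)) (v := Real.pi * u/2) (by positivity) (by rw [div_le_one (by positivity)]; exact h) (by positivity)
    rw [show α / (Real.pi/2) * (Real.pi * u/2) = α * u by field_simp] at this
    refine this.trans ?_
    have h3 : α / (Real.pi/2) ≤ α := div_le_self h0.le (by linarith)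
    have h4 : α ≤ α * Real.exp (β * u) := le_mul_of_one_le_right h0.le he
    nlinarith
  · set x := (α - Real.pi/2) * u
    set y := Real.pi * u / 2
    have hx : 0 < x := mul_pos (by linarith) hu
    have hxy : x ≤ y := by
      show (α - Real.pi/2) * u ≤ Real.pi * u / 2
      nlinarith
    have e : α * u = x + y := by show _ = (α - Real.pi/2) * u + Real.pi * u / 2; ring
    have h5 : Real.sinh (x + y) = Real.exp x * Real.sinh y + Real.exp (-y) * Real.sinh x := by
      rw [Real.sinh_eq, Real.sinh_eq, Real.sinh_eq]
      have a1 : Real.exp (x + y) = Real.exp x * Real.exp y := Real.exp_add _ _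
      have a2 : Real.exp (-(x + y)) = Real.exp (-y) * Real.exp (-x) := by rw [← Real.exp_add]; congr 1; ring
      rw [a1, a2]; ring
    have h6 : Real.exp (-y) * Real.sinh x ≤ Real.sinh y := by
      have : Real.exp (-y) ≤ 1 := by rw [Real.exp_le_one_iff]; linarith
      have h7 := Real.sinh_le_sinh.2 hxy
      have h8 := Real.sinh_pos_iff.2 hx
      nlinarith
    have h9 : 1 ≤ Real.exp x := Real.one_le_exp hx.le
    have h10 : Real.exp x ≤ Real.exp (β * u) := by
      rw [Real.exp_le_exp]; show (α - Real.pi/2) * u ≤ β * u; nlinarith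
    rw [e, h5]
    have h11 : 1 ≤ α := by linarith
    have h12 : Real.exp x * Real.sinh y + Real.sinh y ≤ 2 * (Real.exp x * Real.sinh y) := by nlinarith
    have h13 : Real.exp x * Real.sinh y ≤ Real.exp (β * u) * Real.sinh y := mul_le_mul_of_nonneg_right h10 hs.le
    have h14 : Real.exp (β * u) * Real.sinh y ≤ α * (Real.exp (β * u) * Real.sinh y) := le_mul_of_one_le_left (by positivity) h11
    linarith

lemma E0_nonneg {α u : ℝ} (h0 : 0 < α) (hu : 0 < u) : 0 ≤ E0 α u := by
  have hp := Real.pi_pos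
  have hs : 0 < Real.sinh (Real.pi * u / 2) := Real.sinh_pos_iff.2 (by positivity)
  have := Real.sinh_pos_iff.2 (mul_pos h0 hu)
  unfold E0; positivity

lemma Hi_le {α β : ℝ} (h0 : 0 < α) (h1 : α < Real.pi) (hβ : 0 ≤ β) (hab : α ≤ Real.pi/2 + β) {τ : ℂ} (hτ : 0 < τ.re) :
    ‖Hi α τ‖ ≤ α * (2 * √(Real.pi/τ.re) * Real.exp (β^2/τ.re)) := by
  set t := τ.re
  obtain ⟨i1, e1⟩ := gauss_int (τ := t) (by simpa using hτ) (β:ℂ)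
  have hfun : ∀ u : ℝ, Complex.exp ((β:ℂ) * u) * Complex.exp (-(t:ℂ) * u^2/4) = ((Real.exp (β * u) * Real.exp (-t * u^2/4) : ℝ) : ℂ) := by
    intro u; push_cast; rfl
  simp only [hfun] at i1 e1
  rw [sg_conv hτ, integral_complex_ofReal] at e1
  have e2 : ∫ u : ℝ, Real.exp (β * u) * Real.exp (-t * u^2/4) = 2 * √(Real.pi/t) * Real.exp (β^2/t) := by
    exact_mod_cast e1
  have i2 : Integrable (fun u : ℝ => Real.exp (β * u) * Real.exp (-t * u^2/4)) := by
    refine i1.norm.congr (Filter.Eventually.of_forall fun u => ?_)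
    show ‖((Real.exp (β * u) * Real.exp (-t * u^2/4) : ℝ) : ℂ)‖ = _
    rw [Complex.norm_real, Real.norm_of_nonneg (by positivity)]
  rw [Hi, ← e2]
  calc _ ≤ ∫ u in Set.Ioi (0:ℝ), α * (Real.exp (β * u) * Real.exp (-t * u^2/4)) := by
        refine norm_integral_le_of_norm_le (i2.const_mul α).integrableOn ?_
        filter_upwards [ae_restrict_mem measurableSet_Ioi] with u hu
        rw [norm_mul, norm_gauss, Complex.norm_real, Real.norm_of_nonneg (E0_nonneg h0 hu), ← mul_assoc]
        exact mul_le_mul_of_nonneg_right (E0_le h0 h1 hu hβ hab) (Real.exp_pos _).le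
    _ = α * ∫ u in Set.Ioi (0:ℝ), (Real.exp (β * u) * Real.exp (-t * u^2/4)) := integral_const_mul _ _
    _ ≤ _ := by
        refine mul_le_mul_of_nonneg_left ?_ h0.le
        exact setIntegral_le_integral i2 (Filter.Eventually.of_forall fun u => by positivity)

lemma cot_le {α : ℝ} (h0 : 0 < α) (h1 : α < Real.pi) : (1 + Real.cos α)/Real.sin α ≤ 2/α ∧ 0 < (1 + Real.cos α)/Real.sin α := by
  have hs : 0 < Real.sin (α/2) := Real.sin_pos_of_pos_of_lt_pi (by linarith) (by linarith)
  have hc : 0 < Real.cos (α/2) := Real.cos_pos_of_mem_Ioo ⟨by linarith, by linarith⟩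
  have e : (1 + Real.cos α)/Real.sin α = Real.cos (α/2) / Real.sin (α/2) := by
    have a1 : Real.cos α = 2 * Real.cos (α/2)^2 - 1 := by rw [← Real.cos_two_mul]; congr 1; ring
    have a2 : Real.sin α = 2 * Real.sin (α/2) * Real.cos (α/2) := by rw [← Real.sin_two_mul]; congr 1; ring
    rw [a1, a2]; field_simp; ring
  rw [e]
  refine ⟨?_, by positivity⟩
  have := Real.lt_tan (x := α/2) (by linarith) (by linarith)
  rw [Real.tan_eq_sin_div_cos, lt_div_iff₀ hc] at this
  rw [div_le_div_iff₀ hs h0]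
  linarith

lemma GG_le {α φ : ℝ} (h0 : 0 < α) (h1 : α < Real.pi) (hφ : 0 < φ) (hα : φ ≤ Real.pi - α) {τ : ℂ} (hτ : 0 < τ.re) (hρ : 1 ≤ (1/τ).re) :
    ‖GG α τ‖ ≤ 4 * Real.pi * α * ‖τ‖⁻¹ * Real.exp (-((1/τ).re * (φ * (3 * Real.pi - φ)))) *
      ∑' m : ℕ, (((m:ℝ)+1)^2 * Real.exp (-(2 * Real.pi * φ * m))) := by
  have hp := Real.pi_pos
  have hs := summ_sq (κ := 2 * Real.pi * φ) (by positivity)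
  refine tsum_of_norm_bounded (hs.hasSum.mul_left _) fun m => ?_
  refine (AP_le h0 h1 hτ m).trans ?_
  set ρ := (1/τ).re
  have hρ0 : 0 < ρ := by linarith
  have b1 : Real.exp (-(ρ * ((Real.pi - α) * (2 * Real.pi + α)))) ≤ Real.exp (-(ρ * (φ * (3 * Real.pi - φ)))) := by
    rw [Real.exp_le_exp, neg_le_neg_iff]
    refine mul_le_mul_of_nonneg_left ?_ hρ0.le
    nlinarith
  have b2 : Real.exp (-(2 * Real.pi * (Real.pi - α) * ρ * m)) ≤ Real.exp (-(2 * Real.pi * φ * m)) := by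
    rw [Real.exp_le_exp, neg_le_neg_iff]
    have b3 : φ ≤ (Real.pi - α) * ρ := by nlinarith
    have b4 := mul_le_mul_of_nonneg_left b3 (by positivity : (0:ℝ) ≤ 2 * Real.pi)
    rw [← mul_assoc] at b4
    exact mul_le_mul_of_nonneg_right b4 (Nat.cast_nonneg m)
  refine mul_le_mul (mul_le_mul_of_nonneg_left b1 (by positivity)) (mul_le_mul_of_nonneg_left b2 (by positivity)) (by positivity) (by positivity)

lemma rho_eq (τ : ℂ) : (1/τ).re = τ.re / ‖τ‖^2 := by
  rw [one_div, Complex.inv_re, Complex.normSq_eq_norm_sq]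

lemma norm_facts {τ : ℂ} (hτ : 0 < τ.re) (hρ : 1 ≤ (1/τ).re) : τ.re ≤ ‖τ‖ ∧ ‖τ‖ ≤ 1 ∧ τ.re ≤ 1 ∧ (1/τ).re ≤ 1/τ.re := by
  have h1 : τ.re ≤ ‖τ‖ := Complex.re_le_norm τ
  have hn : 0 < ‖τ‖ := lt_of_lt_of_le hτ h1
  rw [rho_eq] at *
  rw [le_div_iff₀ (by positivity), one_mul] at hρ
  have h2 : ‖τ‖ ≤ 1 := by nlinarith
  refine ⟨h1, h2, h1.trans h2, ?_⟩
  rw [div_le_div_iff₀ (by positivity) hτ, one_mul]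
  nlinarith

lemma VG_le {α φ A : ℝ} (h0 : 0 < α) (h1 : α < Real.pi) (hφ : 0 < φ) (hα : φ ≤ Real.pi - α) (hA : 0 ≤ A)
    (hE : Real.pi^2/4 - φ * (3 * Real.pi - φ) ≤ A) {τ : ℂ} (hτ : 0 < τ.re) (hρ : 1 ≤ (1/τ).re) :
    ‖V (Complex.exp (-τ)) (Complex.exp (-τ)) * (4 * Real.pi / τ) * GG α τ‖ ≤ α * ((4 * Real.pi)^2 * ∑' m : ℕ, (((m:ℝ)+1)^2 * Real.exp (-(2 * Real.pi * φ * m)))) *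
      (1/τ.re^3 * Real.exp (A/τ.re)) := by
  have hp := Real.pi_pos
  have hp3 := Real.pi_gt_three
  obtain ⟨f1, f2, f3, f4⟩ := norm_facts hτ hρ
  have hn : 0 < ‖τ‖ := lt_of_lt_of_le hτ f1
  have hG := GG_le h0 h1 hφ hα hτ hρ
  have hV := V_cone hτ hρ
  set S := ∑' m : ℕ, (((m:ℝ)+1)^2 * Real.exp (-(2 * Real.pi * φ * m)))
  have hS : 0 ≤ S := tsum_nonneg fun m => by positivity
  set ρ := (1/τ).re
  have e1 : ‖(4 * Real.pi / τ : ℂ)‖ = 4 * Real.pi * ‖τ‖⁻¹ := by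
    rw [norm_div, norm_mul, Complex.norm_ofNat, Complex.norm_real, Real.norm_of_nonneg hp.le, div_eq_mul_inv]
  have hsq : √(‖τ‖/Real.pi) ≤ 1 := by
    rw [Real.sqrt_le_one, div_le_one hp]; linarith
  have hV2 : ‖V (Complex.exp (-τ)) (Complex.exp (-τ))‖ ≤ Real.exp (Real.pi^2/4 * ρ) :=
    hV.trans (mul_le_of_le_one_left (Real.exp_pos _).le hsq)
  rw [norm_mul, norm_mul, e1]
  have h3 : ‖τ‖⁻¹ * ‖τ‖⁻¹ ≤ 1/τ.re^3 := by
    rw [← mul_inv, one_div]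
    refine inv_anti₀ (by positivity) ?_
    have : τ.re^2 ≤ ‖τ‖ * ‖τ‖ := by nlinarith
    nlinarith [sq_nonneg τ.re]
  have h4 : Real.exp (Real.pi^2/4 * ρ) * Real.exp (-(ρ * (φ * (3 * Real.pi - φ)))) ≤ Real.exp (A/τ.re) := by
    rw [← Real.exp_add, Real.exp_le_exp]
    calc _ = (Real.pi^2/4 - φ * (3 * Real.pi - φ)) * ρ := by ring
      _ ≤ A * ρ := mul_le_mul_of_nonneg_right hE (by linarith)
      _ ≤ A * (1/τ.re) := mul_le_mul_of_nonneg_left f4 hA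
      _ = _ := by ring
  calc _ ≤ Real.exp (Real.pi^2/4 * ρ) * (4 * Real.pi * ‖τ‖⁻¹) * (4 * Real.pi * α * ‖τ‖⁻¹ * Real.exp (-(ρ * (φ * (3 * Real.pi - φ)))) * S) :=
        mul_le_mul (mul_le_mul_of_nonneg_right hV2 (by positivity)) hG (norm_nonneg _) (by positivity)
    _ = α * ((4 * Real.pi)^2 * S) * ((‖τ‖⁻¹ * ‖τ‖⁻¹) * (Real.exp (Real.pi^2/4 * ρ) * Real.exp (-(ρ * (φ * (3 * Real.pi - φ)))))) := by ring
    _ ≤ _ := mul_le_mul_of_nonneg_left (mul_le_mul h3 h4 (by positivity) (by positivity)) (by positivity)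

lemma sqrt_t_le {t : ℝ} (h0 : 0 < t) (h1 : t ≤ 1) : √(Real.pi/t) ≤ 4 * (1/t^3) := by
  have hp := Real.pi_pos
  have h4 := Real.pi_le_four
  have h2 : √(Real.pi/t) ≤ 4/t := by
    rw [Real.sqrt_le_left (by positivity), div_pow, div_le_div_iff₀ h0 (by positivity)]
    nlinarith
  refine h2.trans ?_
  rw [mul_one_div]
  refine div_le_div_of_nonneg_left (by norm_num) (by positivity) ?_
  nlinarith [sq_nonneg t]

lemma Rf_small {φ : ℝ} (hφ : 0 < φ) {A b : ℝ} (hA : 0 ≤ A) (hb0 : 0 ≤ b) (hb : b^2 ≤ A)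
    (hE : Real.pi^2/4 - φ * (3 * Real.pi - φ) ≤ A) : ∃ C, 0 < C ∧ ∀ α : ℝ, 0 < α → α < Real.pi → φ ≤ Real.pi - α → α ≤ Real.pi/2 + b →
    ∀ τ : ℂ, 0 < τ.re → 1 ≤ (1/τ).re → ‖Rf (Real.pi - α) τ‖ ≤ C * (1/τ.re^3 * Real.exp (A/τ.re)) := by
  have hp := Real.pi_pos
  set S := (4 * Real.pi)^2 * ∑' m : ℕ, (((m:ℝ)+1)^2 * Real.exp (-(2 * Real.pi * φ * m)))
  have hS : 0 ≤ S := mul_nonneg (by positivity) (tsum_nonneg fun m => by positivity)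
  refine ⟨2 * (16 + S), by positivity, fun α h0 h1 hα hab τ hτ hρ => ?_⟩
  obtain ⟨f1, f2, f3, f4⟩ := norm_facts hτ hρ
  have hVG := VG_le h0 h1 hφ hα hA hE hτ hρ
  have hH := Hi_le h0 h1 hb0 hab hτ
  obtain ⟨c1, c2⟩ := cot_le h0 h1
  rw [Rf_formula h0 h1 hτ, norm_mul, Complex.norm_real, Real.norm_of_nonneg c2.le]
  set X := 1/τ.re^3 * Real.exp (A/τ.re)
  have hX : 0 < X := by positivity
  have h2 : 2 * √(Real.pi/τ.re) * Real.exp (b^2/τ.re) ≤ 8 * X := by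
    have a1 := sqrt_t_le hτ f3
    have a2 : Real.exp (b^2/τ.re) ≤ Real.exp (A/τ.re) := Real.exp_le_exp.2 (div_le_div_of_nonneg_right hb hτ.le)
    have := mul_le_mul a1 a2 (Real.exp_pos _).le (by positivity)
    show _ ≤ 8 * (1/τ.re^3 * Real.exp (A/τ.re))
    linarith
  have h3 : ‖2 * Hi α τ + V (Complex.exp (-τ)) (Complex.exp (-τ)) * (4 * Real.pi / τ) * GG α τ‖ ≤ α * ((16 + S) * X) := by
    refine (norm_add_le _ _).trans ?_
    rw [norm_mul (2:ℂ), Complex.norm_ofNat]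
    have := mul_le_mul_of_nonneg_left h2 h0.le
    have h5 : α * S * X = α * (S * X) := by ring
    have : 2 * ‖Hi α τ‖ ≤ α * (16 * X) := by linarith
    calc _ ≤ α * (16 * X) + α * S * X := add_le_add this hVG
      _ = _ := by ring
  calc _ ≤ 2/α * (α * ((16 + S) * X)) := mul_le_mul c1 h3 (norm_nonneg _) (by positivity)
    _ = _ := by field_simp

lemma Rf_cont {τ : ℂ} (hτ : 0 < τ.re) : Continuous (fun φ => Rf φ τ) := by
  unfold Rf TT
  refine continuous_tsum (u := fun s => ‖W0 (Complex.exp (-τ)) s‖) (fun s => ?_) (summable_W0 (exp_norm_lt hτ)) (fun s φ => ?_)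
  · unfold wcos; fun_prop
  · rw [norm_mul]
    exact mul_le_of_le_one_left (norm_nonneg _) (wcos_le _ _ _)

lemma Rf_small' {φ : ℝ} (hφ : 0 < φ) {A b : ℝ} (hA : 0 ≤ A) (hb0 : 0 ≤ b) (hb : b^2 ≤ A)
    (hE : Real.pi^2/4 - φ * (3 * Real.pi - φ) ≤ A) : ∃ C, 0 < C ∧ ∀ ψ : ℝ, φ ≤ ψ → ψ ≤ Real.pi → φ < Real.pi → Real.pi/2 - b ≤ ψ →
    ∀ τ : ℂ, 0 < τ.re → 1 ≤ (1/τ).re → ‖Rf ψ τ‖ ≤ C * (1/τ.re^3 * Real.exp (A/τ.re)) := by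
  have hp := Real.pi_pos
  obtain ⟨C, hC, h⟩ := Rf_small hφ hA hb0 hb hE
  refine ⟨C, hC, fun ψ h1 h2 h3 h4 τ hτ hρ => ?_⟩
  rcases h2.lt_or_eq with h5 | h5
  · have := h (Real.pi - ψ) (by linarith) (by linarith) (by linarith) (by linarith) τ hτ hρ
    rwa [sub_sub_cancel] at this
  · subst h5
    have hc := (Rf_cont hτ).norm.continuousAt (x := Real.pi)
    have hc2 : Filter.Tendsto (fun ψ => ‖Rf ψ τ‖) (nhdsWithin Real.pi (Set.Iio Real.pi)) (nhds ‖Rf Real.pi τ‖) := hc.tendsto.mono_left nhdsWithin_le_nhds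
    refine le_of_tendsto hc2 ?_
    have n1 : Set.Ioo (max φ (Real.pi/2)) Real.pi ∈ nhdsWithin Real.pi (Set.Iio Real.pi) := Ioo_mem_nhdsLT (by rw [max_lt_iff]; constructor <;> linarith)
    filter_upwards [n1] with ψ hψ
    have a1 := le_max_left φ (Real.pi/2)
    have a2 := le_max_right φ (Real.pi/2)
    have := h (Real.pi - ψ) (by linarith [hψ.2]) (by linarith [hψ.1]) (by linarith [hψ.1]) (by linarith [hψ.1]) τ hτ hρ
    rwa [sub_sub_cancel] at this

lemma Rf_refl (φ : ℝ) (τ : ℂ) : Rf (2 * Real.pi - φ) τ = Rf φ τ := by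
  unfold Rf
  congr 1
  funext m k
  unfold wcos
  congr 1
  rw [show (2 * Real.pi - φ) * ((m:ℝ) - k) = ((m:ℤ) - (k:ℤ) : ℤ) * (2 * Real.pi) - φ * ((m:ℝ) - k) by push_cast; ring, Real.cos_int_mul_two_pi_sub]

lemma Hi_main {φ : ℝ} (h0 : 0 < φ) (h1 : φ < Real.pi) {τ : ℂ} (hτ : 0 < τ.re) :
    Hi (Real.pi - φ) τ = sg τ * Complex.exp (((Real.pi/2 - φ : ℝ):ℂ)^2/τ) - Hi φ τ := by
  have hp := Real.pi_pos
  obtain ⟨i1, e1⟩ := gauss_cosh hτ ((Real.pi/2 - φ : ℝ):ℂ)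
  rw [← e1, Hi, Hi, ← integral_sub i1 (Hi_int h0 h1 hτ)]
  apply setIntegral_congr_fun measurableSet_Ioi
  intro u hu
  simp only
  rw [← sub_mul, ← Complex.ofReal_mul, ← Complex.ofReal_cosh, ← Complex.ofReal_sub]
  congr 2
  have hs : 0 < Real.sinh (Real.pi * u / 2) := Real.sinh_pos_iff.2 (by have : 0 < u := hu
                                                                       positivity)
  unfold E0
  rw [show (Real.pi - φ) * u = Real.pi * u / 2 + (Real.pi/2 - φ) * u by ring, show φ * u = Real.pi * u / 2 - (Real.pi/2 - φ) * u by ring, Real.sinh_add, Real.sinh_sub]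
  generalize Real.sinh (Real.pi * u / 2) = s at hs ⊢
  generalize Real.sinh ((Real.pi/2 - φ) * u) = s'
  field_simp; ring

lemma Rf_main {φ : ℝ} (h0 : 0 < φ) (h1 : φ ≤ Real.pi/2) {A : ℝ} (hA : 0 ≤ A)
    (hE : Real.pi^2/4 - φ * (3 * Real.pi - φ) ≤ A) : ∃ C K, 0 < C ∧ 0 < K ∧
    ∀ τ : ℂ, 0 < τ.re → 1 ≤ (1/τ).re → ‖Rf φ τ - (K:ℝ) * (sg τ * Complex.exp (((Real.pi/2 - φ : ℝ):ℂ)^2/τ))‖ ≤ C * (1/τ.re^3 * Real.exp (A/τ.re)) := by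
  have hp := Real.pi_pos
  set α := Real.pi - φ with hαd
  have ha0 : 0 < α := by rw [hαd]; linarith
  have ha1 : α < Real.pi := by rw [hαd]; linarith
  set S := (4 * Real.pi)^2 * ∑' m : ℕ, (((m:ℝ)+1)^2 * Real.exp (-(2 * Real.pi * φ * m)))
  have hS : 0 ≤ S := mul_nonneg (by positivity) (tsum_nonneg fun m => by positivity)
  obtain ⟨c1, c2⟩ := cot_le ha0 ha1
  set k := (1 + Real.cos α)/Real.sin α
  refine ⟨k * (φ * 16 + α * S), k * 2, by positivity, by positivity, fun τ hτ hρ => ?_⟩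
  obtain ⟨f1, f2, f3, f4⟩ := norm_facts hτ hρ
  have hVG := VG_le ha0 ha1 h0 (by rw [hαd]; linarith) hA hE hτ hρ
  have hH := Hi_le h0 (by linarith) le_rfl (by linarith : φ ≤ Real.pi/2 + 0) hτ
  have hm := Hi_main h0 (by linarith) hτ
  have e := Rf_formula ha0 ha1 hτ
  rw [hm, show Real.pi - α = φ by rw [hαd]; ring] at e
  rw [e]
  set X := 1/τ.re^3 * Real.exp (A/τ.re) with hXd
  set VG := V (Complex.exp (-τ)) (Complex.exp (-τ)) * (4 * Real.pi / τ) * GG α τ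
  have e2 : (k:ℂ) * (2 * (sg τ * Complex.exp (((Real.pi/2 - φ : ℝ):ℂ)^2/τ) - Hi φ τ) + VG) - ((k * 2 : ℝ):ℂ) * (sg τ * Complex.exp (((Real.pi/2 - φ : ℝ):ℂ)^2/τ)) = (k:ℂ) * (VG - 2 * Hi φ τ) := by
    push_cast; ring
  rw [e2, norm_mul, Complex.norm_real, Real.norm_of_nonneg c2.le, mul_assoc k]
  refine mul_le_mul_of_nonneg_left ?_ c2.le
  refine (norm_sub_le _ _).trans ?_
  rw [norm_mul (2:ℂ), Complex.norm_ofNat]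
  have h2 : 2 * √(Real.pi/τ.re) * Real.exp (0^2/τ.re) ≤ 8 * X := by
    have a1 := sqrt_t_le hτ f3
    have a2 : Real.exp (0^2/τ.re) ≤ Real.exp (A/τ.re) := Real.exp_le_exp.2 (div_le_div_of_nonneg_right (by simpa using hA) hτ.le)
    have := mul_le_mul a1 a2 (Real.exp_pos _).le (by positivity)
    rw [hXd]
    linarith
  have := mul_le_mul_of_nonneg_left h2 h0.le
  linarith

lemma rho_ge {τ : ℂ} (hτ : 0 < τ.re) {M : ℝ} (hM : |τ.im| ≤ M * τ.re) (ht : τ.re ≤ 1/(1+M^2)) : 1 ≤ (1/τ).re := by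
  have hn : 0 < ‖τ‖ := lt_of_lt_of_le hτ (Complex.re_le_norm τ)
  rw [rho_eq, le_div_iff₀ (by positivity), one_mul, ← Complex.normSq_eq_norm_sq, Complex.normSq_apply]
  rw [le_div_iff₀ (by positivity)] at ht
  have : τ.im^2 ≤ (M * τ.re)^2 := by rw [← sq_abs]; exact pow_le_pow_left₀ (abs_nonneg _) hM 2
  nlinarith

theorem est {c : ℕ} (hc : 7 ≤ c) : ∃ C K δ t0 : ℝ, 0 < C ∧ 0 < K ∧ 0 < δ ∧ 0 < t0 ∧ t0 ≤ 1 ∧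
    (∀ τ : ℂ, 0 < τ.re → τ.re ≤ t0 → |τ.im| ≤ 4000 * τ.re →
      ‖Rf (2 * Real.pi / c) τ - (K:ℝ) * (sg τ * Complex.exp (((Real.pi/2 - 2 * Real.pi / c : ℝ):ℂ)^2/τ))‖ ≤ C * (1/τ.re^3 * Real.exp (((Real.pi/2 - 2 * Real.pi / c)^2 - δ)/τ.re))) ∧
    (∀ j : ℕ, 2 ≤ j → j + 2 ≤ c → ∀ τ : ℂ, 0 < τ.re → τ.re ≤ t0 → |τ.im| ≤ 4000 * τ.re →
      ‖Rf (2 * Real.pi * j / c) τ‖ ≤ C * (1/τ.re^3 * Real.exp (((Real.pi/2 - 2 * Real.pi / c)^2 - δ)/τ.re))) ∧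
    (∀ φ : ℝ, ∀ τ : ℂ, 0 < τ.re → τ.re ≤ t0 → 4000 * τ.re ≤ |τ.im| → |τ.im| ≤ Real.pi →
      ‖Rf φ τ‖ ≤ C * (1/τ.re^3 * Real.exp (((Real.pi/2 - 2 * Real.pi / c)^2 - δ)/τ.re))) := by
  have hp := Real.pi_pos
  have hp3 := Real.pi_gt_d4
  have hp4 := Real.pi_lt_d4
  have hc7 : (7:ℝ) ≤ c := by exact_mod_cast hc
  have hc0 : (0:ℝ) < c := by linarith
  set φ := 2 * Real.pi / c with hφd
  have hφ0 : 0 < φ := by positivity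
  have hφ1 : φ ≤ 2 * Real.pi / 7 := div_le_div_of_nonneg_left (by positivity) (by norm_num) hc7
  set B := Real.pi/2 - φ with hBd
  have hB : 3 * Real.pi / 14 ≤ B := by rw [hBd]; linarith
  have hB2 : 0.45 ≤ B^2 := by
    have : (0.673:ℝ) ≤ B := by linarith
    have := pow_le_pow_left₀ (by norm_num) this 2
    norm_num at this ⊢
    linarith
  set δ := min (φ^2) 0.04 with hδd
  have hδ0 : 0 < δ := lt_min (by positivity) (by norm_num)
  have hδ1 : δ ≤ φ^2 := min_le_left _ _
  have hδ2 : δ ≤ 0.04 := min_le_right _ _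
  set A := B^2 - δ with hAd
  have hA : 0 ≤ A := by rw [hAd]; linarith
  have hE : Real.pi^2/4 - φ * (3 * Real.pi - φ) ≤ A := by
    have : φ^2 ≤ 2 * Real.pi * φ := by nlinarith
    rw [hAd, hBd]; nlinarith
  have hb : (max (Real.pi/2 - 2 * φ) 0)^2 ≤ A := by
    rcases le_total (Real.pi/2 - 2 * φ) 0 with h | h
    · rw [max_eq_right h]; simpa using hA
    · rw [max_eq_left h, hAd, hBd]; nlinarith
  have hMi : Real.pi^2/4 - 2.06 ≤ A := by
    rw [hAd]
    have : Real.pi^2 ≤ 3.1416^2 := pow_le_pow_left₀ hp.le hp4.le 2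
    norm_num at this
    linarith
  obtain ⟨C1, K, hC1, hK, h1⟩ := Rf_main hφ0 (by linarith) hA hE
  obtain ⟨C2, hC2, h2⟩ := Rf_small' hφ0 hA (le_max_right _ _) hb hE
  refine ⟨C1 + C2 + 65 * Real.exp 4, K, δ, 1/(1+4000^2), by positivity, hK, hδ0, by norm_num, by norm_num, ?_, ?_, ?_⟩
  · intro τ hτ ht hi
    refine (h1 τ hτ (rho_ge hτ hi ht)).trans (mul_le_mul_of_nonneg_right ?_ (by positivity))
    have := Real.exp_pos 4
    linarith
  · intro j hj hj2 τ hτ ht hi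
    have hj' : (2:ℝ) ≤ j := by exact_mod_cast hj
    have hj2' : (j:ℝ) + 2 ≤ c := by exact_mod_cast hj2
    have key : ∀ ψ : ℝ, 2 * φ ≤ ψ → ψ ≤ Real.pi → ‖Rf ψ τ‖ ≤ (C1 + C2 + 65 * Real.exp 4) * (1/τ.re^3 * Real.exp (A/τ.re)) := by
      intro ψ a b
      refine (h2 ψ (by linarith) b (by linarith) (by have := le_max_left (Real.pi/2 - 2 * φ) 0; linarith) τ hτ (rho_ge hτ hi ht)).trans (mul_le_mul_of_nonneg_right ?_ (by positivity))
      have := Real.exp_pos 4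
      linarith
    have e1 : 2 * Real.pi * j / c = j * φ := by rw [hφd]; ring
    have e2 : 2 * Real.pi = c * φ := by rw [hφd]; field_simp
    rw [e1]
    rcases le_total ((j:ℝ) * φ) Real.pi with h | h
    · exact key _ (mul_le_mul_of_nonneg_right hj' hφ0.le) h
    · rw [← Rf_refl]
      refine key _ ?_ ?_
      · have := mul_le_mul_of_nonneg_right hj2' hφ0.le
        rw [e2]; linarith
      · linarith
  · intro ψ τ hτ ht hi hpi
    refine (Rf_minor ψ hτ (ht.trans (by norm_num)) hpi hi).trans ?_
    refine mul_le_mul (by linarith) (mul_le_mul_of_nonneg_left (Real.exp_le_exp.2 (div_le_div_of_nonneg_right hMi hτ.le)) (by positivity)) (by positivity) (by positivity)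

end

end OPR

namespace OPR

section

open Finset MeasureTheory

lemma int_exp (k : ℤ) : ∫ θ in (-Real.pi)..Real.pi, Complex.exp ((k:ℂ) * Complex.I * θ) = if k = 0 then (2 * Real.pi : ℂ) else 0 := by
  split_ifs with h
  · subst h
    simp; ring
  · have hk : (k:ℂ) * Complex.I ≠ 0 := mul_ne_zero (by exact_mod_cast h) Complex.I_ne_zero
    rw [integral_exp_mul_complex hk]
    have : Complex.exp ((k:ℂ) * Complex.I * (Real.pi:ℝ)) = Complex.exp ((k:ℂ) * Complex.I * ((-Real.pi:ℝ):ℂ)) := by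
      rw [Complex.exp_eq_exp_iff_exists_int]
      refine ⟨k, ?_⟩
      push_cast; ring
    rw [this, sub_self, zero_div]

lemma coeff_int (D : ℕ → ℝ) (Z : ℂ → ℂ) (hZ : ∀ τ : ℂ, 0 < τ.re → HasSum (fun n => (D n : ℂ) * Complex.exp (-τ)^n) (Z τ))
    {t : ℝ} (ht : 0 < t) (n : ℕ) :
    ∫ θ in (-Real.pi)..Real.pi, Z (t + θ * Complex.I) * Complex.exp (n * (t + θ * Complex.I)) = 2 * Real.pi * (D n : ℂ) := by
  have hre : ∀ θ : ℝ, ((t:ℂ) + θ * Complex.I).re = t := by intro θ; simp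
  have h1 := (hZ t (by simpa using ht)).summable.norm
  have hn : ∀ (m : ℕ) (θ : ℝ), ‖(D m : ℂ) * Complex.exp (-((t:ℂ) + θ * Complex.I))^m‖ = ‖(D m : ℂ) * Complex.exp (-(t:ℂ))^m‖ := by
    intro m θ
    rw [norm_mul, norm_mul, norm_pow, norm_pow, norm_q, norm_q, hre, Complex.ofReal_re]
  have key := intervalIntegral.hasSum_integral_of_dominated_convergence (μ := volume) (a := -Real.pi) (b := Real.pi)
    (F := fun (m : ℕ) (θ : ℝ) => (D m : ℂ) * Complex.exp (-((t:ℂ) + θ * Complex.I))^m * Complex.exp (n * (t + θ * Complex.I)))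
    (f := fun θ : ℝ => Z (t + θ * Complex.I) * Complex.exp (n * (t + θ * Complex.I)))
    (fun m _ => ‖(D m : ℂ) * Complex.exp (-(t:ℂ))^m‖ * Real.exp (n * t))
    (fun m => (by fun_prop : Continuous _).aestronglyMeasurable)
    (fun m => Filter.Eventually.of_forall fun θ _ => by
      rw [norm_mul, hn, Complex.norm_exp]
      refine le_of_eq ?_
      congr 2
      simp)
    (Filter.Eventually.of_forall fun θ _ => h1.mul_right _)
    (by simp)
    (Filter.Eventually.of_forall fun θ _ => (hZ _ (by rw [hre]; exact ht)).mul_right _)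
  have hI : ∀ m : ℕ, ∫ θ in (-Real.pi)..Real.pi, (D m : ℂ) * Complex.exp (-((t:ℂ) + θ * Complex.I))^m * Complex.exp (n * (t + θ * Complex.I))
      = if m = n then 2 * Real.pi * (D n : ℂ) else 0 := by
    intro m
    have e : ∀ θ : ℝ, (D m : ℂ) * Complex.exp (-((t:ℂ) + θ * Complex.I))^m * Complex.exp (n * (t + θ * Complex.I))
      = ((D m : ℂ) * Complex.exp (((n:ℂ) - m) * t)) * Complex.exp ((((n:ℤ) - (m:ℤ) : ℤ) : ℂ) * Complex.I * θ) := by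
      intro θ
      rw [← Complex.exp_nat_mul, mul_assoc, mul_assoc, ← Complex.exp_add, ← Complex.exp_add]
      congr 2
      push_cast; ring
    simp only [e]
    rw [intervalIntegral.integral_const_mul, int_exp]
    by_cases h : m = n
    · subst h; simp; ring
    · rw [if_neg h, if_neg (by omega), mul_zero]
  simp only [hI] at key
  have h2 := hasSum_ite_eq n (2 * Real.pi * (D n : ℂ))
  exact key.unique h2

lemma sg_polar {τ : ℂ} (hτ : 0 < τ.re) : ∃ ψ : ℝ, |ψ| ≤ Real.pi/4 ∧ sg τ = ((√(Real.pi/‖τ‖) : ℝ):ℂ) * Complex.exp (ψ * Complex.I) := by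
  have hp := Real.pi_pos
  have hn : 0 < ‖τ‖ := lt_of_lt_of_le hτ (Complex.re_le_norm τ)
  have h0 : τ ≠ 0 := norm_pos_iff.1 hn
  set w : ℂ := Real.pi / (τ/4) with hw
  have hw0 : w ≠ 0 := by
    rw [hw]; refine div_ne_zero (by exact_mod_cast hp.ne') (div_ne_zero h0 (by norm_num))
  have hwn : ‖w‖ = 4 * (Real.pi / ‖τ‖) := by
    rw [hw, norm_div, norm_div, Complex.norm_real, Real.norm_of_nonneg hp.le]; norm_num; field_simp
  have hwre : 0 ≤ w.re := by
    have : w = ((4 * Real.pi : ℝ):ℂ) * τ⁻¹ := by rw [hw]; push_cast; field_simp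
    rw [this, Complex.re_ofReal_mul, Complex.inv_re]
    have := Complex.normSq_nonneg τ
    positivity
  refine ⟨Complex.arg w / 2, ?_, ?_⟩
  · have := Complex.abs_arg_le_pi_div_two_iff.2 hwre
    rw [abs_div, abs_two]; linarith
  · rw [sg, ← hw, Complex.cpow_def_of_ne_zero hw0]
    have e : Complex.log w * (1/2:ℂ) = ((Real.log ‖w‖ / 2 : ℝ):ℂ) + ((Complex.arg w / 2 : ℝ):ℂ) * Complex.I := by
      rw [Complex.log]; push_cast; ring
    rw [e, Complex.exp_add, ← Complex.ofReal_exp, ← mul_assoc]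
    congr 1
    have e2 : Real.exp (Real.log ‖w‖/2) = 2 * √(Real.pi/‖τ‖) := by
      rw [Real.exp_half, Real.exp_log (norm_pos_iff.2 hw0), hwn, Real.sqrt_mul (by norm_num), show (4:ℝ) = 2^2 by norm_num, Real.sqrt_sq (by norm_num)]
    rw [e2]; push_cast; ring

lemma expo {N t X B y : ℝ} (ht : 0 < t) (h1 : N * t = X) (h2 : B^2 = X * t) :
    (N:ℂ) * (t + ((t * y : ℝ):ℂ) * Complex.I) + (B:ℂ)^2 / (t + ((t * y : ℝ):ℂ) * Complex.I)
      = ((X * (1 + 1/(1+y^2)) : ℝ):ℂ) + ((X * (y^3/(1+y^2)) : ℝ):ℂ) * Complex.I := by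
  have ht' : (t:ℂ) ≠ 0 := by exact_mod_cast ht.ne'
  have hy : (1 + (y:ℂ)^2) ≠ 0 := by exact_mod_cast (by positivity : (1 + y^2) ≠ 0)
  have hm : (1 + (y:ℂ) * Complex.I) * (1 - y * Complex.I) = 1 + (y:ℂ)^2 := by
    linear_combination (-(y:ℂ)^2) * Complex.I_sq
  have hs : (1 + (y:ℂ) * Complex.I) ≠ 0 := fun h => hy (by rw [← hm, h, zero_mul])
  have e1 : (t:ℂ) + ((t * y : ℝ):ℂ) * Complex.I = t * (1 + y * Complex.I) := by push_cast; ring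
  have e2 : (B:ℂ)^2 / (t * (1 + y * Complex.I)) = X * ((1 - y * Complex.I) / (1 + (y:ℂ)^2)) := by
    rw [show (B:ℂ)^2 = X * t by exact_mod_cast h2, ← hm]
    have : (1 - (y:ℂ) * Complex.I) ≠ 0 := fun h => hy (by rw [← hm, h, mul_zero])
    field_simp
  rw [e1, e2, ← mul_assoc, show (N:ℂ) * t = X by exact_mod_cast h1]
  push_cast
  field_simp
  ring

lemma main_re {N t X B y : ℝ} (ht : 0 < t) (h1 : N * t = X) (h2 : B^2 = X * t) :
    ∃ ψ : ℝ, |ψ| ≤ Real.pi/4 ∧ (sg (t + ((t * y : ℝ):ℂ) * Complex.I) * Complex.exp ((B:ℂ)^2 / (t + ((t * y : ℝ):ℂ) * Complex.I)) *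
       Complex.exp (N * (t + ((t * y : ℝ):ℂ) * Complex.I))).re
      = √(Real.pi / ‖(t:ℂ) + ((t * y : ℝ):ℂ) * Complex.I‖) * Real.exp (X * (1 + 1/(1+y^2))) * Real.cos (ψ + X * (y^3/(1+y^2))) := by
  obtain ⟨ψ, hψ, e⟩ := sg_polar (τ := (t:ℂ) + ((t * y : ℝ):ℂ) * Complex.I) (by simpa using ht)
  refine ⟨ψ, hψ, ?_⟩
  rw [mul_assoc, ← Complex.exp_add, add_comm (_ / _), expo ht h1 h2, e, Complex.exp_add]
  set R := √(Real.pi / ‖(t:ℂ) + ((t * y : ℝ):ℂ) * Complex.I‖)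
  have : (R:ℂ) * Complex.exp (ψ * Complex.I) * (Complex.exp ((X * (1 + 1/(1+y^2)) : ℝ):ℂ) * Complex.exp (((X * (y^3/(1+y^2)) : ℝ):ℂ) * Complex.I))
     = ((R * Real.exp (X * (1 + 1/(1+y^2))) : ℝ):ℂ) * Complex.exp (((ψ + X * (y^3/(1+y^2)) : ℝ):ℂ) * Complex.I) := by
    rw [Complex.ofReal_add ψ, add_mul, Complex.exp_add, Complex.ofReal_mul R, Complex.ofReal_exp]; ring
  rw [this, Complex.re_ofReal_mul, Complex.exp_ofReal_mul_I_re]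

lemma main_pt {N t x B y : ℝ} (hx : 5 ≤ x) (ht : 0 < t) (h1 : N * t = x^5) (h2 : B^2 = x^5 * t) :
    (if |y| ≤ 1/x^3 then √(Real.pi/t)/4 * Real.exp (2 * x^5 - 1) else 0) - √(Real.pi/t) * Real.exp (2 * x^5 - x/2) ≤
     (sg (t + ((t * y : ℝ):ℂ) * Complex.I) * Complex.exp ((B:ℂ)^2 / (t + ((t * y : ℝ):ℂ) * Complex.I)) *
       Complex.exp (N * (t + ((t * y : ℝ):ℂ) * Complex.I))).re := by
  have hp := Real.pi_pos
  have hp4 := Real.pi_lt_d2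
  obtain ⟨ψ, hψ, e⟩ := main_re (y := y) ht h1 h2
  rw [e]
  have hx0 : 0 < x := by linarith
  set n := ‖(t:ℂ) + ((t * y : ℝ):ℂ) * Complex.I‖
  have hn : t ≤ n := by
    have := Complex.re_le_norm ((t:ℂ) + ((t * y : ℝ):ℂ) * Complex.I)
    have hr : ((t:ℂ) + ((t * y : ℝ):ℂ) * Complex.I).re = t := by simp
    rw [hr] at this; exact this
  have hn0 : 0 < n := by linarith
  have hU : √(Real.pi/n) ≤ √(Real.pi/t) := Real.sqrt_le_sqrt (div_le_div_of_nonneg_left hp.le ht hn)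
  have eX : x^5 * (1 + 1/(1+y^2)) = 2 * x^5 - x^5 * (y^2/(1+y^2)) := by field_simp; ring
  rw [eX]
  have hU0 := Real.sqrt_nonneg (Real.pi/t)
  have hn00 := Real.sqrt_nonneg (Real.pi/n)
  rcases le_or_gt (|y|) (1/x^2) with hy | hy
  · have hcos : 1/2 ≤ Real.cos (ψ + x^5 * (y^3/(1+y^2))) := by
      have a1 : |x^5 * (y^3/(1+y^2))| ≤ 1/5 := by
        rw [abs_mul, abs_div, abs_pow, abs_pow, abs_of_pos hx0, abs_of_pos (by positivity : 0 < 1+y^2)]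
        have a2 : |y|^3/(1+y^2) ≤ |y|^3 := div_le_self (by positivity) (by nlinarith [sq_nonneg y])
        have a3 : |y|^3 ≤ (1/x^2)^3 := pow_le_pow_left₀ (abs_nonneg _) hy 3
        calc _ ≤ x^5 * (1/x^2)^3 := mul_le_mul_of_nonneg_left (a2.trans a3) (by positivity)
          _ = 1/x := by field_simp
          _ ≤ 1/5 := div_le_div_of_nonneg_left (by norm_num) (by norm_num) hx
      have a4 : |ψ + x^5 * (y^3/(1+y^2))| ≤ 1 := (abs_add_le _ _).trans (by linarith)
      have a5 := Real.one_sub_sq_div_two_le_cos (x := ψ + x^5 * (y^3/(1+y^2)))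
      have a6 : (ψ + x^5 * (y^3/(1+y^2)))^2 ≤ 1 := by rw [sq_le_one_iff_abs_le_one]; exact a4
      linarith
    have hpos : 0 ≤ √(Real.pi/t) * Real.exp (2 * x^5 - x/2) := by positivity
    split_ifs with h
    · have b1 : √(Real.pi/t)/2 ≤ √(Real.pi/n) := by
        have b2 : n ≤ 4 * t := by
          have : n ≤ t + t * |y| := by
            refine (norm_add_le _ _).trans ?_
            rw [norm_mul, Complex.norm_I, mul_one, Complex.norm_real, Complex.norm_real, Real.norm_of_nonneg ht.le, Real.norm_eq_abs, abs_mul, abs_of_pos ht]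
          have b3 : |y| ≤ 1 := hy.trans (by rw [div_le_one (by positivity)]; nlinarith)
          nlinarith
        refine Real.le_sqrt_of_sq_le ?_
        rw [div_pow, Real.sq_sqrt (by positivity), div_div, div_le_div_iff₀ (by positivity) hn0]
        nlinarith
      have b4 : Real.exp (2 * x^5 - 1) ≤ Real.exp (2 * x^5 - x^5 * (y^2/(1+y^2))) := by
        rw [Real.exp_le_exp]
        have b5 : y^2/(1+y^2) ≤ y^2 := div_le_self (by positivity) (by nlinarith [sq_nonneg y])
        have b6 : y^2 ≤ (1/x^3)^2 := by rw [← sq_abs]; exact pow_le_pow_left₀ (abs_nonneg _) h 2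
        have : x^5 * (y^2/(1+y^2)) ≤ 1 := by
          calc _ ≤ x^5 * (1/x^3)^2 := mul_le_mul_of_nonneg_left (b5.trans b6) (by positivity)
            _ = 1/x := by field_simp
            _ ≤ 1 := by rw [div_le_one hx0]; linarith
        linarith
      have b7 : √(Real.pi/t)/2 * Real.exp (2 * x^5 - 1) * (1/2) ≤ √(Real.pi/n) * Real.exp (2 * x^5 - x^5 * (y^2/(1+y^2))) * Real.cos (ψ + x^5 * (y^3/(1+y^2))) :=
        mul_le_mul (mul_le_mul b1 b4 (by positivity) hn00) hcos (by norm_num) (by positivity)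
      linarith
    · have : 0 ≤ √(Real.pi/n) * Real.exp (2 * x^5 - x^5 * (y^2/(1+y^2))) * Real.cos (ψ + x^5 * (y^3/(1+y^2))) := by
        have : 0 ≤ Real.cos (ψ + x^5 * (y^3/(1+y^2))) := by linarith
        positivity
      linarith
  · have hne : ¬ (|y| ≤ 1/x^3) := by
      rw [not_le]
      refine lt_of_le_of_lt (div_le_div_of_nonneg_left (by norm_num) (by positivity) ?_) hy
      exact pow_le_pow_right₀ (by linarith) (by norm_num)
    rw [if_neg hne, zero_sub]
    have c1 : Real.exp (2 * x^5 - x^5 * (y^2/(1+y^2))) ≤ Real.exp (2 * x^5 - x/2) := by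
      rw [Real.exp_le_exp]
      have c2 : (1/x^2)^2 ≤ y^2 := by rw [← sq_abs y]; exact pow_le_pow_left₀ (by positivity) hy.le 2
      have c3 : 1/(2*x^4) ≤ y^2/(1+y^2) := by
        rw [div_le_div_iff₀ (by positivity) (by positivity)]
        have c4 : 1 ≤ x^4 * y^2 := by
          calc 1 = x^4 * (1/x^2)^2 := by field_simp
            _ ≤ _ := mul_le_mul_of_nonneg_left c2 (by positivity)
        have c5 : 1 ≤ x^4 := one_le_pow₀ (by linarith)
        nlinarith [sq_nonneg y]
      have c6 : x^5 * (1/(2*x^4)) = x/2 := by field_simp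
      have := mul_le_mul_of_nonneg_left c3 (by positivity : 0 ≤ x^5)
      linarith
    have c7 : √(Real.pi/n) * Real.exp (2 * x^5 - x^5 * (y^2/(1+y^2))) ≤ √(Real.pi/t) * Real.exp (2 * x^5 - x/2) :=
      mul_le_mul hU c1 (by positivity) hU0
    have c8 := Real.neg_one_le_cos (ψ + x^5 * (y^3/(1+y^2)))
    have c9 : 0 ≤ √(Real.pi/n) * Real.exp (2 * x^5 - x^5 * (y^2/(1+y^2))) := by positivity
    nlinarith

end

end OPR

namespace OPR

section

open Finset MeasureTheory

lemma ev {K B C δ : ℝ} (hK : 0 < K) (hB : 0 < B) (hC : 0 < C) (hδ : 0 < δ) :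
    ∀ᶠ x : ℝ in Filter.atTop, 2 * Real.pi * (K * Real.exp (-(x/2)) + C * ((x^5/B^2)^3 * Real.exp (-(δ * (x^5/B^2))))) < K * B^2 / (2 * Real.exp 1 * x^8) := by
  have hp := Real.pi_pos
  have h1 : Filter.Tendsto (fun x : ℝ => x^8 / Real.exp (1/2 * x)) Filter.atTop (nhds 0) :=
    (isLittleO_pow_exp_pos_mul_atTop 8 (by norm_num)).tendsto_div_nhds_zero
  have h2 : Filter.Tendsto (fun x : ℝ => x^23 / Real.exp (δ/B^2 * x)) Filter.atTop (nhds 0) :=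
    (isLittleO_pow_exp_pos_mul_atTop 23 (by positivity)).tendsto_div_nhds_zero
  have h3 := (h1.const_mul (2 * Real.pi * K)).add (h2.const_mul (2 * Real.pi * (C / B^6)))
  rw [mul_zero, mul_zero, add_zero] at h3
  have h4 := h3.eventually_lt_const (by positivity : 0 < K * B^2 / (2 * Real.exp 1))
  filter_upwards [h4, Filter.eventually_ge_atTop 1] with x hx hx1
  have hx0 : 0 < x := by linarith
  have e0 : Real.exp (-(δ * (x^5/B^2))) ≤ (Real.exp (δ/B^2 * x))⁻¹ := by
    rw [← Real.exp_neg, Real.exp_le_exp, neg_le_neg_iff]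
    have : x ≤ x^5 := le_self_pow₀ hx1 (by norm_num)
    have := mul_le_mul_of_nonneg_left this (by positivity : 0 ≤ δ/B^2)
    calc _ ≤ _ := this
      _ = _ := by ring
  have e1 : Real.exp (-(x/2)) = (Real.exp (1/2 * x))⁻¹ := by rw [← Real.exp_neg]; congr 1; ring
  rw [← div_div, lt_div_iff₀ (by positivity), e1]
  refine lt_of_le_of_lt ?_ hx
  have e2 : C * ((x^5/B^2)^3 * Real.exp (-(δ * (x^5/B^2)))) ≤ C * ((x^5/B^2)^3 * (Real.exp (δ/B^2 * x))⁻¹) :=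
    mul_le_mul_of_nonneg_left (mul_le_mul_of_nonneg_left e0 (by positivity)) hC.le
  have e3 : 2 * Real.pi * (K * (Real.exp (1/2 * x))⁻¹ + C * ((x^5/B^2)^3 * Real.exp (-(δ * (x^5/B^2))))) * x^8 ≤
     2 * Real.pi * (K * (Real.exp (1/2 * x))⁻¹ + C * ((x^5/B^2)^3 * (Real.exp (δ/B^2 * x))⁻¹)) * x^8 := by
    refine mul_le_mul_of_nonneg_right (mul_le_mul_of_nonneg_left ?_ (by positivity)) (by positivity)
    linarith
  refine e3.trans (le_of_eq ?_)
  have := Real.exp_pos (δ/B^2 * x)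
  have := Real.exp_pos (1/2 * x)
  generalize Real.exp (δ/B^2 * x) = A1 at *
  generalize Real.exp (1/2 * x) = A2 at *
  field_simp

lemma int_step {a b h : ℝ} (h0 : 0 < h) (h1 : h ≤ Real.pi) :
    IntervalIntegrable (fun θ => (Set.Ioc (-h) h).indicator (fun _ => a) θ - b) volume (-Real.pi) Real.pi ∧
    ∫ θ in (-Real.pi)..Real.pi, ((Set.Ioc (-h) h).indicator (fun _ => a) θ - b) = 2 * h * a - 2 * Real.pi * b := by
  have hp := Real.pi_pos
  have i1 : IntervalIntegrable (fun θ => (Set.Ioc (-h) h).indicator (fun _ => a) θ) volume (-Real.pi) Real.pi := by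
    rw [intervalIntegrable_iff]
    refine IntegrableOn.indicator ?_ measurableSet_Ioc
    exact (intervalIntegrable_iff.1 (intervalIntegrable_const (c := a)))
  refine ⟨i1.sub intervalIntegrable_const, ?_⟩
  rw [intervalIntegral.integral_sub i1 intervalIntegrable_const, intervalIntegral.integral_const, intervalIntegral.integral_of_le (by linarith),
    setIntegral_indicator measurableSet_Ioc, Set.inter_eq_right.2 (Set.Ioc_subset_Ioc (by linarith) h1), setIntegral_const, Real.volume_real_Ioc_of_le (by linarith)]
  simp only [smul_eq_mul]; ring

lemma circle_low (D : ℕ → ℝ) (Z : ℂ → ℂ) (hZ : ∀ τ : ℂ, 0 < τ.re → HasSum (fun n => (D n : ℂ) * Complex.exp (-τ)^n) (Z τ))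
    (hcont : ContinuousOn Z HP) {B C K δ t0 : ℝ} (hC : 0 < C) (hK : 0 < K)
    (h1 : ∀ τ : ℂ, 0 < τ.re → τ.re ≤ t0 → |τ.im| ≤ 4000 * τ.re →
      ‖Z τ - (K:ℝ) * (sg τ * Complex.exp ((B:ℂ)^2/τ))‖ ≤ C * (1/τ.re^3 * Real.exp ((B^2 - δ)/τ.re)))
    (h2 : ∀ τ : ℂ, 0 < τ.re → τ.re ≤ t0 → 4000 * τ.re ≤ |τ.im| → |τ.im| ≤ Real.pi →
      ‖Z τ‖ ≤ C * (1/τ.re^3 * Real.exp ((B^2 - δ)/τ.re)))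
    {t x : ℝ} (n : ℕ) (hx : 5 ≤ x) (ht : 0 < t) (ht0 : t ≤ t0) (ht1 : t ≤ 1) (e1 : n * t = x^5) (e2 : B^2 = x^5 * t) :
    2 * (t/x^3) * (K * (√(Real.pi/t)/4 * Real.exp (2 * x^5 - 1))) - 2 * Real.pi * (K * (√(Real.pi/t) * Real.exp (2 * x^5 - x/2)) + C * (1/t^3 * Real.exp (2 * x^5 - δ / t))) ≤ 2 * Real.pi * D n := by
  have hp := Real.pi_pos
  have hp3 := Real.pi_gt_three
  have hx0 : 0 < x := by linarith
  have hx3 : 1 ≤ x^3 := one_le_pow₀ (by linarith)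
  have hh0 : 0 < t/x^3 := by positivity
  have hht : t/x^3 ≤ t := div_le_self ht.le hx3
  obtain ⟨i1, I1⟩ := int_step (a := K * (√(Real.pi/t)/4 * Real.exp (2 * x^5 - 1))) (b := K * (√(Real.pi/t) * Real.exp (2 * x^5 - x/2)) + C * (1/t^3 * Real.exp (2 * x^5 - δ / t))) hh0 (by linarith)
  rw [← I1]
  have hre : ∀ θ : ℝ, ((t:ℂ) + θ * Complex.I).re = t := by intro θ; simp
  have him : ∀ θ : ℝ, ((t:ℂ) + θ * Complex.I).im = θ := by intro θ; simp
  have hG : Continuous (fun θ : ℝ => Z (t + θ * Complex.I) * Complex.exp (n * (t + θ * Complex.I))) := by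
    refine Continuous.mul ?_ (by fun_prop)
    refine hcont.comp_continuous (by fun_prop) fun θ => ?_
    show 0 < ((t:ℂ) + θ * Complex.I).re
    rw [hre]; exact ht
  have hI := coeff_int D Z hZ ht n
  have hI2 : ∫ θ in (-Real.pi)..Real.pi, (Z (t + θ * Complex.I) * Complex.exp (n * (t + θ * Complex.I))).re = 2 * Real.pi * D n := by
    have := congrArg Complex.re hI
    rw [show (2 * (Real.pi:ℂ) * (D n : ℂ)) = ((2 * Real.pi * D n : ℝ):ℂ) by push_cast; ring, Complex.ofReal_re] at this
    rw [← this]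
    exact Complex.reCLM.intervalIntegral_comp_comm (hG.intervalIntegrable _ _)
  rw [← hI2]
  refine intervalIntegral.integral_mono_on (by linarith) i1 ((Complex.continuous_re.comp hG).intervalIntegrable _ _) fun θ hθ => ?_
  have hθ' : |θ| ≤ Real.pi := abs_le.2 hθ
  have hne : ‖Complex.exp (n * ((t:ℂ) + θ * Complex.I))‖ = Real.exp (x^5) := by
    rw [Complex.norm_exp, ← e1]; congr 1; simp
  have herr : ∀ w : ℂ, ‖w‖ ≤ C * (1/t^3 * Real.exp ((B^2 - δ)/t)) → ‖w * Complex.exp (n * ((t:ℂ) + θ * Complex.I))‖ ≤ C * (1/t^3 * Real.exp (2 * x^5 - δ / t)) := by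
    intro w hw
    rw [norm_mul, hne]
    have := mul_le_mul_of_nonneg_right hw (Real.exp_pos (x^5)).le
    refine this.trans (le_of_eq ?_)
    rw [mul_assoc, mul_assoc, ← Real.exp_add]
    congr 3
    rw [e2]; field_simp; ring
  have hpos1 : 0 ≤ K * (√(Real.pi/t) * Real.exp (2 * x^5 - x/2)) := by positivity
  rcases le_total (|θ|) (4000 * t) with hc | hc
  · have a1 := herr _ (by have := h1 (t + θ * Complex.I) (by rw [hre]; exact ht) (by rw [hre]; exact ht0) (by rw [hre, him]; exact hc); rw [hre] at this; exact this)
    have a2 := main_pt (y := θ/t) (B := B) (N := n) hx ht e1 e2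
    rw [mul_div_cancel₀ _ ht.ne'] at a2
    have a3 : Z (t + θ * Complex.I) * Complex.exp (n * (t + θ * Complex.I)) =
       (Z (t + θ * Complex.I) - (K:ℝ) * (sg (t + θ * Complex.I) * Complex.exp ((B:ℂ)^2/(t + θ * Complex.I)))) * Complex.exp (n * (t + θ * Complex.I))
       + (K:ℝ) * (sg (t + θ * Complex.I) * Complex.exp ((B:ℂ)^2/(t + θ * Complex.I)) * Complex.exp (((n:ℝ):ℂ) * (t + θ * Complex.I))) := by
      push_cast; ring
    rw [a3, Complex.add_re, Complex.re_ofReal_mul]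
    have a4 := (abs_le.1 ((Complex.abs_re_le_norm _).trans a1)).1
    have a5 := mul_le_mul_of_nonneg_left a2 hK.le
    have a6 : (Set.Ioc (-(t/x^3)) (t/x^3)).indicator (fun _ => K * (√(Real.pi/t)/4 * Real.exp (2 * x^5 - 1))) θ ≤
      K * (if |θ/t| ≤ 1/x^3 then √(Real.pi/t)/4 * Real.exp (2 * x^5 - 1) else 0) := by
      by_cases hm : θ ∈ Set.Ioc (-(t/x^3)) (t/x^3)
      · have : |θ/t| ≤ 1/x^3 := by
          rw [abs_div, abs_of_pos ht, div_le_iff₀ ht]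
          refine (abs_le.2 ⟨hm.1.le, hm.2⟩).trans (le_of_eq (by ring))
        rw [Set.indicator_of_mem hm, if_pos this]
      · rw [Set.indicator_of_notMem hm]
        split_ifs <;> positivity
    rw [mul_sub] at a5
    linarith
  · have a1 := herr _ (by have := h2 (t + θ * Complex.I) (by rw [hre]; exact ht) (by rw [hre]; exact ht0) (by rw [hre, him]; exact hc) (by rw [him]; exact hθ'); rw [hre] at this; exact this)
    have a4 := (abs_le.1 ((Complex.abs_re_le_norm _).trans a1)).1
    have hm : θ ∉ Set.Ioc (-(t/x^3)) (t/x^3) := by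
      intro hm
      have := abs_le.2 ⟨hm.1.le, hm.2⟩
      linarith
    rw [Set.indicator_of_notMem hm]
    linarith

theorem circle (D : ℕ → ℝ) (Z : ℂ → ℂ) (hZ : ∀ τ : ℂ, 0 < τ.re → HasSum (fun n => (D n : ℂ) * Complex.exp (-τ)^n) (Z τ))
    (hcont : ContinuousOn Z HP) {B C K δ t0 : ℝ} (hB : 0 < B) (hC : 0 < C) (hK : 0 < K) (hδ : 0 < δ) (h00 : 0 < t0) (h01 : t0 ≤ 1)
    (h1 : ∀ τ : ℂ, 0 < τ.re → τ.re ≤ t0 → |τ.im| ≤ 4000 * τ.re →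
      ‖Z τ - (K:ℝ) * (sg τ * Complex.exp ((B:ℂ)^2/τ))‖ ≤ C * (1/τ.re^3 * Real.exp ((B^2 - δ)/τ.re)))
    (h2 : ∀ τ : ℂ, 0 < τ.re → τ.re ≤ t0 → 4000 * τ.re ≤ |τ.im| → |τ.im| ≤ Real.pi →
      ‖Z τ‖ ≤ C * (1/τ.re^3 * Real.exp ((B^2 - δ)/τ.re))) :
    ∃ N : ℕ, ∀ n : ℕ, N < n → 0 < D n := by
  have hp := Real.pi_pos
  have hp3 := Real.pi_gt_three
  have t1 : Filter.Tendsto (fun n : ℕ => (B * √(n:ℝ))^(1/5:ℝ)) Filter.atTop Filter.atTop :=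
    (tendsto_rpow_atTop (by norm_num)).comp ((Real.tendsto_sqrt_atTop.comp tendsto_natCast_atTop_atTop).const_mul_atTop hB)
  have t2 := t1.eventually ((ev hK hB hC hδ).and ((Filter.eventually_ge_atTop 5).and (Filter.eventually_ge_atTop (B^2/t0))))
  obtain ⟨N, hN⟩ := Filter.eventually_atTop.1 t2
  refine ⟨N, fun n hn => ?_⟩
  obtain ⟨h3, hx, hxt⟩ := hN n hn.le
  have hn0 : (0:ℝ) < n := by exact_mod_cast (lt_of_le_of_lt (Nat.zero_le _) hn)
  set x := (B * √(n:ℝ))^(1/5:ℝ) with hxd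
  have hx5 : x^5 = B * √(n:ℝ) := by
    rw [hxd, ← Real.rpow_natCast, ← Real.rpow_mul (by positivity)]; norm_num
  clear_value x
  have hx0 : 0 < x := by linarith
  obtain ⟨t, ht⟩ : ∃ t, t = B^2/x^5 := ⟨_, rfl⟩
  have htp : 0 < t := by rw [ht]; positivity
  have htt : t ≤ t0 := by
    rw [ht, div_le_iff₀ (by positivity)]
    rw [div_le_iff₀ h00] at hxt
    have : x ≤ x^5 := le_self_pow₀ (by linarith) (by norm_num)
    nlinarith
  have e1 : n * t = x^5 := by
    have : x^5 * x^5 = B^2 * n := by rw [hx5]; nlinarith [Real.sq_sqrt hn0.le]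
    rw [ht, mul_div_assoc', div_eq_iff (by positivity), this]; ring
  have e2 : B^2 = x^5 * t := by rw [ht]; field_simp
  have key := circle_low D Z hZ hcont hC hK h1 h2 n hx htp htt (htt.trans h01) e1 e2
  have hU : 1 ≤ √(Real.pi/t) := by
    rw [Real.one_le_sqrt, le_div_iff₀ htp]; linarith
  have et : x^5/B^2 = 1/t := by rw [ht]; field_simp
  rw [et] at h3
  have f1 : Real.exp (2 * x^5 - 1) = Real.exp (2*x^5) / Real.exp 1 := Real.exp_sub _ _
  have f2 : Real.exp (2 * x^5 - x/2) = Real.exp (2*x^5) * Real.exp (-(x/2)) := by rw [← Real.exp_add]; rfl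
  have f3 : Real.exp (2 * x^5 - δ/t) = Real.exp (2*x^5) * Real.exp (-(δ * (1/t))) := by rw [← Real.exp_add]; congr 1; ring
  rw [f1, f2, f3] at key
  set U := √(Real.pi/t)
  set P := Real.exp (2*x^5)
  have hP : 0 < P := Real.exp_pos _
  have g1 : 2 * (t/x^3) * (K * (U/4 * (P / Real.exp 1))) = U * P * (K * B^2 / (2 * Real.exp 1 * x^8)) := by
    rw [ht]
    have := Real.exp_pos 1
    field_simp
    ring
  have g2 : C * (1/t^3 * (P * Real.exp (-(δ * (1/t))))) ≤ U * P * (C * ((1/t)^3 * Real.exp (-(δ * (1/t))))) := by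
    have : 0 ≤ P * (C * ((1/t)^3 * Real.exp (-(δ * (1/t))))) := by positivity
    have := mul_le_mul_of_nonneg_right hU this
    calc _ = 1 * (P * (C * ((1/t)^3 * Real.exp (-(δ * (1/t)))))) := by rw [one_div_pow]; ring
      _ ≤ _ := this
      _ = _ := by ring
  have g3 := mul_lt_mul_of_pos_left h3 (by positivity : 0 < U * P)
  rw [g1] at key
  have g4 : 2 * Real.pi * (C * (1/t^3 * (P * Real.exp (-(δ * (1/t)))))) ≤ 2 * Real.pi * (U * P * (C * ((1/t)^3 * Real.exp (-(δ * (1/t)))))) := mul_le_mul_of_nonneg_left g2 (by positivity)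
  have g5 : 0 < 2 * Real.pi * D n := by linarith
  exact pos_of_mul_pos_right g5 (by positivity)

end

end OPR

namespace OPR

section

open Finset MeasureTheory

noncomputable def vv (c a b j : ℕ) : ℝ := (Real.cos (2 * Real.pi * j / c * a) - Real.cos (2 * Real.pi * j / c * b)) / c

noncomputable def ZZ (c a b : ℕ) (τ : ℂ) : ℂ := ∑ j ∈ range c, (vv c a b j : ℂ) * Rf (2 * Real.pi * j / c) τ

lemma ZZ_hasSum {c : ℕ} (hc : 0 < c) (a b : ℕ) {τ : ℂ} (hτ : 0 < τ.re) :
    HasSum (fun n => ((((nbar a c n : ℝ) - (nbar b c n : ℝ)) : ℝ) : ℂ) * Complex.exp (-τ)^n) (ZZ c a b τ) := by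
  have h := (hasSum_nbar (exp_norm_lt hτ) a c hc).sub (hasSum_nbar (exp_norm_lt hτ) b c hc)
  rw [← Finset.sum_sub_distrib] at h
  have e : ZZ c a b τ = ∑ j ∈ range c, (((Real.cos (2 * Real.pi * j / c * (a:ℤ)) / c : ℝ) : ℂ) * TT (Complex.exp (-τ)) (wcos (2 * Real.pi * j / c)) -
     ((Real.cos (2 * Real.pi * j / c * (b:ℤ)) / c : ℝ) : ℂ) * TT (Complex.exp (-τ)) (wcos (2 * Real.pi * j / c))) := by
    refine Finset.sum_congr rfl fun j _ => ?_
    rw [vv, Rf, ← sub_mul, ← Complex.ofReal_sub, sub_div, Int.cast_natCast, Int.cast_natCast]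
  rw [e]
  have hfun : (fun n => ((((nbar a c n : ℝ) - (nbar b c n : ℝ)) : ℝ) : ℂ) * Complex.exp (-τ)^n) =
    (fun n => (nbar a c n : ℂ) * Complex.exp (-τ)^n - (nbar b c n : ℂ) * Complex.exp (-τ)^n) := by
    funext n; push_cast; ring
  rw [hfun]; exact h

lemma ZZ_cont (c a b : ℕ) : ContinuousOn (ZZ c a b) HP := by
  unfold ZZ
  exact continuousOn_finsetSum _ fun j _ => continuousOn_const.mul (Rf_diff _).continuousOn

lemma vv_zero (c a b : ℕ) : vv c a b 0 = 0 := by simp [vv]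

lemma vv_one {c a b : ℕ} (hc : 7 ≤ c) (hab : a < b) (hb : b ≤ c / 2) : 0 < vv c a b 1 := by
  have hc0 : (0:ℝ) < c := by exact_mod_cast (by omega : 0 < c)
  have hp := Real.pi_pos
  have hb2 : (2:ℝ) * b ≤ c := by exact_mod_cast (by omega : 2 * b ≤ c)
  have hab' : (a:ℝ) < b := by exact_mod_cast hab
  unfold vv
  refine div_pos (sub_pos.2 ?_) hc0
  rw [Nat.cast_one, mul_one]
  refine Real.cos_lt_cos_of_nonneg_of_le_pi (by positivity) ?_ (mul_lt_mul_of_pos_left hab' (by positivity))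
  rw [div_mul_eq_mul_div, div_le_iff₀ hc0]
  nlinarith

lemma vv_last {c a b : ℕ} (hc : 7 ≤ c) : vv c a b (c - 1) = vv c a b 1 := by
  have hc0 : (c:ℝ) ≠ 0 := by exact_mod_cast (by omega : c ≠ 0)
  have h : ∀ m : ℕ, Real.cos (2 * Real.pi * ((c - 1 : ℕ):ℝ) / c * m) = Real.cos (2 * Real.pi * ((1:ℕ):ℝ) / c * m) := by
    intro m
    rw [Nat.cast_sub (by omega), ← Real.cos_nat_mul_two_pi_sub _ m]
    congr 1
    push_cast
    field_simp
    ring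
  unfold vv
  rw [h, h]

theorem final {c a b : ℕ} (hc : 7 ≤ c) (hab : a < b) (hb : b ≤ c / 2) :
    ∃ N : ℕ, ∀ n : ℕ, N < n → nbar b c n < nbar a c n := by
  obtain ⟨C, K, δ, t0, hC, hK, hδ, h00, h01, h1, h2, h3⟩ := est hc
  have hc7 : (7:ℝ) ≤ c := by exact_mod_cast hc
  have hc0 : (0:ℝ) < c := by linarith
  have hp := Real.pi_pos
  have hB : 0 < Real.pi/2 - 2 * Real.pi/c := by
    have : 2 * Real.pi / c ≤ 2 * Real.pi / 7 := div_le_div_of_nonneg_left (by positivity) (by norm_num) hc7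
    linarith
  have hv1 := vv_one hc hab hb
  have hvl := vv_last (a := a) (b := b) hc
  have hS : 0 ≤ ∑ j ∈ range c, |vv c a b j| := Finset.sum_nonneg fun j _ => abs_nonneg _
  have hC' : 0 < (∑ j ∈ range c, |vv c a b j| + 1) * C := mul_pos (by linarith) hC
  have hK' : 0 < 2 * vv c a b 1 * K := mul_pos (mul_pos two_pos hv1) hK
  have H1 : ∀ τ : ℂ, 0 < τ.re → τ.re ≤ t0 → |τ.im| ≤ 4000 * τ.re →
      ‖ZZ c a b τ - ((2 * vv c a b 1 * K : ℝ):ℂ) * (sg τ * Complex.exp (((Real.pi/2 - 2 * Real.pi / c : ℝ):ℂ)^2/τ))‖ ≤ ((∑ j ∈ range c, |vv c a b j| + 1) * C) * (1/τ.re^3 * Real.exp (((Real.pi/2 - 2 * Real.pi / c)^2 - δ)/τ.re)) := by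
    intro τ hτ ht hi
    set E := 1/τ.re^3 * Real.exp (((Real.pi/2 - 2 * Real.pi / c)^2 - δ)/τ.re) with hEd
    have hE : 0 ≤ C * E := by positivity
    set M : ℂ := (K:ℝ) * (sg τ * Complex.exp (((Real.pi/2 - 2 * Real.pi / c : ℝ):ℂ)^2/τ)) with hM
    have a1 := h1 τ hτ ht hi
    have e : ZZ c a b τ - ((2 * vv c a b 1 * K : ℝ):ℂ) * (sg τ * Complex.exp (((Real.pi/2 - 2 * Real.pi / c : ℝ):ℂ)^2/τ))
       = ∑ j ∈ range c, (vv c a b j : ℂ) * (Rf (2 * Real.pi * j / c) τ - ((if j = 1 then M else 0) + (if j = c - 1 then M else 0))) := by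
      simp only [mul_sub, mul_add, mul_ite, mul_zero]
      rw [Finset.sum_sub_distrib, Finset.sum_add_distrib, Finset.sum_ite_eq', Finset.sum_ite_eq', if_pos (Finset.mem_range.2 (by omega)), if_pos (Finset.mem_range.2 (by omega)), hvl, ZZ, hM]
      rw [Complex.ofReal_mul, Complex.ofReal_mul, Complex.ofReal_ofNat]; ring
    rw [e]
    have b1 : ∀ j ∈ range c, ‖(vv c a b j : ℂ) * (Rf (2 * Real.pi * j / c) τ - ((if j = 1 then M else 0) + (if j = c - 1 then M else 0)))‖ ≤ |vv c a b j| * (C * E) := by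
      intro j hj
      rw [Finset.mem_range] at hj
      rw [norm_mul, Complex.norm_real, Real.norm_eq_abs]
      rcases Nat.eq_zero_or_pos j with h0 | h0
      · subst h0; rw [vv_zero]; simp
      refine mul_le_mul_of_nonneg_left ?_ (abs_nonneg _)
      by_cases hj1 : j = 1
      · rw [if_pos hj1, if_neg (by omega), add_zero, hj1, Nat.cast_one, mul_one]; exact a1
      by_cases hjl : j = c - 1
      · rw [if_neg hj1, if_pos hjl, zero_add, hjl]
        have : 2 * Real.pi * ((c - 1 : ℕ):ℝ) / c = 2 * Real.pi - 2 * Real.pi / c := by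
          rw [Nat.cast_sub (by omega)]; push_cast; field_simp
        rw [this, Rf_refl]; exact a1
      · rw [if_neg hj1, if_neg hjl, add_zero, sub_zero]
        exact h2 j (by omega) (by omega) τ hτ ht hi
    refine (norm_sum_le_of_le _ b1).trans ?_
    rw [← Finset.sum_mul, mul_assoc]
    exact mul_le_mul_of_nonneg_right (by linarith) hE
  have H2 : ∀ τ : ℂ, 0 < τ.re → τ.re ≤ t0 → 4000 * τ.re ≤ |τ.im| → |τ.im| ≤ Real.pi →
      ‖ZZ c a b τ‖ ≤ ((∑ j ∈ range c, |vv c a b j| + 1) * C) * (1/τ.re^3 * Real.exp (((Real.pi/2 - 2 * Real.pi / c)^2 - δ)/τ.re)) := by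
    intro τ hτ ht hi hpi
    have hE : 0 ≤ C * (1/τ.re^3 * Real.exp (((Real.pi/2 - 2 * Real.pi / c)^2 - δ)/τ.re)) := by positivity
    have b1 : ∀ j ∈ range c, ‖(vv c a b j : ℂ) * Rf (2 * Real.pi * j / c) τ‖ ≤ |vv c a b j| * (C * (1/τ.re^3 * Real.exp (((Real.pi/2 - 2 * Real.pi / c)^2 - δ)/τ.re))) := by
      intro j _
      rw [norm_mul, Complex.norm_real, Real.norm_eq_abs]
      exact mul_le_mul_of_nonneg_left (h3 _ τ hτ ht hi hpi) (abs_nonneg _)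
    refine (norm_sum_le_of_le _ b1).trans ?_
    rw [← Finset.sum_mul, mul_assoc]
    exact mul_le_mul_of_nonneg_right (by linarith) hE
  obtain ⟨N, hN⟩ := circle (fun n => (nbar a c n : ℝ) - (nbar b c n : ℝ)) (ZZ c a b)
    (fun τ hτ => ZZ_hasSum (by omega) a b hτ) (ZZ_cont c a b) (B := Real.pi/2 - 2 * Real.pi/c)
    (C := (∑ j ∈ range c, |vv c a b j| + 1) * C) (K := 2 * vv c a b 1 * K) (δ := δ) (t0 := t0) hB hC' hK' hδ h00 h01
    H1 H2
  refine ⟨N, fun n hn => ?_⟩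
  have := hN n hn
  have : (nbar b c n : ℝ) < nbar a c n := by linarith
  exact_mod_cast this

end

end OPR

theorem stmt0 (c a b : ℕ) (hc : 7 ≤ c) (hab : a < b) (hb : b ≤ c / 2) :
    ∃ N : ℕ, ∀ n : ℕ, N < n → nbar b c n < nbar a c n := by
  exact OPR.final hc hab hb
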